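/- Let Ω ⊂ ℝ^d be an open set, let 𝒜 be a k-th order linear constant-coefficient partial differential operator with k ≥ 1 and coefficients A_α ∈ ℝ^{n×m}, let μ be a finite ℝ^m-valued Radon measure on Ω, and let σ be a finite ℝ^n-valued Radon measure on Ω such that 𝒜μ = σ in the sense of distributions. Then the polar dμ/d|μ|(x) belongs to the wave cone Λ_𝒜 for |μ^s|-almost every x ∈ Ω. -/

import Mathlib

open MeasureTheory Metric

/-- The partial derivative `∂_i φ` of a scalar function on `ℝ^d`. -/
noncomputable def pderiv' {d : ℕ} (i : Fin d) (φ : EuclideanSpace ℝ (Fin d) → ℝ) :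
    EuclideanSpace ℝ (Fin d) → ℝ :=
  fun x => fderiv ℝ φ x (EuclideanSpace.single i 1)

/-- The iterated partial derivative `∂^α φ` for a multi-index `α`. -/
noncomputable def pderivMulti {d : ℕ} (α : Fin d → ℕ) (φ : EuclideanSpace ℝ (Fin d) → ℝ) :
    EuclideanSpace ℝ (Fin d) → ℝ :=
  (List.finRange d).foldr (fun i ψ => (pderiv' i)^[α i] ψ) φ

/-- The finite set of multi-indices `α` with `|α| ≤ k`. -/
def multiIdxLe (d k : ℕ) : Finset (Fin d → ℕ) :=
  (Fintype.piFinset fun _ : Fin d => Finset.range (k + 1)).filter fun α => ∑ i, α i ≤ k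

/-- The finite set of multi-indices `α` with `|α| = k`. -/
def multiIdxEq (d k : ℕ) : Finset (Fin d → ℕ) :=
  (Fintype.piFinset fun _ : Fin d => Finset.range (k + 1)).filter fun α => ∑ i, α i = k

/-- The wave cone `Λ_𝒜` of the `k`-th order operator with coefficients `A`. -/
def waveCone {d m n : ℕ} (k : ℕ) (A : (Fin d → ℕ) → Matrix (Fin n) (Fin m) ℝ) :
    Set (Fin m → ℝ) :=
  {v | ∃ ξ : Fin d → ℝ, ξ ≠ 0 ∧ ∀ i : Fin n,
    ∑ α ∈ multiIdxEq d k, (∏ l, ξ l ^ α l) * ∑ j, A α i j * v j = 0}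

section Kernels

open Module SchwartzMap

variable {E : Type*} [NormedAddCommGroup E] [InnerProductSpace ℝ E]

/-- The `L¹`-normalised dyadic dilation `2^{ld} k(2^l x)`. -/
noncomputable def dilate (l : ℕ) (k : E → ℝ) (x : E) : ℝ :=
  ((2 : ℝ) ^ l) ^ finrank ℝ E * k ((2 : ℝ) ^ l • x)

/-- A fixed integrable majorant of (multiples of) Schwartz functions. -/
noncomputable def majorant (x : E) : ℝ := ((1 + ‖x‖) ^ (finrank ℝ E + 2))⁻¹

lemma sum_le_of_le_mul_of_le_div {a : ℕ → ℝ} {C r : ℝ} (hC : 0 ≤ C) (hr : 0 < r)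
    (h₁ : ∀ l, a l ≤ C * (2 ^ l * r)) (h₂ : ∀ l, a l ≤ C / (2 ^ l * r)) (J : ℕ) :
    ∑ l ∈ Finset.range J, a l ≤ 6 * C := by
  set G : ℕ → ℝ := fun l => 6 * C * ((2 ^ l * r) / (1 + 2 ^ l * r)) with hG
  have key : ∀ l, a l ≤ G (l + 1) - G l := by
    intro l
    have h1 := h₁ l
    have h2 := h₂ l
    simp only [hG]
    set t : ℝ := 2 ^ l * r with ht
    have htpos : 0 < t := by positivity
    have e : (2 : ℝ) ^ (l + 1) * r = 2 * t := by rw [ht]; ring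
    rw [e]
    have e2 : 6 * C * (2 * t / (1 + 2 * t)) - 6 * C * (t / (1 + t))
        = 6 * C * t / ((1 + 2 * t) * (1 + t)) := by
      field_simp; ring
    rw [e2, le_div_iff₀ (by positivity)]
    rcases le_total t 1 with h | h
    · have : (1 + 2 * t) * (1 + t) ≤ 6 := by nlinarith
      calc a l * ((1 + 2 * t) * (1 + t)) ≤ C * t * ((1 + 2 * t) * (1 + t)) := by gcongr
        _ ≤ C * t * 6 := by gcongr
        _ = _ := by ring
    · have : (1 + 2 * t) * (1 + t) ≤ 6 * t ^ 2 := by nlinarith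
      calc a l * ((1 + 2 * t) * (1 + t)) ≤ C / t * ((1 + 2 * t) * (1 + t)) := by gcongr
        _ ≤ C / t * (6 * t ^ 2) := by gcongr
        _ = _ := by field_simp
  calc ∑ l ∈ Finset.range J, a l ≤ ∑ l ∈ Finset.range J, (G (l + 1) - G l) :=
        Finset.sum_le_sum fun l _ => key l
    _ = G J - G 0 := Finset.sum_range_sub G J
    _ ≤ G J := by simp only [hG]; rw [sub_le_self_iff]; positivity
    _ ≤ 6 * C * 1 := by
        simp only [hG]; gcongr
        rw [div_le_one (by positivity)]; linarith
    _ = 6 * C := mul_one _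

lemma continuous_dilate {k : E → ℝ} (hk : Continuous k) (l : ℕ) : Continuous (dilate l k) := by
  unfold dilate; fun_prop

lemma abs_dilate (l : ℕ) (k : E → ℝ) (x : E) : |dilate l k x| = dilate l (fun y => |k y|) x := by
  simp only [dilate, abs_mul]
  rw [abs_of_nonneg (by positivity : (0 : ℝ) ≤ ((2 : ℝ) ^ l) ^ finrank ℝ E)]

lemma dilate_mono {k k' : E → ℝ} (h : ∀ x, k x ≤ k' x) (l : ℕ) (x : E) :
    dilate l k x ≤ dilate l k' x := by
  simp only [dilate]; gcongr; exact h _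

lemma majorant_pos (x : E) : 0 < majorant x := by unfold majorant; positivity

lemma majorant_le_one (x : E) : majorant x ≤ 1 := by
  unfold majorant
  apply inv_le_one_of_one_le₀
  apply one_le_pow₀
  linarith [norm_nonneg x]

lemma continuous_majorant : Continuous (majorant : E → ℝ) := by
  unfold majorant
  refine Continuous.inv₀ (by fun_prop) fun x => ?_
  positivity

lemma majorant_le_of_norm_sub_le {z z' : E} (h : ‖z' - z‖ ≤ 1) :
    majorant z' ≤ 2 ^ (finrank ℝ E + 2) * majorant z := by
  unfold majorant
  rw [← div_eq_mul_inv, le_div_iff₀ (by positivity), inv_mul_le_iff₀ (by positivity), ← mul_pow]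
  gcongr
  have : ‖z‖ ≤ ‖z'‖ + ‖z' - z‖ := by
    rw [norm_sub_rev]
    simpa using norm_add_le z' (z - z')
  nlinarith [norm_nonneg z']

lemma SchwartzMap.exists_norm_iteratedFDeriv_le_majorant {F : Type*} [NormedAddCommGroup F]
    [NormedSpace ℝ F] (k : 𝓢(E, F)) (n : ℕ) :
    ∃ C : ℝ, 0 ≤ C ∧ ∀ x, ‖iteratedFDeriv ℝ n k x‖ ≤ C * majorant x := by
  have h := SchwartzMap.one_add_le_sup_seminorm_apply (𝕜 := ℝ) (m := (finrank ℝ E + 2, n))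
    (k := finrank ℝ E + 2) (n := n) le_rfl le_rfl k
  set C := 2 ^ (finrank ℝ E + 2, n).1 * ((Finset.Iic (finrank ℝ E + 2, n)).sup
    fun m => SchwartzMap.seminorm ℝ m.1 m.2) k with hC
  refine ⟨C, by positivity, fun x => ?_⟩
  unfold majorant
  rw [← div_eq_mul_inv, le_div_iff₀ (by positivity), mul_comm]
  exact h x

lemma SchwartzMap.exists_norm_le_majorant {F : Type*} [NormedAddCommGroup F]
    [NormedSpace ℝ F] (k : 𝓢(E, F)) :
    ∃ C : ℝ, 0 ≤ C ∧ ∀ x, ‖k x‖ ≤ C * majorant x := by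
  obtain ⟨C, hC, h⟩ := k.exists_norm_iteratedFDeriv_le_majorant 0
  exact ⟨C, hC, fun x => by simpa using h x⟩

lemma SchwartzMap.exists_abs_sub_le_majorant (k : 𝓢(E, ℝ)) :
    ∃ C : ℝ, 0 ≤ C ∧ ∀ z w : E, ‖w‖ ≤ 1 → |k (z - w) - k z| ≤ C * ‖w‖ * majorant z := by
  obtain ⟨C, hC, h⟩ := k.exists_norm_iteratedFDeriv_le_majorant 1
  refine ⟨C * 2 ^ (finrank ℝ E + 2), by positivity, fun z w hw => ?_⟩
  have := (convex_segment z (z - w)).norm_image_sub_le_of_norm_fderiv_le (f := k) (𝕜 := ℝ)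
    (C := C * 2 ^ (finrank ℝ E + 2) * majorant z) (fun x _ => k.differentiableAt) ?_
    (left_mem_segment ℝ _ _) (right_mem_segment ℝ _ _)
  · rw [Real.norm_eq_abs] at this
    have e : ‖z - w - z‖ = ‖w‖ := by rw [sub_sub_cancel_left, norm_neg]
    rw [e] at this
    linarith
  · intro x hx
    rw [← norm_iteratedFDeriv_one]
    refine (h x).trans ?_
    rw [mul_assoc]
    gcongr
    apply majorant_le_of_norm_sub_le
    obtain ⟨t, ⟨ht0, ht1⟩, rfl⟩ := (segment_eq_image' ℝ z (z - w)) ▸ hx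
    simp only [sub_sub_cancel_left, add_sub_cancel_left, norm_smul, norm_neg]
    rw [Real.norm_of_nonneg ht0]
    nlinarith [norm_nonneg w]

variable [FiniteDimensional ℝ E] [MeasurableSpace E] [BorelSpace E]

lemma integral_dilate (l : ℕ) (k : E → ℝ) : ∫ x, dilate l k x = ∫ x, k x := by
  simp only [dilate]
  rw [integral_const_mul, Measure.integral_comp_smul, smul_eq_mul, ← mul_assoc,
    abs_of_nonneg (by positivity), mul_inv_cancel₀ (by positivity), one_mul]

lemma integrable_dilate {k : E → ℝ} (hk : Integrable k) (l : ℕ) : Integrable (dilate l k) := by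
  exact ((integrable_comp_smul_iff volume k (by positivity)).2 hk).const_mul _

lemma integral_dilate_mul (l : ℕ) (k g : E → ℝ) :
    ∫ x, dilate l k x * g x = ∫ x, k x * g (((2 : ℝ) ^ l)⁻¹ • x) := by
  rw [← integral_dilate l (fun x => k x * g (((2 : ℝ) ^ l)⁻¹ • x))]
  congr 1; ext x
  simp only [dilate]
  rw [inv_smul_smul₀ (by positivity), mul_assoc]

lemma integrable_inv_one_add_norm_pow (n : ℕ) (hn : finrank ℝ E < n) :
    Integrable (fun x : E => ((1 + ‖x‖) ^ n)⁻¹) := by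
  have := integrable_one_add_norm (E := E) (μ := volume) (r := n) (by exact_mod_cast hn)
  refine this.congr (ae_of_all _ fun x => ?_)
  simp only
  rw [Real.rpow_neg (by positivity), Real.rpow_natCast]

lemma integrable_majorant : Integrable (majorant : E → ℝ) :=
  integrable_inv_one_add_norm_pow _ (by omega)

lemma SchwartzMap.exists_integral_abs_sub_le (k : 𝓢(E, ℝ)) :
    ∃ C : ℝ, 0 ≤ C ∧ ∀ w : E, ∫ z, |k (z - w) - k z| ≤ C * ‖w‖ := by
  obtain ⟨C, hC, h⟩ := k.exists_abs_sub_le_majorant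
  have hM : 0 ≤ ∫ x : E, majorant x := integral_nonneg fun x => (majorant_pos x).le
  have hK : 0 ≤ ∫ x, |k x| := integral_nonneg fun x => abs_nonneg _
  have hk := k.integrable (μ := volume)
  refine ⟨C * (∫ x : E, majorant x) + 2 * ∫ x, |k x|, by positivity, fun w => ?_⟩
  rcases le_total ‖w‖ 1 with hw | hw
  · calc ∫ z, |k (z - w) - k z| ≤ ∫ z, C * ‖w‖ * majorant z := by
          apply integral_mono ((hk.comp_sub_right w).sub hk).abs (integrable_majorant.const_mul _)
          exact fun z => h z w hw
      _ = C * ‖w‖ * ∫ z : E, majorant z := integral_const_mul _ _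
      _ ≤ _ := by nlinarith [norm_nonneg w, mul_nonneg hK (norm_nonneg w)]
  · calc ∫ z, |k (z - w) - k z| ≤ ∫ z, (|k (z - w)| + |k z|) := by
          apply integral_mono ((hk.comp_sub_right w).sub hk).abs
            ((hk.comp_sub_right w).abs.add hk.abs)
          exact fun z => abs_sub _ _
      _ = 2 * ∫ z, |k z| := by
          rw [integral_add (hk.comp_sub_right w).abs hk.abs,
            integral_sub_right_eq_self (fun z => |k z|) w]
          ring
      _ ≤ _ := by nlinarith [mul_nonneg hC hM]

lemma SchwartzMap.integrable_norm_mul_abs (k : 𝓢(E, ℝ)) :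
    Integrable (fun x => ‖x‖ * |k x|) := by
  simpa using k.integrable_pow_mul volume 1

/-- Hörmander's condition, uniformly for the truncated sums of dilates of a Schwartz function. -/
lemma SchwartzMap.exists_hormander (k : 𝓢(E, ℝ)) :
    ∃ C : ℝ, 0 ≤ C ∧ ∀ (J : ℕ) (r : ℝ) (y : E), 0 < r → ‖y‖ ≤ r →
      ∫ x in {x : E | 2 * r ≤ ‖x‖},
        |∑ l ∈ Finset.range J, dilate l k (x - y) - ∑ l ∈ Finset.range J, dilate l k x| ≤ C := by
  obtain ⟨C, hC, h⟩ := k.exists_integral_abs_sub_le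
  have hk := k.integrable (μ := volume)
  set M := ∫ x, ‖x‖ * |k x| with hM
  have hM0 : 0 ≤ M := integral_nonneg fun x => by positivity
  have hdi : ∀ l, Integrable (dilate l k) := integrable_dilate hk
  have hdis : ∀ l y, Integrable (fun x => dilate l k (x - y)) :=
    fun l y => (hdi l).comp_sub_right y
  have tail : ∀ (l : ℕ) (s : ℝ), 0 < s →
      ∫ x in {x : E | s ≤ ‖x‖}, |dilate l k x| ≤ M / (2 ^ l * s) := by
    intro l s hs
    have e : ∫ x, |dilate l k x| * ‖x‖ = ((2 : ℝ) ^ l)⁻¹ * M := by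
      simp_rw [abs_dilate]
      rw [integral_dilate_mul, hM, ← integral_const_mul]
      congr 1; ext x
      rw [norm_smul, norm_inv, norm_pow, Real.norm_ofNat]; ring
    have hi : Integrable (fun x => |dilate l k x| * ‖x‖) := by
      have := integrable_dilate (k.integrable_norm_mul_abs) l
      refine (this.const_mul (((2 : ℝ) ^ l)⁻¹)).congr (ae_of_all _ fun x => ?_)
      simp only [dilate, norm_smul, norm_pow, Real.norm_ofNat]
      field_simp
      rw [abs_mul, abs_of_nonneg (by positivity : (0 : ℝ) ≤ ((2 : ℝ) ^ l) ^ finrank ℝ E)]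
      ring
    rw [le_div_iff₀ (by positivity)]
    calc (∫ x in {x : E | s ≤ ‖x‖}, |dilate l k x|) * (2 ^ l * s)
        = 2 ^ l * ∫ x in {x : E | s ≤ ‖x‖}, s * |dilate l k x| := by
          rw [integral_const_mul]; ring
      _ ≤ 2 ^ l * ∫ x in {x : E | s ≤ ‖x‖}, |dilate l k x| * ‖x‖ := by
          refine mul_le_mul_of_nonneg_left ?_ (by positivity)
          apply setIntegral_mono_on (((hdi l).abs.const_mul s).integrableOn) hi.integrableOn
          · exact measurableSet_le measurable_const measurable_norm
          · intro x hx
            rw [mul_comm]; gcongr; exact hx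
      _ ≤ 2 ^ l * ∫ x, |dilate l k x| * ‖x‖ := by
          exact mul_le_mul_of_nonneg_left
            (setIntegral_le_integral hi (ae_of_all _ fun x => by positivity)) (by positivity)
      _ = M := by rw [e]; field_simp
  refine ⟨6 * (C + 2 * M), by positivity, fun J r y hr hy => ?_⟩
  have hms : MeasurableSet {x : E | 2 * r ≤ ‖x‖} :=
    measurableSet_le measurable_const measurable_norm
  set a : ℕ → ℝ := fun l => ∫ x in {x : E | 2 * r ≤ ‖x‖}, |dilate l k (x - y) - dilate l k x|
  have ha1 : ∀ l, a l ≤ (C + 2 * M) * (2 ^ l * r) := by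
    intro l
    calc a l ≤ ∫ x, |dilate l k (x - y) - dilate l k x| :=
          setIntegral_le_integral ((hdis l y).sub (hdi l)).abs
            (ae_of_all _ fun x => abs_nonneg _)
      _ = ∫ z, |k (z - (2 : ℝ) ^ l • y) - k z| := by
          rw [← integral_dilate l (fun z => |k (z - (2 : ℝ) ^ l • y) - k z|)]
          congr 1; ext x
          simp only [dilate]
          rw [← mul_sub, abs_mul, smul_sub,
            abs_of_nonneg (by positivity : (0 : ℝ) ≤ ((2 : ℝ) ^ l) ^ finrank ℝ E)]
      _ ≤ C * ‖(2 : ℝ) ^ l • y‖ := h _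
      _ = C * (2 ^ l * ‖y‖) := by rw [norm_smul, norm_pow, Real.norm_ofNat]
      _ ≤ (C + 2 * M) * (2 ^ l * r) := by gcongr; linarith
  have ha2 : ∀ l, a l ≤ (C + 2 * M) / (2 ^ l * r) := by
    intro l
    calc a l ≤ ∫ x in {x : E | 2 * r ≤ ‖x‖}, (|dilate l k (x - y)| + |dilate l k x|) := by
          apply integral_mono ((hdis l y).sub (hdi l)).abs.integrableOn
            ((hdis l y).abs.add (hdi l).abs).integrableOn
          exact fun x => abs_sub _ _
      _ = (∫ x in {x : E | 2 * r ≤ ‖x‖}, |dilate l k (x - y)|)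
            + ∫ x in {x : E | 2 * r ≤ ‖x‖}, |dilate l k x| :=
          integral_add (hdis l y).abs.integrableOn (hdi l).abs.integrableOn
      _ ≤ M / (2 ^ l * r) + M / (2 ^ l * (2 * r)) := by
          gcongr
          · refine le_trans ?_ (tail l r hr)
            rw [← integral_indicator hms,
              ← integral_indicator (measurableSet_le measurable_const measurable_norm),
              ← integral_sub_right_eq_self
                ({x : E | r ≤ ‖x‖}.indicator fun x => |dilate l k x|) y]
            apply integral_mono ((hdis l y).abs.indicator hms)
              (((hdi l).abs.indicator
                (measurableSet_le measurable_const measurable_norm)).comp_sub_right y)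
            intro x
            by_cases hx : 2 * r ≤ ‖x‖
            · have : r ≤ ‖x - y‖ := by
                have := norm_sub_norm_le x y; linarith
              simp [Set.indicator, hx, this]
            · simp only [Set.indicator, Set.mem_ofPred_eq, hx, if_false]
              split_ifs <;> positivity
          · exact tail l (2 * r) (by positivity)
      _ ≤ M / (2 ^ l * r) + M / (2 ^ l * r) := by gcongr; linarith
      _ ≤ (C + 2 * M) / (2 ^ l * r) := by
          rw [← add_div]
          exact div_le_div_of_nonneg_right (by linarith) (by positivity)
  calc _ ≤ ∫ x in {x : E | 2 * r ≤ ‖x‖},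
        ∑ l ∈ Finset.range J, |dilate l k (x - y) - dilate l k x| := by
        apply integral_mono
        · exact ((integrable_finsetSum _ fun l _ => hdis l y).sub
            (integrable_finsetSum _ fun l _ => hdi l)).abs.integrableOn
        · exact (integrable_finsetSum _ fun l _ => ((hdis l y).sub (hdi l)).abs).integrableOn
        · intro x
          simp only
          rw [← Finset.sum_sub_distrib]
          exact Finset.abs_sum_le_sum_abs _ _
    _ = ∑ l ∈ Finset.range J, a l :=
        integral_finsetSum _ fun l _ => ((hdis l y).sub (hdi l)).abs.integrableOn
    _ ≤ _ := sum_le_of_le_mul_of_le_div (by positivity) hr ha1 ha2 J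

end Kernels

section Plancherel

open Module SchwartzMap FourierTransform

variable {E : Type*} [NormedAddCommGroup E] [InnerProductSpace ℝ E]

/-- `dilate` as an operation on Schwartz functions. -/
noncomputable def SchwartzMap.dilated (l : ℕ) (k : 𝓢(E, ℝ)) : 𝓢(E, ℝ) :=
  (((2 : ℝ) ^ l) ^ finrank ℝ E) • compCLMOfContinuousLinearEquiv ℝ
    (ContinuousLinearEquiv.smulLeft (Units.mk0 ((2 : ℝ) ^ l) (by positivity))) k

lemma SchwartzMap.dilated_apply (l : ℕ) (k : 𝓢(E, ℝ)) (x : E) :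
    dilated l k x = dilate l k x := rfl

/-- A real Schwartz function seen as a complex one. -/
noncomputable def SchwartzMap.toComplex (k : 𝓢(E, ℝ)) : 𝓢(E, ℂ) :=
  postcompCLM (𝕜 := ℝ) Complex.ofRealCLM k

lemma SchwartzMap.toComplex_apply (k : 𝓢(E, ℝ)) (x : E) : k.toComplex x = (k x : ℂ) := rfl

variable [FiniteDimensional ℝ E] [MeasurableSpace E] [BorelSpace E]

lemma SchwartzMap.fourier_toComplex_dilated (l : ℕ) (k : 𝓢(E, ℝ)) (ξ : E) :
    𝓕 (dilated l k).toComplex ξ = 𝓕 k.toComplex (((2 : ℝ) ^ l)⁻¹ • ξ) := by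
  rw [fourier_coe, fourier_coe, Real.fourier_eq', Real.fourier_eq']
  have := Measure.integral_comp_smul (volume : Measure E) (fun v : E =>
    Complex.exp (↑(-2 * Real.pi * inner ℝ v (((2 : ℝ) ^ l)⁻¹ • ξ)) * Complex.I) • k.toComplex v)
    ((2 : ℝ) ^ l)
  rw [abs_of_nonneg (by positivity), eq_inv_smul_iff₀ (by positivity), ← integral_smul] at this
  rw [← this]
  congr 1; ext x
  rw [real_inner_smul_left, real_inner_smul_right, mul_inv_cancel_left₀ (by positivity)]
  simp only [toComplex_apply, dilated_apply, dilate, smul_eq_mul, Complex.real_smul]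
  push_cast
  ring

lemma SchwartzMap.exists_norm_fourier_sum_le (k : 𝓢(E, ℝ)) (h0 : ∫ x, k x = 0) :
    ∃ C : ℝ, 0 ≤ C ∧ ∀ (J : ℕ) (ξ : E),
      ‖𝓕 (∑ l ∈ Finset.range J, dilated l k).toComplex ξ‖ ≤ C := by
  set g := 𝓕 k.toComplex with hg
  have g0 : g 0 = 0 := by
    rw [hg, fourier_coe, Real.fourier_eq']
    simp only [inner_zero_right, mul_zero, Complex.ofReal_zero, zero_mul, Complex.exp_zero,
      one_smul, toComplex_apply]
    rw [integral_complex_ofReal, h0, Complex.ofReal_zero]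
  obtain ⟨C₁, hC₁, h₁⟩ := g.exists_norm_iteratedFDeriv_le_majorant 1
  obtain ⟨C₂, hC₂, h₂⟩ := g.decay 1 0
  have b1 : ∀ ξ, ‖g ξ‖ ≤ (C₁ + C₂) * ‖ξ‖ := by
    intro ξ
    have := (convex_univ (𝕜 := ℝ) (E := E)).norm_image_sub_le_of_norm_fderiv_le (f := g) (𝕜 := ℝ)
      (C := C₁) (fun x _ => g.differentiableAt) (fun x _ => by
        rw [← norm_iteratedFDeriv_one]
        exact (h₁ x).trans (mul_le_of_le_one_right hC₁ (majorant_le_one x)))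
      (Set.mem_univ 0) (Set.mem_univ ξ)
    rw [g0, sub_zero, sub_zero] at this
    nlinarith [norm_nonneg ξ]
  have b2 : ∀ ξ, ‖ξ‖ * ‖g ξ‖ ≤ C₁ + C₂ := by
    intro ξ
    have := h₂ ξ
    simp only [pow_one, norm_iteratedFDeriv_zero] at this
    linarith
  refine ⟨6 * (C₁ + C₂), by positivity, fun J ξ => ?_⟩
  have e : 𝓕 (∑ l ∈ Finset.range J, dilated l k).toComplex ξ
      = ∑ l ∈ Finset.range J, g (((2 : ℝ) ^ l)⁻¹ • ξ) := by
    have : (∑ l ∈ Finset.range J, dilated l k).toComplex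
        = ∑ l ∈ Finset.range J, (dilated l k).toComplex := map_sum _ _ _
    rw [this, ← fourierCLM_apply (R := ℂ), map_sum, sum_apply]
    exact Finset.sum_congr rfl fun l _ => fourier_toComplex_dilated l k ξ
  rw [e]
  rcases eq_or_ne ξ 0 with rfl | hξ
  · simp only [smul_zero, g0, Finset.sum_const_zero, norm_zero]; positivity
  have hξ' : 0 < ‖ξ‖ := norm_pos_iff.2 hξ
  refine (norm_sum_le _ _).trans (sum_le_of_le_mul_of_le_div (r := ‖ξ‖⁻¹)
    (a := fun l => ‖g (((2 : ℝ) ^ l)⁻¹ • ξ)‖) (by positivity) (by positivity) ?_ ?_ J)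
  · intro l
    have := b2 (((2 : ℝ) ^ l)⁻¹ • ξ)
    rw [norm_smul, norm_inv, norm_pow, Real.norm_ofNat] at this
    calc ‖g (((2 : ℝ) ^ l)⁻¹ • ξ)‖ = ((2 ^ l)⁻¹ * ‖ξ‖ * ‖g (((2 : ℝ) ^ l)⁻¹ • ξ)‖)
          * (2 ^ l * ‖ξ‖⁻¹) := by field_simp
      _ ≤ _ := by gcongr
  · intro l
    have := b1 (((2 : ℝ) ^ l)⁻¹ • ξ)
    rw [norm_smul, norm_inv, norm_pow, Real.norm_ofNat] at this
    refine this.trans (le_of_eq ?_)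
    field_simp

lemma SchwartzMap.integral_sq_convolution_le {κ f : 𝓢(E, ℝ)} {M : ℝ}
    (h : ∀ ξ, ‖𝓕 κ.toComplex ξ‖ ≤ M) :
    Integrable (fun x => (∫ y, κ (x - y) * f y) ^ 2) ∧
      ∫ x, (∫ y, κ (x - y) * f y) ^ 2 ≤ M ^ 2 * ∫ x, f x ^ 2 := by
  set c := convolution (ContinuousLinearMap.mul ℂ ℂ) f.toComplex κ.toComplex with hc
  have e : ∀ x, c x = ((∫ y, κ (x - y) * f y : ℝ) : ℂ) := by
    intro x
    rw [hc, convolution_apply]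
    simp only [MeasureTheory.convolution, ContinuousLinearMap.mul_apply', toComplex_apply]
    rw [← integral_complex_ofReal]
    congr 1; ext y; push_cast; ring
  have e2 : ∀ x, (∫ y, κ (x - y) * f y) ^ 2 = ‖c x‖ ^ 2 := by
    intro x; rw [e, Complex.norm_real, Real.norm_eq_abs, sq_abs]
  have sqi : ∀ u : 𝓢(E, ℂ), Integrable (fun x => ‖u x‖ ^ 2) := fun u =>
    (memLp_two_iff_integrable_sq_norm u.continuous.aestronglyMeasurable).1 (u.memLp 2 volume)
  simp_rw [e2]
  refine ⟨sqi c, ?_⟩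
  rw [← integral_norm_sq_fourier]
  have e3 : ∀ ξ, 𝓕 c ξ = 𝓕 f.toComplex ξ * 𝓕 κ.toComplex ξ := by
    intro ξ
    rw [hc, fourier_convolution_apply, Real.fourier_mul_convolution_eq f.toComplex.integrable
      κ.toComplex.integrable]
    rfl
  calc ∫ ξ, ‖𝓕 c ξ‖ ^ 2 ≤ ∫ ξ, M ^ 2 * ‖𝓕 f.toComplex ξ‖ ^ 2 := by
        apply integral_mono (sqi _) ((sqi _).const_mul _)
        intro ξ
        simp only [e3, norm_mul, mul_pow]
        rw [mul_comm]
        gcongr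
        exact h ξ
    _ = M ^ 2 * ∫ x, f x ^ 2 := by
        rw [integral_const_mul, integral_norm_sq_fourier]
        congr 2; ext x
        rw [toComplex_apply, Complex.norm_real, Real.norm_eq_abs, sq_abs]

lemma abs_integral_mul_le {X : Type*} [MeasurableSpace X] {μ : Measure X} {a b : X → ℝ}
    (ha : Integrable (fun x => a x ^ 2) μ) (hb : Integrable (fun x => b x ^ 2) μ) {t : ℝ}
    (ht : 0 < t) :
    |∫ x, a x * b x ∂μ| ≤ t * (∫ x, a x ^ 2 ∂μ) + (∫ x, b x ^ 2 ∂μ) / t := by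
  rw [← integral_const_mul, ← integral_div, ← integral_add (ha.const_mul _) (hb.div_const _)]
  rw [← Real.norm_eq_abs]
  refine norm_integral_le_of_norm_le ((ha.const_mul _).add (hb.div_const _))
    (ae_of_all _ fun x => ?_)
  rw [Real.norm_eq_abs, abs_mul]
  have h := sq_nonneg (t * |a x| - |b x|)
  have h2 := mul_nonneg (abs_nonneg (a x)) (abs_nonneg (b x))
  rw [← sq_abs (a x), ← sq_abs (b x)]
  rw [← sub_nonneg]
  have : t * |a x| ^ 2 + |b x| ^ 2 / t - |a x| * |b x|
    = ((t * |a x| - |b x|) ^ 2 + t * (|a x| * |b x|)) / t := by field_simp; ring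
  rw [this]; positivity

lemma measure_lt_abs_le_of_integrable_sq {X : Type*} [MeasurableSpace X] {μ : Measure X}
    {u : X → ℝ} (hu : Integrable (fun x => u x ^ 2) μ) {r C : ℝ} (hr : 0 < r)
    (hC : ∫ x, u x ^ 2 ∂μ ≤ C) : μ {x | r < |u x|} ≤ ENNReal.ofReal (C / r ^ 2) := by
  have hsub : {x | r < |u x|} ⊆ {x | r ^ 2 ≤ u x ^ 2} := fun x hx => by
    have hx' : r < |u x| := hx
    change r ^ 2 ≤ u x ^ 2
    rw [← sq_abs (u x)]; gcongr
  refine (measure_mono hsub).trans ?_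
  have h := mul_meas_ge_le_integral_of_nonneg (ae_of_all μ fun x => sq_nonneg (u x)) hu (r ^ 2)
  have hfin : μ {x | r ^ 2 ≤ u x ^ 2} < ⊤ := hu.measure_ge_lt_top (by positivity)
  rw [← ENNReal.ofReal_toReal hfin.ne]
  apply ENNReal.ofReal_le_ofReal
  rw [le_div_iff₀ (by positivity)]
  simp only [Measure.real] at h
  linarith

lemma SchwartzMap.measure_lt_abs_convolution_le {κ : 𝓢(E, ℝ)} {M : ℝ}
    (h : ∀ ξ, ‖𝓕 κ.toComplex ξ‖ ≤ M) {g : E → ℝ} (hg : MemLp g 2) {r : ℝ} (hr : 0 < r) :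
    volume {x | r < |∫ y, κ (x - y) * g y|} ≤
      ENNReal.ofReal (16 * M ^ 2 * (∫ y, g y ^ 2) / r ^ 2) := by
  have hgi : Integrable (fun y => g y ^ 2) := hg.integrable_sq
  have hκi : Integrable (fun y => κ y ^ 2) := (κ.memLp 2 volume).integrable_sq
  set I := ∫ y, g y ^ 2 with hI
  have hI0 : 0 ≤ I := integral_nonneg fun y => sq_nonneg _
  rcases hI0.eq_or_lt with hI0 | hIpos
  · have : (fun y => g y ^ 2) =ᵐ[volume] 0 :=
      (integral_eq_zero_iff_of_nonneg (fun y => sq_nonneg _) hgi).1 hI0.symm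
    have hz : ∀ x, ∫ y, κ (x - y) * g y = 0 := by
      intro x
      apply integral_eq_zero_of_ae
      filter_upwards [this] with y hy
      have : g y = 0 := by simpa using hy
      simp [this]
    simp only [hz, abs_zero, not_lt.2 hr.le, Set.ofPred_false, measure_empty, zero_le]
  set K2 := ∫ y, κ y ^ 2 with hK2
  have hK20 : 0 ≤ K2 := integral_nonneg fun y => sq_nonneg _
  set δ := min (r / (2 * (K2 + 1))) (Real.sqrt I) with hδ
  have hδ0 : 0 < δ := lt_min (by positivity) (Real.sqrt_pos.2 hIpos)
  obtain ⟨f₀, hf1, hf2, hf3⟩ := hg.exist_eLpNorm_sub_le (by simp) (by simp) hδ0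
  set f := hf1.toSchwartzMap hf2 with hf
  have hff : ∀ x, f x = f₀ x := fun x => rfl
  have hd : MemLp (g - f₀) 2 := hg.sub (f.memLp 2 volume)
  have hdi : Integrable (fun y => (g y - f y) ^ 2) := hd.integrable_sq
  have hdle : ∫ y, (g y - f y) ^ 2 ≤ δ ^ 2 := by
    have e := hd.eLpNorm_eq_integral_rpow_norm (by simp) (by simp)
    rw [e] at hf3
    have := (ENNReal.ofReal_le_ofReal_iff hδ0.le).1 hf3
    simp only [ENNReal.toReal_ofNat, Real.rpow_ofNat, Pi.sub_apply, Real.norm_eq_abs,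
      sq_abs] at this
    rw [show (2 : ℝ)⁻¹ = 1 / 2 by norm_num, ← Real.sqrt_eq_rpow, Real.sqrt_le_iff] at this
    exact this.2
  have hfi : Integrable (fun y => f y ^ 2) := (f.memLp 2 volume).integrable_sq
  have hfle : ∫ y, f y ^ 2 ≤ 4 * I := by
    have hδI : δ ^ 2 ≤ I := by
      calc δ ^ 2 ≤ (Real.sqrt I) ^ 2 := by gcongr; exact min_le_right _ _
        _ = I := Real.sq_sqrt hIpos.le
    calc ∫ y, f y ^ 2 ≤ ∫ y, (2 * g y ^ 2 + 2 * (g y - f y) ^ 2) := by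
          apply integral_mono hfi ((hgi.const_mul 2).add (hdi.const_mul 2))
          intro y
          change f y ^ 2 ≤ 2 * g y ^ 2 + 2 * (g y - f y) ^ 2
          nlinarith [sq_nonneg (2 * g y - f y)]
      _ = 2 * I + 2 * ∫ y, (g y - f y) ^ 2 := by
          rw [integral_add (hgi.const_mul 2) (hdi.const_mul 2), integral_const_mul,
            integral_const_mul]
      _ ≤ 4 * I := by linarith
  have hconv := integral_sq_convolution_le (f := f) h
  have hsub : {x | r < |∫ y, κ (x - y) * g y|} ⊆ {x | r / 2 < |∫ y, κ (x - y) * f y|} := by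
    intro x hx
    have hx' : r < |∫ y, κ (x - y) * g y| := hx
    change r / 2 < |∫ y, κ (x - y) * f y|
    have hκx : Integrable (fun y => κ (x - y) ^ 2) := hκi.comp_sub_left x
    have hκm : MemLp (fun y => κ (x - y)) 2 :=
      (memLp_two_iff_integrable_sq (by have := κ.continuous; fun_prop)).2 hκx
    have hb := abs_integral_mul_le hκx hdi hδ0
    rw [integral_sub_left_eq_self (fun y => κ y ^ 2) volume x] at hb
    have e : ∫ y, κ (x - y) * (g y - f y) = (∫ y, κ (x - y) * g y) - ∫ y, κ (x - y) * f y := by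
      refine Eq.trans ?_ (integral_sub (hκm.integrable_mul hg)
        (hκm.integrable_mul (f.memLp 2 volume)))
      congr 1; ext y; exact mul_sub _ _ _
    rw [e] at hb
    have h3 : δ * K2 + (∫ y, (g y - f y) ^ 2) / δ ≤ r / 2 := by
      calc δ * K2 + (∫ y, (g y - f y) ^ 2) / δ ≤ δ * K2 + δ ^ 2 / δ := by gcongr
        _ = δ * (K2 + 1) := by field_simp
        _ ≤ r / (2 * (K2 + 1)) * (K2 + 1) := by gcongr; exact min_le_left _ _
        _ = r / 2 := by field_simp
    have h4 := abs_sub_abs_le_abs_sub (∫ y, κ (x - y) * g y) (∫ y, κ (x - y) * f y)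
    linarith
  refine (measure_mono hsub).trans ?_
  refine (measure_lt_abs_le_of_integrable_sq hconv.1 (half_pos hr)
    (hconv.2.trans (mul_le_mul_of_nonneg_left hfle (sq_nonneg M)))).trans (le_of_eq ?_)
  congr 1
  field_simp
  ring

lemma SchwartzMap.exists_measure_lt_abs_sum_convolution_le (k : 𝓢(E, ℝ)) (h0 : ∫ x, k x = 0) :
    ∃ C : ℝ, 0 ≤ C ∧ ∀ (J : ℕ) (g : E → ℝ) (r : ℝ), MemLp g 2 → 0 < r →
      volume {x | r < |∫ y, (∑ l ∈ Finset.range J, dilate l k (x - y)) * g y|}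
        ≤ ENNReal.ofReal (C * (∫ y, g y ^ 2) / r ^ 2) := by
  obtain ⟨M, hM, h⟩ := k.exists_norm_fourier_sum_le h0
  refine ⟨16 * M ^ 2, by positivity, fun J g r hg hr => ?_⟩
  have := measure_lt_abs_convolution_le (h J) hg hr
  simpa only [sum_apply, dilated_apply] using this

end Plancherel

section BallSelection

open Module

variable {E : Type*} [NormedAddCommGroup E] [InnerProductSpace ℝ E] [FiniteDimensional ℝ E]
  [MeasurableSpace E] [BorelSpace E]

lemma exists_measure_closedBall_diff_eq [Nontrivial E] (x : E) {c : ℝ} (hc : 0 ≤ c) {F : Set E}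
    (hF : volume F ≠ ⊤) :
    ∃ r : ℝ, 0 ≤ r ∧ volume (closedBall x r \ F) = ENNReal.ofReal c := by
  set b := volume.real (ball (0 : E) 1) with hb
  have hbpos : 0 < b := ENNReal.toReal_pos (measure_ball_pos _ _ one_pos).ne' measure_ball_lt_top.ne
  have hd : finrank ℝ E ≠ 0 := finrank_pos.ne'
  have hV : ∀ r, 0 ≤ r → volume.real (closedBall x r) = r ^ finrank ℝ E * b := fun r hr =>
    Measure.addHaar_real_closedBall _ _ hr
  have fin : ∀ r, volume (closedBall x r) ≠ ⊤ := fun r => measure_closedBall_lt_top.ne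
  have fin' : ∀ r, volume (closedBall x r \ F) ≠ ⊤ := fun r =>
    measure_ne_top_of_subset Set.sdiff_subset (fin r)
  set h : ℝ → ℝ := fun r => volume.real (closedBall x r \ F) with hh
  have key : ∀ s r, 0 ≤ s → s ≤ r → h s ≤ h r ∧
      h r - h s ≤ r ^ finrank ℝ E * b - s ^ finrank ℝ E * b := by
    intro s r hs hsr
    refine ⟨measureReal_mono (Set.sdiff_subset_sdiff_left (closedBall_subset_closedBall hsr))
      (fin' r), ?_⟩
    rw [← hV r (hs.trans hsr), ← hV s hs, ← measureReal_sdiff (closedBall_subset_closedBall hsr)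
      measurableSet_closedBall (fin r)]
    have : closedBall x r \ F ⊆ (closedBall x s \ F) ∪ (closedBall x r \ closedBall x s) := by
      intro y hy
      by_cases h : y ∈ closedBall x s
      · exact Or.inl ⟨h, hy.2⟩
      · exact Or.inr ⟨hy.1, h⟩
    have h1 := measureReal_mono (μ := volume) this (measure_union_ne_top (fin' s)
      (measure_ne_top_of_subset Set.sdiff_subset (fin r)))
    have h2 := measureReal_union_le (μ := volume) (closedBall x s \ F)
      (closedBall x r \ closedBall x s)
    simp only [hh]
    linarith
  have key2 : ∀ s r, 0 ≤ s → 0 ≤ r →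
      dist (h r) (h s) ≤ dist (r ^ finrank ℝ E * b) (s ^ finrank ℝ E * b) := by
    intro s r hs hr
    rcases le_total s r with hsr | hsr
    · obtain ⟨h1, h2⟩ := key s r hs hsr
      rw [Real.dist_eq, Real.dist_eq, abs_of_nonneg (by linarith)]
      exact h2.trans (le_abs_self _)
    · obtain ⟨h1, h2⟩ := key r s hr hsr
      rw [dist_comm, dist_comm (r ^ _ * b), Real.dist_eq, Real.dist_eq, abs_of_nonneg (by linarith)]
      exact h2.trans (le_abs_self _)
  have hcont : ContinuousOn h (Set.Ici 0) := by
    intro s hs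
    have hc : ContinuousWithinAt (fun r : ℝ => r ^ finrank ℝ E * b) (Set.Ici 0) s := by fun_prop
    rw [ContinuousWithinAt, tendsto_iff_dist_tendsto_zero] at hc ⊢
    exact squeeze_zero' (Filter.Eventually.of_forall fun _ => dist_nonneg)
      (eventually_mem_nhdsWithin.mono fun r hr => key2 s r hs hr) hc
  have h0 : h 0 = 0 := by
    have h1 : h 0 ≤ volume.real (closedBall x 0) := measureReal_mono Set.sdiff_subset (fin 0)
    rw [hV 0 le_rfl, zero_pow hd, zero_mul] at h1
    exact h1.antisymm measureReal_nonneg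
  have hlarge : ∃ R, 0 ≤ R ∧ c ≤ h R := by
    set R := 1 + (c + volume.real F) / b with hR
    have hR1 : 1 ≤ R := by
      rw [hR]; have : 0 ≤ (c + volume.real F) / b := by positivity
      linarith
    refine ⟨R, by linarith, ?_⟩
    have h1 : R * b ≤ volume.real (closedBall x R) := by
      rw [hV R (by linarith)]
      gcongr
      exact le_self_pow₀ hR1 hd
    have h2 : volume.real (closedBall x R) ≤ h R + volume.real F := by
      refine (measureReal_mono (s₂ := (closedBall x R \ F) ∪ F) ?_
        (measure_union_ne_top (fin' R) hF)).trans (measureReal_union_le _ _)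
      rw [Set.sdiff_union_self]; exact Set.subset_union_left
    have h3 : R * b = b + (c + volume.real F) := by rw [hR]; field_simp
    linarith
  obtain ⟨R, hR0, hR⟩ := hlarge
  obtain ⟨r, hr, hrc⟩ := intermediate_value_Icc hR0 (hcont.mono Set.Icc_subset_Ici_self)
    (show c ∈ Set.Icc (h 0) (h R) from ⟨h0.le.trans hc, hR⟩)
  refine ⟨r, hr.1, ?_⟩
  rw [← hrc]
  exact (ENNReal.ofReal_toReal (fin' r)).symm

/-- The union of the first `n` greedily chosen balls, centred at the points `x i`. -/
noncomputable def greedyUnion (R : E → ℝ → Set E → ℝ) (x : ℕ → E) (c : ℕ → ℝ) : ℕ → Set E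
  | 0 => ∅
  | n + 1 => greedyUnion R x c n ∪ closedBall (x n) (R (x n) (c n) (greedyUnion R x c n))

lemma exists_greedy_balls [Nontrivial E] (x : ℕ → E) (c : ℕ → ℝ) (hc : ∀ i, 0 ≤ c i) :
    ∃ (r : ℕ → ℝ) (G : ℕ → Set E), G 0 = ∅ ∧ ∀ n, 0 ≤ r n ∧ MeasurableSet (G n) ∧
      G (n + 1) = G n ∪ closedBall (x n) (r n) ∧
      volume (closedBall (x n) (r n) \ G n) = ENNReal.ofReal (c n) ∧
      volume (G n) = ENNReal.ofReal (∑ i ∈ Finset.range n, c i) := by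
  have hex : ∀ (x : E) (c : ℝ) (F : Set E), ∃ r : ℝ, 0 ≤ c → volume F ≠ ⊤ →
      0 ≤ r ∧ volume (closedBall x r \ F) = ENNReal.ofReal c := by
    intro x c F
    by_cases h : 0 ≤ c ∧ volume F ≠ ⊤
    · obtain ⟨r, hr⟩ := exists_measure_closedBall_diff_eq x h.1 h.2
      exact ⟨r, fun _ _ => hr⟩
    · exact ⟨0, fun h1 h2 => absurd ⟨h1, h2⟩ h⟩
  choose R hR using hex
  have hm : ∀ n, MeasurableSet (greedyUnion R x c n) := by
    intro n
    induction n with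
    | zero => exact MeasurableSet.empty
    | succ n ih => exact ih.union measurableSet_closedBall
  have hv : ∀ n, volume (greedyUnion R x c n) = ENNReal.ofReal (∑ i ∈ Finset.range n, c i) := by
    intro n
    induction n with
    | zero => simp [greedyUnion]
    | succ n ih =>
      have h1 := hR (x n) (c n) (greedyUnion R x c n) (hc n)
        (by rw [ih]; exact ENNReal.ofReal_ne_top)
      rw [greedyUnion, ← Set.union_sdiff_self, measure_union Set.disjoint_sdiff_right
        (measurableSet_closedBall.diff (hm n)), ih, h1.2, Finset.sum_range_succ,
        ENNReal.ofReal_add (Finset.sum_nonneg fun i _ => hc i) (hc n)]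
  refine ⟨fun n => R (x n) (c n) (greedyUnion R x c n), greedyUnion R x c, rfl, fun n => ?_⟩
  have h1 := hR (x n) (c n) (greedyUnion R x c n) (hc n) (by rw [hv]; exact ENNReal.ofReal_ne_top)
  exact ⟨h1.1, hm n, rfl, h1.2, hv n⟩

lemma measure_biUnion_closedBall_two_mul_le (x : ℕ → E) (r : ℕ → ℝ) (hr : ∀ i, 0 ≤ r i) (n : ℕ) :
    volume (⋃ i ∈ Finset.range n, closedBall (x i) (2 * r i))
      ≤ ENNReal.ofReal (7 ^ finrank ℝ E) *
        volume (⋃ i ∈ Finset.range n, closedBall (x i) (r i)) := by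
  obtain ⟨u, hut, hud, hcov⟩ := Vitali.exists_disjoint_subfamily_covering_enlargement
    (fun i => closedBall (x i) (r i)) (Finset.range n : Set ℕ) r 2 one_lt_two (fun i _ => hr i)
    (∑ i ∈ Finset.range n, r i) (fun i hi => Finset.single_le_sum (fun i _ => hr i) hi)
    (fun i _ => nonempty_closedBall.2 (hr i))
  have hufin : u.Finite := (Finset.range n).finite_toSet.subset hut
  have hsub : (⋃ i ∈ Finset.range n, closedBall (x i) (2 * r i))
      ⊆ ⋃ b ∈ u, closedBall (x b) (7 * r b) := by
    intro z hz
    simp only [Set.mem_iUnion] at hz ⊢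
    obtain ⟨i, hi, hz⟩ := hz
    obtain ⟨b, hb, ⟨w, hw1, hw2⟩, hle⟩ := hcov i hi
    refine ⟨b, hb, ?_⟩
    rw [mem_closedBall] at hz hw1 hw2 ⊢
    have h1 := dist_triangle z (x i) (x b)
    have h2 := dist_triangle_left (x i) (x b) w
    linarith
  calc _ ≤ volume (⋃ b ∈ u, closedBall (x b) (7 * r b)) := measure_mono hsub
    _ ≤ ∑ b ∈ hufin.toFinset, volume (closedBall (x b) (7 * r b)) := by
        have := measure_biUnion_finset_le (μ := volume) hufin.toFinset
          (fun b => closedBall (x b) (7 * r b))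
        simpa using this
    _ = ENNReal.ofReal (7 ^ finrank ℝ E) *
        ∑ b ∈ hufin.toFinset, volume (closedBall (x b) (r b)) := by
        rw [Finset.mul_sum]
        refine Finset.sum_congr rfl fun b _ => ?_
        rw [Measure.addHaar_closedBall_mul _ _ (by norm_num) (hr b),
          Measure.addHaar_closedBall_center volume (x b)]
    _ ≤ _ := by
        gcongr
        rw [← measure_biUnion_finset (by simpa using hud) (fun b _ => measurableSet_closedBall)]
        apply measure_mono
        intro z hz
        simp only [Set.mem_iUnion, Set.Finite.mem_toFinset] at hz ⊢
        obtain ⟨b, hb, hz⟩ := hz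
        exact ⟨b, hut hb, hz⟩

end BallSelection

section WeakType

open Module SchwartzMap

variable {E : Type*} [NormedAddCommGroup E] [InnerProductSpace ℝ E] [FiniteDimensional ℝ E]
  [MeasurableSpace E] [BorelSpace E]

lemma setLIntegral_compl_closedBall_le {K : E → ℝ} (hKi : Integrable K) {C : ℝ}
    (hH : ∀ (r : ℝ) (y : E), 0 < r → ‖y‖ ≤ r →
      ∫ x in {x : E | 2 * r ≤ ‖x‖}, |K (x - y) - K x| ≤ C) {a y : E} {r : ℝ}
    (hy : y ∈ closedBall a r) :
    ∫⁻ z in (closedBall a (2 * r))ᶜ, ‖K (z - y) - K (z - a)‖ₑ ≤ ENNReal.ofReal C := by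
  have hr : 0 ≤ r := dist_nonneg.trans hy
  rcases hr.eq_or_lt with rfl | hr
  · rw [closedBall_zero, Set.mem_singleton_iff] at hy
    simp [hy]
  have hms : MeasurableSet {x : E | 2 * r ≤ ‖x‖} :=
    measurableSet_le measurable_const measurable_norm
  have h := hH r (y - a) hr (by rwa [← dist_eq_norm])
  have hi : Integrable (fun x => K (x - (y - a)) - K x) (volume.restrict {x : E | 2 * r ≤ ‖x‖}) :=
    ((hKi.comp_sub_right (y - a)).sub hKi).integrableOn
  have e := ofReal_integral_norm_eq_lintegral_enorm hi
  simp only [Real.norm_eq_abs] at e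
  refine le_trans ?_ (e ▸ ENNReal.ofReal_le_ofReal h)
  rw [← lintegral_indicator measurableSet_closedBall.compl, ← lintegral_indicator hms,
    ← lintegral_sub_right_eq_self
      ({x : E | 2 * r ≤ ‖x‖}.indicator fun x => ‖K (x - (y - a)) - K x‖ₑ) a]
  apply lintegral_mono
  intro z
  by_cases hz : z ∈ closedBall a (2 * r)
  · simp [hz]
  · have hz' : 2 * r ≤ ‖z - a‖ := by
      rw [mem_closedBall, not_le, dist_eq_norm] at hz; exact hz.le
    have e3 : z - a - (y - a) = z - y := by abel
    simp [hz, hz', Set.indicator, e3]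

lemma measure_lt_abs_sum_le [Nontrivial E] {K : E → ℝ} (hKc : Continuous K) (hKi : Integrable K)
    {C₂ C : ℝ} (hC₂ : 0 ≤ C₂) (hC : 0 ≤ C)
    (hW : ∀ (g : E → ℝ) (r : ℝ), MemLp g 2 → 0 < r →
      volume {x | r < |∫ y, K (x - y) * g y|} ≤ ENNReal.ofReal (C₂ * (∫ y, g y ^ 2) / r ^ 2))
    (hH : ∀ (r : ℝ) (y : E), 0 < r → ‖y‖ ≤ r →
      ∫ x in {x : E | 2 * r ≤ ‖x‖}, |K (x - y) - K x| ≤ C)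
    (x : ℕ → E) (α : ℕ → ℝ) (n : ℕ) {t : ℝ} (ht : 0 < t) :
    volume {z | 2 * t < |∑ i ∈ Finset.range n, α i * K (z - x i)|}
      ≤ ENNReal.ofReal ((7 ^ finrank ℝ E + C₂ + C) * (∑ i ∈ Finset.range n, |α i|) / t) := by
  obtain ⟨r, G, hG0, hG⟩ := exists_greedy_balls x (fun i => |α i| / t) (fun i => by positivity)
  set S := ∑ i ∈ Finset.range n, |α i| with hS
  have hS0 : 0 ≤ S := Finset.sum_nonneg fun i _ => abs_nonneg _
  set B : ℕ → Set E := fun i => closedBall (x i) (r i) \ G i with hB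
  have hBm : ∀ i, MeasurableSet (B i) := fun i => measurableSet_closedBall.diff (hG i).2.1
  have hBv : ∀ i, volume (B i) = ENNReal.ofReal (|α i| / t) := fun i => (hG i).2.2.2.1
  have hBf : ∀ i, volume (B i) ≠ ⊤ := fun i => by rw [hBv]; exact ENNReal.ofReal_ne_top
  set s : ℕ → ℝ := fun i => if 0 ≤ α i then 1 else -1 with hs
  have hsα : ∀ i, α i = s i * |α i| := by
    intro i; simp only [hs]; split_ifs with h
    · rw [abs_of_nonneg h, one_mul]
    · rw [abs_of_neg (not_le.1 h)]; ring
  have hsabs : ∀ i, |s i| = 1 := by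
    intro i; simp only [hs]; split_ifs <;> simp
  set g : ℕ → E → ℝ := fun m y => ∑ i ∈ Finset.range m, (B i).indicator (fun _ => s i * t) y with hg
  have hgb : ∀ m y, (y ∈ G m → |g m y| ≤ t) ∧ (y ∉ G m → g m y = 0) := by
    intro m y
    induction m with
    | zero => simp [hg, ht.le]
    | succ m ih =>
      have hgs : g (m + 1) y = g m y + (B m).indicator (fun _ => s m * t) y :=
        Finset.sum_range_succ _ _
      rw [(hG m).2.2.1, hgs]
      by_cases h1 : y ∈ G m
      · have : y ∉ B m := fun h => h.2 h1
        simp only [Set.indicator_of_notMem this, add_zero]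
        exact ⟨fun _ => ih.1 h1, fun h => absurd (Or.inl h1) h⟩
      · rw [ih.2 h1, zero_add]
        by_cases h2 : y ∈ closedBall (x m) (r m)
        · have : y ∈ B m := ⟨h2, h1⟩
          rw [Set.indicator_of_mem this, abs_mul, hsabs, one_mul, abs_of_pos ht]
          exact ⟨fun _ => le_rfl, fun h => absurd (Or.inr h2) h⟩
        · have : y ∉ B m := fun h => h2 h.1
          rw [Set.indicator_of_notMem this]
          exact ⟨fun _ => by simp [ht.le], fun _ => rfl⟩
  have hgL : MemLp (g n) 2 := memLp_finsetSum _ fun i _ =>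
    memLp_indicator_const 2 (hBm i) _ (Or.inr (hBf i))
  have hGv : volume (G n) = ENNReal.ofReal (S / t) := by
    rw [(hG n).2.2.2.2, hS, Finset.sum_div]
  have hgsq : ∫ y, g n y ^ 2 ≤ t * S := by
    calc ∫ y, g n y ^ 2 ≤ ∫ y, (G n).indicator (fun _ => t ^ 2) y := by
          apply integral_mono hgL.integrable_sq
          · rw [integrable_indicator_iff (hG n).2.1]
            exact integrableOn_const (by rw [hGv]; exact ENNReal.ofReal_ne_top)
          · intro y
            by_cases hy : y ∈ G n
            · simp only [Set.indicator_of_mem hy]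
              rw [← sq_abs]
              have := (hgb n y).1 hy
              gcongr
            · simp [Set.indicator_of_notMem hy, (hgb n y).2 hy]
      _ = t * S := by
          rw [integral_indicator (hG n).2.1, setIntegral_const, Measure.real, hGv,
            ENNReal.toReal_ofReal (by positivity), smul_eq_mul]
          field_simp
  have hKz : ∀ z, Integrable (fun y => K (z - y)) := fun z => hKi.comp_sub_left z
  have hconv : ∀ z, ∫ y, K (z - y) * g n y
      = ∑ i ∈ Finset.range n, s i * t * ∫ y in B i, K (z - y) := by
    intro z
    have e : ∀ y, K (z - y) * g n y
        = ∑ i ∈ Finset.range n, s i * t * (B i).indicator (fun y => K (z - y)) y := by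
      intro y
      simp only [hg, Finset.mul_sum]
      refine Finset.sum_congr rfl fun i _ => ?_
      by_cases h : y ∈ B i
      · simp only [Set.indicator_of_mem h]; ring
      · simp only [Set.indicator_of_notMem h]; ring
    simp_rw [e]
    rw [integral_finsetSum _ fun i _ => ((hKz z).indicator (hBm i)).const_mul _]
    refine Finset.sum_congr rfl fun i _ => ?_
    rw [integral_const_mul, integral_indicator (hBm i)]
  set D : ℕ → E → ENNReal := fun i z => ∫⁻ y in B i, ‖K (z - y) - K (z - x i)‖ₑ with hD
  have hDm : ∀ i, Measurable (D i) := by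
    intro i
    apply Measurable.lintegral_prod_right'
      (f := fun p : E × E => ‖K (p.1 - p.2) - K (p.1 - x i)‖ₑ)
    exact Continuous.measurable (by fun_prop)
  have hdiff : ∀ z, ‖(∑ i ∈ Finset.range n, α i * K (z - x i)) - ∫ y, K (z - y) * g n y‖ₑ
      ≤ ENNReal.ofReal t * ∑ i ∈ Finset.range n, D i z := by
    intro z
    rw [hconv, ← Finset.sum_sub_distrib, Finset.mul_sum]
    refine (enorm_sum_le _ _).trans (Finset.sum_le_sum fun i _ => ?_)
    have e : α i * K (z - x i) - s i * t * ∫ y in B i, K (z - y)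
        = -(s i * t) * ∫ y in B i, (K (z - y) - K (z - x i)) := by
      rw [integral_sub (hKz z).integrableOn (integrableOn_const (hBf i)), setIntegral_const,
        Measure.real, hBv, ENNReal.toReal_ofReal (by positivity), smul_eq_mul]
      nth_rewrite 1 [hsα i]
      field_simp
      ring
    rw [e, enorm_mul]
    have e2 : ‖-(s i * t)‖ₑ = ENNReal.ofReal t := by
      rw [Real.enorm_eq_ofReal_abs, abs_neg, abs_mul, hsabs, one_mul, abs_of_pos ht]
    rw [e2]
    gcongr
    exact enorm_integral_le_lintegral_enorm _
  set U := ⋃ i ∈ Finset.range n, closedBall (x i) (2 * r i) with hU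
  have hUm : MeasurableSet U := Finset.measurableSet_biUnion _ fun i _ => measurableSet_closedBall
  have hDi : ∀ i ∈ Finset.range n, ∫⁻ z in Uᶜ, D i z
      ≤ ENNReal.ofReal C * ENNReal.ofReal (|α i| / t) := by
    intro i hi
    calc ∫⁻ z in Uᶜ, D i z ≤ ∫⁻ z in (closedBall (x i) (2 * r i))ᶜ, D i z := by
          apply lintegral_mono_set
          exact Set.compl_subset_compl.2
            (Set.subset_biUnion_of_mem (u := fun i => closedBall (x i) (2 * r i)) hi)
      _ = ∫⁻ y in B i, ∫⁻ z in (closedBall (x i) (2 * r i))ᶜ, ‖K (z - y) - K (z - x i)‖ₑ := by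
          simp only [hD]
          rw [lintegral_lintegral_swap]
          apply Measurable.aemeasurable
          exact Continuous.measurable (by fun_prop)
      _ ≤ ∫⁻ y in B i, ENNReal.ofReal C := by
          apply setLIntegral_mono measurable_const
          exact fun y hy => setLIntegral_compl_closedBall_le hKi hH hy.1
      _ = _ := by rw [setLIntegral_const, hBv]
  have hbad : volume.restrict Uᶜ {z | 1 ≤ ∑ i ∈ Finset.range n, D i z}
      ≤ ENNReal.ofReal (C * S / t) := by
    have h1 := mul_meas_ge_le_lintegral (μ := volume.restrict Uᶜ)
      (Finset.measurable_sum (Finset.range n) fun i _ => hDm i) 1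
    rw [one_mul] at h1
    refine h1.trans ?_
    rw [lintegral_finsetSum _ fun i _ => hDm i]
    refine (Finset.sum_le_sum hDi).trans ?_
    rw [← Finset.mul_sum, ← ENNReal.ofReal_sum_of_nonneg fun i _ => by positivity,
      ← ENNReal.ofReal_mul hC, ← Finset.sum_div, mul_div_assoc]
  have hUv : volume U ≤ ENNReal.ofReal (7 ^ finrank ℝ E * S / t) := by
    have h1 := measure_biUnion_closedBall_two_mul_le x r (fun i => (hG i).1) n
    have h2 : ∀ m, (⋃ i ∈ Finset.range m, closedBall (x i) (r i)) ⊆ G m := by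
      intro m
      induction m with
      | zero => simp
      | succ m ih =>
        rw [(hG m).2.2.1, Finset.range_add_one, Finset.set_biUnion_insert]
        exact Set.union_subset Set.subset_union_right (ih.trans Set.subset_union_left)
    refine h1.trans ?_
    rw [mul_div_assoc, ENNReal.ofReal_mul (by positivity), ← hGv]
    gcongr
    exact h2 n
  have hsub : {z | 2 * t < |∑ i ∈ Finset.range n, α i * K (z - x i)|}
      ⊆ U ∪ {z | t < |∫ y, K (z - y) * g n y|} ∪ ({z | 1 ≤ ∑ i ∈ Finset.range n, D i z} ∩ Uᶜ) := by
    intro z hz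
    have hz' : 2 * t < |∑ i ∈ Finset.range n, α i * K (z - x i)| := hz
    by_cases hzU : z ∈ U
    · exact Or.inl (Or.inl hzU)
    by_cases hz2 : t < |∫ y, K (z - y) * g n y|
    · exact Or.inl (Or.inr hz2)
    refine Or.inr ⟨?_, hzU⟩
    change 1 ≤ ∑ i ∈ Finset.range n, D i z
    have h1 := hdiff z
    have h2 := abs_sub_abs_le_abs_sub (∑ i ∈ Finset.range n, α i * K (z - x i))
      (∫ y, K (z - y) * g n y)
    have h3 : ENNReal.ofReal t ≤ ENNReal.ofReal t * ∑ i ∈ Finset.range n, D i z := by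
      refine le_trans ?_ h1
      rw [Real.enorm_eq_ofReal_abs]
      apply ENNReal.ofReal_le_ofReal
      linarith
    by_contra h
    rw [not_le] at h
    have h4 : ENNReal.ofReal t * ∑ i ∈ Finset.range n, D i z < ENNReal.ofReal t * 1 :=
      ENNReal.mul_lt_mul_right (by simpa using ht) ENNReal.ofReal_ne_top h
    rw [mul_one] at h4
    exact absurd h3 (not_le.2 h4)
  have hfin : volume {z | t < |∫ y, K (z - y) * g n y|} ≤ ENNReal.ofReal (C₂ * S / t) := by
    refine (hW (g n) t hgL ht).trans (ENNReal.ofReal_le_ofReal ?_)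
    rw [div_le_div_iff₀ (by positivity) ht]
    calc C₂ * (∫ y, g n y ^ 2) * t ≤ C₂ * (t * S) * t := by gcongr
      _ = C₂ * S * t ^ 2 := by ring
  have hbad' : volume ({z | 1 ≤ ∑ i ∈ Finset.range n, D i z} ∩ Uᶜ) ≤
      ENNReal.ofReal (C * S / t) := by
    rwa [Measure.restrict_apply' hUm.compl] at hbad
  calc _ ≤ _ := measure_mono hsub
    _ ≤ ENNReal.ofReal (7 ^ finrank ℝ E * S / t) + ENNReal.ofReal (C₂ * S / t)
          + ENNReal.ofReal (C * S / t) :=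
        (measure_union_le _ _).trans (add_le_add ((measure_union_le _ _).trans
          (add_le_add hUv hfin)) hbad')
    _ = _ := by
        rw [← ENNReal.ofReal_add (by positivity) (by positivity),
          ← ENNReal.ofReal_add (by positivity) (by positivity)]
        congr 1; ring


lemma exists_sum_eq_integral_simpleFunc {φ : SimpleFunc E E} {v K : E → ℝ} (hv : Integrable v) :
    ∃ (x : ℕ → E) (α : ℕ → ℝ) (n : ℕ), ∑ i ∈ Finset.range n, |α i| ≤ ∫ y, |v y| ∧
      ∀ z, ∑ i ∈ Finset.range n, α i * K (z - x i) = ∫ y, K (z - φ y) * v y := by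
  classical
  set n := φ.range.card
  set e := φ.range.equivFin.symm with he
  set x : ℕ → E := fun i => if h : i < n then (e ⟨i, h⟩ : E) else 0 with hx
  have hsum : ∀ f : E → ℝ, ∑ i ∈ Finset.range n, f (x i) = ∑ p ∈ φ.range, f p := by
    intro f
    rw [← Fin.sum_univ_eq_sum_range (fun i => f (x i)) n, ← Finset.sum_coe_sort φ.range,
      ← Equiv.sum_comp e]
    refine Finset.sum_congr rfl fun i _ => ?_
    simp [hx]
  have hsplit : ∀ (u : E → ℝ), Integrable u → ∫ y, u y = ∑ p ∈ φ.range, ∫ y in φ ⁻¹' {p}, u y := by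
    intro u hu
    rw [← integral_biUnion_finset _ (fun p _ => φ.measurableSet_fiber p) ?_
      (fun p _ => hu.integrableOn)]
    · rw [← setIntegral_univ]
      congr 2
      ext y
      simp
    · intro p _ q _ hpq
      refine Set.disjoint_left.2 fun y hy hy' => hpq ?_
      simp only [Set.mem_preimage, Set.mem_singleton_iff] at hy hy'
      rw [← hy, ← hy']
  refine ⟨x, fun i => ∫ y in φ ⁻¹' {x i}, v y, n, ?_, fun z => ?_⟩
  · rw [hsum (fun p => |∫ y in φ ⁻¹' {p}, v y|), hsplit _ hv.abs]
    exact Finset.sum_le_sum fun p _ => abs_integral_le_integral_abs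
  · rw [hsum (fun p => (∫ y in φ ⁻¹' {p}, v y) * K (z - p)), hsplit]
    · refine Finset.sum_congr rfl fun p _ => ?_
      rw [mul_comm, ← integral_const_mul]
      refine setIntegral_congr_fun (φ.measurableSet_fiber p) fun y hy => ?_
      have hy' : φ y = p := hy
      simp only [hy']
    · refine hv.bdd_mul (c := ∑ p ∈ φ.range, |K (z - p)|) ?_ (ae_of_all _ fun y => ?_)
      · exact (φ.map fun p => K (z - p)).aestronglyMeasurable
      · exact Finset.single_le_sum (f := fun p => |K (z - p)|) (fun p _ => abs_nonneg _)
          (φ.mem_range_self y)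

lemma measure_lt_abs_convolution_le_of_atoms {K : E → ℝ} {v : E → ℝ} {A M : ℝ} (hA : 0 ≤ A)
    (hM : 0 ≤ M) (hKb : Continuous K) (hKi : ∃ B, ∀ z, |K z| ≤ B)
    (hK : ∀ z w : E, ‖w‖ ≤ 1 → |K (z - w) - K z| ≤ M * ‖w‖)
    (hatoms : ∀ (x : ℕ → E) (α : ℕ → ℝ) (n : ℕ) (t : ℝ), 0 < t →
      volume {z | 2 * t < |∑ i ∈ Finset.range n, α i * K (z - x i)|}
        ≤ ENNReal.ofReal (A * (∑ i ∈ Finset.range n, |α i|) / t))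
    (hv : Continuous v) (hvc : HasCompactSupport v) {r : ℝ} (hr : 0 < r) :
    volume {z | r < |∫ y, K (z - y) * v y|} ≤ ENNReal.ofReal (4 * A * (∫ y, |v y|) / r) := by
  have hvi : Integrable v := hv.integrable_of_hasCompactSupport hvc
  set I := ∫ y, |v y| with hI
  have hI0 : 0 ≤ I := integral_nonneg fun y => abs_nonneg _
  set δ := min 1 (r / (2 * (M + 1) * (I + 1))) with hδ
  have hδ0 : 0 < δ := lt_min one_pos (by positivity)
  obtain ⟨N, hN⟩ : ∃ N, ∀ y ∈ tsupport v, ∃ i ≤ N, dist y (TopologicalSpace.denseSeq E i) < δ := by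
    have hcov : tsupport v ⊆ ⋃ i, ball (TopologicalSpace.denseSeq E i) δ := by
      intro y _
      obtain ⟨i, hi⟩ := (TopologicalSpace.denseRange_denseSeq E).exists_dist_lt y hδ0
      exact Set.mem_iUnion.2 ⟨i, hi⟩
    obtain ⟨s, hs⟩ := hvc.isCompact.elim_finite_subcover _ (fun i => isOpen_ball) hcov
    refine ⟨s.sup id, fun y hy => ?_⟩
    obtain ⟨i, hi⟩ := Set.mem_iUnion.1 (hs hy)
    obtain ⟨his, hi⟩ := Set.mem_iUnion.1 hi
    exact ⟨i, Finset.le_sup (f := id) his, hi⟩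
  set φ := SimpleFunc.nearestPt (TopologicalSpace.denseSeq E) N with hφ
  have hφd : ∀ y ∈ tsupport v, ‖φ y - y‖ ≤ δ := by
    intro y hy
    obtain ⟨i, hi, hd⟩ := hN y hy
    have := SimpleFunc.edist_nearestPt_le (TopologicalSpace.denseSeq E) y hi
    rw [edist_dist, edist_dist, ENNReal.ofReal_le_ofReal_iff dist_nonneg, dist_eq_norm] at this
    rw [dist_comm] at hd
    exact this.trans hd.le
  obtain ⟨x, α, n, hα, hsum⟩ := exists_sum_eq_integral_simpleFunc (φ := φ) (K := K) hvi
  obtain ⟨B, hB⟩ := hKi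
  have hint1 : ∀ z, Integrable (fun y => K (z - y) * v y) := fun z =>
    hvi.bdd_mul (c := B) (Continuous.aestronglyMeasurable (by fun_prop))
      (ae_of_all _ fun y => hB _)
  have hint2 : ∀ z, Integrable (fun y => K (z - φ y) * v y) := fun z =>
    hvi.bdd_mul (c := B)
      ((hKb.measurable.comp (measurable_const.sub φ.measurable)).aestronglyMeasurable)
      (ae_of_all _ fun y => hB _)
  have hclose : ∀ z, |(∫ y, K (z - y) * v y) - ∫ y, K (z - φ y) * v y| ≤ r / 2 := by
    intro z
    rw [← integral_sub (hint1 z) (hint2 z)]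
    calc |∫ y, (K (z - y) * v y - K (z - φ y) * v y)|
        ≤ ∫ y, M * δ * |v y| := by
          rw [← Real.norm_eq_abs]
          refine norm_integral_le_of_norm_le (hvi.abs.const_mul _) (ae_of_all _ fun y => ?_)
          by_cases hy : y ∈ tsupport v
          · rw [← sub_mul, Real.norm_eq_abs, abs_mul]
            gcongr
            have h1 := hK (z - y) (φ y - y) ((hφd y hy).trans (min_le_left _ _))
            rw [show z - y - (φ y - y) = z - φ y by abel, abs_sub_comm] at h1
            exact h1.trans (mul_le_mul_of_nonneg_left (hφd y hy) hM)
          · simp [image_eq_zero_of_notMem_tsupport hy]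
      _ = M * δ * I := integral_const_mul _ _
      _ ≤ (M + 1) * (r / (2 * (M + 1) * (I + 1))) * (I + 1) := by
          gcongr
          · linarith
          · exact min_le_right _ _
          · linarith
      _ = r / 2 := by field_simp
  have hsub : {z | r < |∫ y, K (z - y) * v y|}
      ⊆ {z | 2 * (r / 4) < |∑ i ∈ Finset.range n, α i * K (z - x i)|} := by
    intro z hz
    have hz' : r < |∫ y, K (z - y) * v y| := hz
    change 2 * (r / 4) < |∑ i ∈ Finset.range n, α i * K (z - x i)|
    rw [hsum]
    have h1 := hclose z
    have h2 := abs_sub_abs_le_abs_sub (∫ y, K (z - y) * v y) (∫ y, K (z - φ y) * v y)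
    linarith
  refine (measure_mono hsub).trans ((hatoms x α n (r / 4) (by positivity)).trans
    (ENNReal.ofReal_le_ofReal ?_))
  calc A * (∑ i ∈ Finset.range n, |α i|) / (r / 4) ≤ A * I / (r / 4) := by gcongr
    _ = 4 * A * I / r := by field_simp

/-- Weak type `(1,1)` bound, uniform in `J`, for convolution with `∑_{l<J} 2^{ld} k(2^l ·)`. -/
theorem SchwartzMap.exists_weak_type [Nontrivial E] (k : 𝓢(E, ℝ)) (h0 : ∫ x, k x = 0) :
    ∃ C : ℝ, 0 ≤ C ∧ ∀ (J : ℕ) (v : E → ℝ) (r : ℝ), Continuous v → HasCompactSupport v → 0 < r →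
      volume {x | r < |∫ y, (∑ l ∈ Finset.range J, dilate l k (x - y)) * v y|}
        ≤ ENNReal.ofReal (C * (∫ y, |v y|) / r) := by
  obtain ⟨C₂, hC₂, hW⟩ := k.exists_measure_lt_abs_sum_convolution_le h0
  obtain ⟨C, hC, hH⟩ := k.exists_hormander
  refine ⟨4 * (7 ^ finrank ℝ E + C₂ + C), by positivity, fun J v r hv hvc hr => ?_⟩
  set κ : 𝓢(E, ℝ) := ∑ l ∈ Finset.range J, dilated l k with hκ
  have e : ∀ x, κ x = ∑ l ∈ Finset.range J, dilate l k x := fun x => by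
    rw [hκ, sum_apply]; rfl
  obtain ⟨M, hM, hL⟩ := κ.exists_abs_sub_le_majorant
  obtain ⟨B, hB, hb⟩ := κ.exists_norm_le_majorant
  simp only [← e] at hW hH ⊢
  refine measure_lt_abs_convolution_le_of_atoms (by positivity) hM κ.continuous
    ⟨B, fun z => (hb z).trans (mul_le_of_le_one_right hB (majorant_le_one z))⟩ (fun z w hw => ?_) ?_
    hv hvc hr
  · exact (hL z w hw).trans (mul_le_of_le_one_right (by positivity) (majorant_le_one z))
  · intro x α n t ht
    refine measure_lt_abs_sum_le κ.continuous κ.integrable hC₂ hC ?_ ?_ x α n ht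
    · intro g r hg hr
      simpa only [← e] using hW J g r hg hr
    · intro r y hr hy
      simpa only [← e] using hH J r y hr hy

end WeakType

section Parametrix

open Module SchwartzMap FourierTransform LineDeriv
open scoped ContDiff

variable {d : ℕ}

local notation "𝔼" => EuclideanSpace ℝ (Fin d)

/-- The list of coordinate directions in which `pderivMulti α` differentiates. -/
def multiList (α : Fin d → ℕ) : List (Fin d) :=
  (List.finRange d).flatMap fun i => List.replicate (α i) i

/-- Iterated partial derivative along a list of coordinate directions. -/
noncomputable def iterPDeriv (L : List (Fin d)) (φ : 𝔼 → ℝ) : 𝔼 → ℝ :=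
  L.foldr pderiv' φ

/-- `iterPDeriv` as an operation on Schwartz functions. -/
noncomputable def SchwartzMap.iterLineDeriv {F : Type*} [NormedAddCommGroup F] [NormedSpace ℝ F]
    (L : List (Fin d)) (q : 𝓢(𝔼, F)) : 𝓢(𝔼, F) :=
  L.foldr (fun i r => ∂_{EuclideanSpace.single i (1 : ℝ)} r) q

lemma pderivMulti_eq_iterPDeriv (α : Fin d → ℕ) (φ : 𝔼 → ℝ) :
    pderivMulti α φ = iterPDeriv (multiList α) φ := by
  have h : ∀ (i : Fin d) (a : ℕ) (ψ : 𝔼 → ℝ),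
      (pderiv' i)^[a] ψ = (List.replicate a i).foldr pderiv' ψ := by
    intro i a ψ
    induction a with
    | zero => rfl
    | succ a ih => rw [Function.iterate_succ_apply', ih, List.replicate_succ, List.foldr_cons]
  simp only [pderivMulti, iterPDeriv, multiList, List.foldr_flatMap, h]

lemma length_multiList (α : Fin d → ℕ) : (multiList α).length = ∑ i, α i := by
  simp [multiList, List.length_flatMap, Fin.sum_univ_def]

lemma prod_map_multiList {R : Type*} [CommMonoid R] (α : Fin d → ℕ) (f : Fin d → R) :
    ((multiList α).map f).prod = ∏ i, f i ^ α i := by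
  rw [multiList, Fin.prod_univ_def]
  induction List.finRange d with
  | nil => simp
  | cons i L ih => simp [ih]

lemma iterPDeriv_schwartz (L : List (Fin d)) (q : 𝓢(𝔼, ℝ)) :
    iterPDeriv L q = iterLineDeriv L q := by
  induction L with
  | nil => rfl
  | cons i L ih =>
    change pderiv' i (iterPDeriv L q) = _
    rw [ih]; rfl

/-- The real part of a complex Schwartz function. -/
noncomputable def SchwartzMap.rePart (q : 𝓢(𝔼, ℂ)) : 𝓢(𝔼, ℝ) :=
  postcompCLM (𝕜 := ℝ) Complex.reCLM q

lemma SchwartzMap.rePart_apply (q : 𝓢(𝔼, ℂ)) (x : 𝔼) : q.rePart x = (q x).re := rfl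

lemma SchwartzMap.iterLineDeriv_rePart (L : List (Fin d)) (q : 𝓢(𝔼, ℂ)) :
    iterLineDeriv L q.rePart = (iterLineDeriv L q).rePart := by
  induction L with
  | nil => rfl
  | cons i L ih =>
    change ∂_{EuclideanSpace.single i (1 : ℝ)} (iterLineDeriv L q.rePart) = _
    rw [ih]
    ext x
    have h := (Complex.reCLM.hasFDerivAt (x := iterLineDeriv L q x)).comp x
      ((iterLineDeriv L q).differentiableAt (x := x)).hasFDerivAt
    have e : (⇑(iterLineDeriv L q).rePart : 𝔼 → ℝ) = Complex.reCLM ∘ iterLineDeriv L q := rfl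
    rw [lineDerivOp_apply_eq_fderiv, e, h.fderiv]
    rfl

lemma SchwartzMap.exists_iterLineDeriv_fourierInv (L : List (Fin d)) (u : 𝓢(𝔼, ℂ)) :
    ∃ w : 𝓢(𝔼, ℂ), iterLineDeriv L (𝓕⁻ u) = 𝓕⁻ w ∧
      ∀ ξ, w ξ = (2 * Real.pi * Complex.I) ^ L.length * (L.map fun i => (ξ i : ℂ)).prod * u ξ := by
  induction L with
  | nil => exact ⟨u, rfl, fun ξ => by simp⟩
  | cons i L ih =>
    obtain ⟨w, hw, h⟩ := ih
    refine ⟨(2 * Real.pi * Complex.I) •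
      smulLeftCLM ℂ (inner ℝ · (EuclideanSpace.single i (1 : ℝ))) w, ?_, ?_⟩
    · change ∂_{EuclideanSpace.single i (1 : ℝ)} (iterLineDeriv L (𝓕⁻ u)) = _
      rw [hw, lineDerivOp_fourierInv_eq]
    · intro ξ
      rw [smul_apply, smulLeftCLM_apply_apply (by fun_prop), h]
      simp [EuclideanSpace.inner_single_right]
      ring

lemma SchwartzMap.integral_iterPDeriv_eq_zero {L : List (Fin d)} (hL : L ≠ []) (q : 𝓢(𝔼, ℝ)) :
    ∫ x, iterPDeriv L q x = 0 := by
  obtain ⟨i, L, rfl⟩ := List.exists_cons_of_ne_nil hL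
  have := integral_mul_fderiv_eq_neg_fderiv_mul_of_integrable (μ := (volume : Measure 𝔼))
    (f := fun _ => (1 : ℝ)) (g := iterLineDeriv L q) (v := EuclideanSpace.single i (1 : ℝ))
    (by simp) (by
      simpa using! (∂_{EuclideanSpace.single i (1 : ℝ)} (iterLineDeriv L q)).integrable)
    (by simpa using! (iterLineDeriv L q).integrable) (by simp)
    (fun _ _ => (iterLineDeriv L q).differentiableAt)
  simp at this
  rw [iterPDeriv_schwartz]
  exact this

lemma SchwartzMap.dilate_rePart_fourierInv {a b : 𝓢(𝔼, ℂ)}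
    (h : ∀ ξ, b ξ = a ((2 : ℝ)⁻¹ • ξ)) (x : 𝔼) :
    dilate 1 (𝓕⁻ a).rePart x = (𝓕⁻ b).rePart x := by
  have key : 𝓕⁻ b x = ((2 : ℝ) ^ finrank ℝ 𝔼 : ℝ) • 𝓕⁻ a ((2 : ℝ) • x) := by
    rw [fourierInv_coe, fourierInv_coe, Real.fourierInv_eq', Real.fourierInv_eq']
    have := Measure.integral_comp_smul (volume : Measure 𝔼) (fun v : 𝔼 =>
      Complex.exp (↑(2 * Real.pi * inner ℝ v ((2 : ℝ) • x)) * Complex.I) • a v) (2 : ℝ)⁻¹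
    rw [inv_pow, inv_inv, abs_of_nonneg (by positivity)] at this
    rw [← this]
    congr 1; ext y
    rw [real_inner_smul_left, real_inner_smul_right, inv_mul_cancel_left₀ (by positivity), h]
  rw [rePart_apply, key, dilate, rePart_apply, pow_one, Complex.smul_re, smul_eq_mul]

/-- Off the wave cone, the operator `P ↦ 𝒜(Pδ)` has a parametrix whose dyadic pieces are dilates
of fixed Schwartz functions. -/
theorem exists_parametrix {m n k : ℕ} {A : (Fin d → ℕ) → Matrix (Fin n) (Fin m) ℝ}
    {P : Fin m → ℝ} (hP : P ∉ waveCone k A) :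
    ∃ (Φ : 𝓢(𝔼, ℝ)) (Q : Fin n → 𝓢(𝔼, ℝ)), ∫ x, Φ x = 1 ∧ ∀ x, dilate 1 Φ x - Φ x =
      ∑ i, ∑ α ∈ multiIdxEq d k, (∑ j, A α i j * P j) * pderivMulti α (Q i) x := by
  set c : Fin n → (Fin d → ℕ) → ℝ := fun i α => ∑ j, A α i j * P j with hc
  set p : Fin n → 𝔼 → ℝ := fun i ξ => ∑ α ∈ multiIdxEq d k, c i α * ∏ l, ξ l ^ α l with hp
  set S : 𝔼 → ℝ := fun ξ => ∑ i, p i ξ ^ 2 with hS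
  have hpc : ∀ i, ContDiff ℝ ∞ (p i) := fun i => by
    refine ContDiff.sum fun α _ => contDiff_const.mul (contDiff_prod fun l _ => ?_)
    exact ContDiff.pow (contDiff_piLp_apply (p := 2) (i := l)) _
  have hSc : ContDiff ℝ ∞ S := ContDiff.sum fun i _ => (hpc i).pow 2
  have hS0 : ∀ ξ, ξ ≠ 0 → S ξ ≠ 0 := by
    intro ξ hξ h0
    refine hP ⟨ξ, fun h => hξ (by ext l; exact congrFun h l), fun i => ?_⟩
    have := (Finset.sum_eq_zero_iff_of_nonneg fun i _ => sq_nonneg (p i ξ)).1 h0 i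
      (Finset.mem_univ i)
    rw [sq_eq_zero_iff] at this
    rw [← this]
    exact Finset.sum_congr rfl fun α _ => mul_comm _ _
  let φ : ContDiffBump (0 : 𝔼) := ⟨1, 2, one_pos, one_lt_two⟩
  set φ₂ : 𝔼 → ℝ := fun ξ => φ ((2 : ℝ)⁻¹ • ξ) with hφ₂
  have hφ₂c : ContDiff ℝ ∞ φ₂ := φ.contDiff.comp (contDiff_const_smul _)
  have hφ₂s : HasCompactSupport φ₂ := φ.hasCompactSupport.comp_smul (by norm_num)
  set ζ : 𝔼 → ℝ := fun ξ => φ₂ ξ - φ ξ with hζ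
  have hζc : ContDiff ℝ ∞ ζ := hφ₂c.sub φ.contDiff
  have hζs : HasCompactSupport ζ := hφ₂s.sub φ.hasCompactSupport
  have hζ0 : ∀ ξ ∈ ball (0 : 𝔼) 1, ζ ξ = 0 := by
    intro ξ hξ
    rw [mem_ball_zero_iff] at hξ
    have h1 : φ ξ = 1 := φ.one_of_mem_closedBall (by simpa [φ] using hξ.le)
    have h2 : φ ((2 : ℝ)⁻¹ • ξ) = 1 := φ.one_of_mem_closedBall (by
      rw [mem_closedBall_zero_iff, norm_smul]
      norm_num [φ]; linarith [norm_nonneg ξ])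
    simp only [hζ, hφ₂, h1, h2, sub_self]
  set u : Fin n → 𝔼 → ℝ := fun i ξ => ζ ξ * (p i ξ / S ξ) with hu
  have huc : ∀ i, ContDiff ℝ ∞ (u i) := fun i => by
    refine contDiff_iff_contDiffAt.2 fun ξ => ?_
    rcases eq_or_ne ξ 0 with rfl | hξ
    · refine (contDiffAt_const (c := (0 : ℝ))).congr_of_eventuallyEq ?_
      filter_upwards [ball_mem_nhds (0 : 𝔼) one_pos] with ξ hξ
      simp only [hu, hζ0 ξ hξ, zero_mul]
    · exact hζc.contDiffAt.mul ((hpc i).contDiffAt.div hSc.contDiffAt (hS0 ξ hξ))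
  have hus : ∀ i, HasCompactSupport (u i) := fun i => hζs.mul_right
  set φc : 𝓢(𝔼, ℂ) := (φ.hasCompactSupport.toSchwartzMap φ.contDiff).toComplex
  set φc₂ : 𝓢(𝔼, ℂ) := (hφ₂s.toSchwartzMap hφ₂c).toComplex
  set uc : Fin n → 𝓢(𝔼, ℂ) := fun i => ((hus i).toSchwartzMap (huc i)).toComplex
  set κ : ℂ := (2 * Real.pi * Complex.I) ^ k with hκ
  have hκ0 : κ ≠ 0 := pow_ne_zero _ (by simp [Real.pi_ne_zero])
  refine ⟨(𝓕⁻ φc).rePart, fun i => (𝓕⁻ (κ⁻¹ • uc i)).rePart, ?_, fun x => ?_⟩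
  · have h1 : 𝓕 (𝓕⁻ φc) 0 = 1 := by
      rw [fourier_fourierInv_eq]
      change ((φ 0 : ℝ) : ℂ) = 1
      rw [φ.one_of_mem_closedBall (by simp [φ]), Complex.ofReal_one]
    rw [fourier_coe, Real.fourier_eq'] at h1
    simp only [inner_zero_right, mul_zero, Complex.ofReal_zero, zero_mul, Complex.exp_zero,
      one_smul] at h1
    have := Complex.reCLM.integral_comp_comm (𝓕⁻ φc).integrable (μ := volume)
    rw [h1] at this
    exact this.trans rfl
  · rw [dilate_rePart_fourierInv (b := φc₂) fun ξ => rfl]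
    choose w hw hw' using fun (α : Fin d → ℕ) i =>
      exists_iterLineDeriv_fourierInv (multiList α) (κ⁻¹ • uc i)
    have hid : φc₂ - φc = ∑ i, ∑ α ∈ multiIdxEq d k, (c i α : ℂ) • w α i := by
      ext ξ
      have e1 : ∀ i, ∑ α ∈ multiIdxEq d k, (c i α : ℂ) * w α i ξ = ((p i ξ * u i ξ : ℝ) : ℂ) := by
        intro i
        rw [hp, Complex.ofReal_mul, Complex.ofReal_sum, Finset.sum_mul]
        refine Finset.sum_congr rfl fun α hα => ?_
        have hα' : ∑ l, α l = k := (Finset.mem_filter.1 hα).2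
        rw [hw', length_multiList, hα', prod_map_multiList, ← hκ, smul_apply]
        change (c i α : ℂ) * (κ * _ * (κ⁻¹ • (u i ξ : ℂ))) = _
        rw [smul_eq_mul]
        push_cast
        field_simp
      have e2 : ∑ i, p i ξ * u i ξ = ζ ξ := by
        by_cases h0 : ξ = 0
        · subst h0
          simp only [hu, hζ0 0 (by simp), zero_mul, mul_zero, Finset.sum_const_zero]
        · have : ∀ i, p i ξ * u i ξ = ζ ξ / S ξ * p i ξ ^ 2 := fun i => by
            simp only [hu]; ring
          rw [Finset.sum_congr rfl fun i _ => this i, ← Finset.mul_sum]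
          exact div_mul_cancel₀ _ (hS0 ξ h0)
      rw [sum_apply]
      simp only [sum_apply, smul_apply, smul_eq_mul, e1]
      rw [← Complex.ofReal_sum, e2]
      change (φ₂ ξ : ℂ) - φ ξ = _
      rw [hζ]; push_cast; rfl
    have hid' : 𝓕⁻ φc₂ - 𝓕⁻ φc = ∑ i, ∑ α ∈ multiIdxEq d k,
        (c i α : ℂ) • iterLineDeriv (multiList α) (𝓕⁻ (κ⁻¹ • uc i)) := by
      simp only [hw, ← fourierInv_smul, ← fourierInv_sum, ← hid]
      exact ((fourierInvCLM ℂ 𝓢(𝔼, ℂ)).map_sub φc₂ φc).symm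
    have := congrArg (fun q : 𝓢(𝔼, ℂ) => (q x).re) hid'
    simp only [sub_apply, sum_apply, smul_apply, Complex.sub_re, Complex.re_sum, smul_eq_mul,
      Complex.re_ofReal_mul] at this
    simp only [pderivMulti_eq_iterPDeriv, iterPDeriv_schwartz, iterLineDeriv_rePart, rePart_apply]
    exact this

end Parametrix

section Convolution

open Module SchwartzMap

variable {E : Type*} [NormedAddCommGroup E] [InnerProductSpace ℝ E] [FiniteDimensional ℝ E]
  [MeasurableSpace E] [BorelSpace E]

lemma integrable_conv_integrand {K v : E → ℝ} (hK : Integrable K) (hv : Integrable v) :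
    Integrable (fun p : E × E => K (p.1 - p.2) * v p.2) (volume.prod volume) := by
  refine (hv.convolution_integrand (ContinuousLinearMap.mul ℝ ℝ) hK).congr
    (ae_of_all _ fun p => ?_)
  simp [mul_comm]

lemma integrable_conv {K v : E → ℝ} (hK : Integrable K) (hv : Integrable v) :
    Integrable (fun x => ∫ y, K (x - y) * v y) :=
  (integrable_conv_integrand hK hv).integral_prod_left

lemma integral_conv {K v : E → ℝ} (hK : Integrable K) (hv : Integrable v) :
    ∫ x, ∫ y, K (x - y) * v y = (∫ x, K x) * ∫ y, v y := by
  rw [integral_integral_swap (integrable_conv_integrand hK hv)]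
  simp only [integral_mul_const, integral_sub_right_eq_self, integral_const_mul]

lemma conv_le {K v : E → ℝ} {M : ℝ} (hK0 : ∀ x, 0 ≤ K x) (hKM : ∀ x, K x ≤ M)
    (hv : Integrable v) (hv0 : ∀ x, 0 ≤ v x) (x : E) : ∫ y, K (x - y) * v y ≤ M * ∫ y, v y := by
  rw [← integral_const_mul]
  exact integral_mono_of_nonneg (ae_of_all _ fun y => mul_nonneg (hK0 _) (hv0 _)) (hv.const_mul M)
    (ae_of_all _ fun y => mul_le_mul_of_nonneg_right (hKM _) (hv0 _))

lemma sum_ite_inv_two_pow_le (L J : ℕ) :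
    ∑ l ∈ Finset.range J, (if L ≤ l then ((2 : ℝ) ^ l)⁻¹ else 0) ≤ 2 * ((2 : ℝ) ^ L)⁻¹ := by
  set h : ℕ → ℝ := fun l => 2 * ((2 : ℝ) ^ max l L)⁻¹ with hh
  have e : ∀ l, (if L ≤ l then ((2 : ℝ) ^ l)⁻¹ else 0) = h l - h (l + 1) := by
    intro l
    split_ifs with hl
    · simp only [hh, max_eq_left hl, max_eq_left (hl.trans l.le_succ), pow_succ]
      field_simp; ring
    · push Not at hl
      simp only [hh, max_eq_right hl.le, max_eq_right (Nat.succ_le_of_lt hl), sub_self]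
  rw [Finset.sum_congr rfl fun l _ => e l, Finset.sum_range_sub']
  have : 0 ≤ h J := by positivity
  simp only [hh, Nat.zero_max] at this ⊢
  linarith

lemma setIntegral_sum_dilate_majorant_le {a : E → ℝ} (ha : Integrable a) (h0 : ∀ x, 0 ≤ a x)
    (L J : ℕ) {G : Set E} (hG : volume G ≠ ⊤) :
    ∫ x in G, ∑ l ∈ Finset.range J, ((2 : ℝ) ^ l)⁻¹ * ∫ y, dilate l majorant (x - y) * a y
      ≤ 2 * (((2 : ℝ) ^ L) ^ finrank ℝ E * volume.real G
        + ((2 : ℝ) ^ L)⁻¹ * ∫ x : E, majorant x) * ∫ y, a y := by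
  have hI : 0 ≤ ∫ y, a y := integral_nonneg h0
  have hm : 0 ≤ ∫ x : E, majorant x := integral_nonneg fun x => (majorant_pos x).le
  have hd0 : ∀ l (x : E), 0 ≤ dilate l majorant x := fun l x =>
    mul_nonneg (by positivity) (majorant_pos _).le
  have hc : ∀ l, Integrable (fun x => ∫ y, dilate l majorant (x - y) * a y) := fun l =>
    integrable_conv (integrable_dilate integrable_majorant l) ha
  have hc0 : ∀ l x, 0 ≤ ∫ y, dilate l majorant (x - y) * a y := fun l x =>
    integral_nonneg fun y => mul_nonneg (hd0 _ _) (h0 _)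
  rw [integral_finsetSum _ fun l _ => ((hc l).const_mul _).integrableOn]
  simp only [integral_const_mul]
  have b1 : ∀ l, ∫ x in G, ∫ y, dilate l majorant (x - y) * a y
      ≤ (∫ x : E, majorant x) * ∫ y, a y := fun l => by
    refine (setIntegral_le_integral (hc l) (ae_of_all _ (hc0 l))).trans ?_
    rw [integral_conv (integrable_dilate integrable_majorant l) ha, integral_dilate]
  have b2 : ∀ l, l ≤ L → ∫ x in G, ∫ y, dilate l majorant (x - y) * a y
      ≤ ((2 : ℝ) ^ L) ^ finrank ℝ E * volume.real G * ∫ y, a y := fun l hl => by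
    have hle : ∀ x : E, dilate l majorant x ≤ ((2 : ℝ) ^ L) ^ finrank ℝ E := fun x => by
      refine (mul_le_of_le_one_right (by positivity) (majorant_le_one _)).trans ?_
      gcongr; norm_num
    refine (integral_mono (hc l).integrableOn (integrableOn_const hG)
      (fun x => conv_le (hd0 l) hle ha h0 x)).trans (le_of_eq ?_)
    rw [setIntegral_const, smul_eq_mul]; ring
  set X := ((2 : ℝ) ^ L) ^ finrank ℝ E * volume.real G * ∫ y, a y
  set Y := (∫ x : E, majorant x) * ∫ y, a y
  have hX : 0 ≤ X := by positivity
  have hY : 0 ≤ Y := by positivity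
  calc _ ≤ ∑ l ∈ Finset.range J, ((if 0 ≤ l then ((2 : ℝ) ^ l)⁻¹ else 0) * X
        + (if L ≤ l then ((2 : ℝ) ^ l)⁻¹ else 0) * Y) := by
        refine Finset.sum_le_sum fun l _ => ?_
        rw [if_pos l.zero_le]
        split_ifs with hl
        · have := mul_le_mul_of_nonneg_left (b1 l) (by positivity : (0 : ℝ) ≤ (2 ^ l)⁻¹)
          have : 0 ≤ ((2 : ℝ) ^ l)⁻¹ * X := by positivity
          linarith
        · push Not at hl
          have := mul_le_mul_of_nonneg_left (b2 l hl.le) (by positivity : (0 : ℝ) ≤ (2 ^ l)⁻¹)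
          linarith
    _ ≤ 2 * X + 2 * ((2 : ℝ) ^ L)⁻¹ * Y := by
        rw [Finset.sum_add_distrib, ← Finset.sum_mul, ← Finset.sum_mul]
        have := sum_ite_inv_two_pow_le 0 J
        rw [pow_zero, inv_one, mul_one] at this
        exact add_le_add (mul_le_mul_of_nonneg_right this hX)
          (mul_le_mul_of_nonneg_right (sum_ite_inv_two_pow_le L J) hY)
    _ = _ := by ring

lemma SchwartzMap.abs_integral_mul_conv_sum_dilate_le (k : 𝓢(E, ℝ)) (h0 : ∫ x, k x = 0)
    {χ : E → ℝ} {C : ℝ} (hC : ∀ x y, |χ x - χ y| ≤ C * ‖x - y‖) (hχ : Continuous χ)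
    {M : ℝ} (hχM : ∀ x, |χ x| ≤ M) (J : ℕ) {v : E → ℝ} (hv : Integrable v) :
    |∫ x, χ x * ∫ y, (∑ l ∈ Finset.range J, dilate l k (x - y)) * v y|
      ≤ 2 * C * (∫ z, ‖z‖ * |k z|) * ∫ y, |v y| := by
  have hk := k.integrable (μ := volume)
  have hK : Integrable (fun x => ∑ l ∈ Finset.range J, dilate l k x) :=
    integrable_finsetSum _ fun l _ => integrable_dilate hk l
  have hC0 : 0 ≤ C * ∫ z, ‖z‖ * |k z| := by
    rw [← integral_const_mul]
    refine integral_nonneg fun z => ?_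
    have := (abs_nonneg _).trans (hC z 0)
    rw [sub_zero] at this
    change 0 ≤ C * (‖z‖ * |k z|)
    rw [← mul_assoc]
    exact mul_nonneg this (abs_nonneg _)
  have hint : Integrable (fun p : E × E => χ p.1 *
      ((∑ l ∈ Finset.range J, dilate l k (p.1 - p.2)) * v p.2)) (volume.prod volume) :=
    (integrable_conv_integrand hK hv).bdd_mul (c := M)
      (hχ.comp continuous_fst).aestronglyMeasurable (ae_of_all _ fun p => hχM _)
  have inner : ∀ y, |∫ x, χ x * ∑ l ∈ Finset.range J, dilate l k (x - y)|
      ≤ 2 * (C * ∫ z, ‖z‖ * |k z|) := by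
    intro y
    have hi : ∀ l, Integrable (fun z => dilate l k z * χ (z + y)) := fun l =>
      (integrable_dilate hk l).mul_bdd (c := M)
        (hχ.comp (continuous_id.add continuous_const)).aestronglyMeasurable
        (ae_of_all _ fun p => hχM _)
    have e : ∫ x, χ x * ∑ l ∈ Finset.range J, dilate l k (x - y)
        = ∑ l ∈ Finset.range J, ∫ z, k z * χ (((2 : ℝ) ^ l)⁻¹ • z + y) := by
      rw [← integral_add_right_eq_self _ y]
      simp only [add_sub_cancel_right, Finset.mul_sum]
      simp only [mul_comm (χ _)]
      rw [integral_finsetSum _ fun l _ => hi l]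
      exact Finset.sum_congr rfl fun l _ => integral_dilate_mul l k fun z => χ (z + y)
    have b : ∀ l, |∫ z, k z * χ (((2 : ℝ) ^ l)⁻¹ • z + y)|
        ≤ ((2 : ℝ) ^ l)⁻¹ * (C * ∫ z, ‖z‖ * |k z|) := by
      intro l
      have : ∫ z, k z * χ (((2 : ℝ) ^ l)⁻¹ • z + y)
          = ∫ z, k z * (χ (((2 : ℝ) ^ l)⁻¹ • z + y) - χ y) := by
        have hi' : Integrable (fun z => k z * χ (((2 : ℝ) ^ l)⁻¹ • z + y)) :=
          hk.mul_bdd (c := M)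
            (hχ.comp ((continuous_const_smul _).add continuous_const)).aestronglyMeasurable
            (ae_of_all _ fun p => hχM _)
        simp only [mul_sub]
        rw [integral_sub hi' (hk.mul_const _), integral_mul_const, h0, zero_mul, sub_zero]
      rw [this, ← integral_const_mul, ← integral_const_mul, ← Real.norm_eq_abs]
      refine norm_integral_le_of_norm_le ((k.integrable_norm_mul_abs.const_mul C).const_mul _)
        (ae_of_all _ fun z => ?_)
      have h := hC (((2 : ℝ) ^ l)⁻¹ • z + y) y
      rw [add_sub_cancel_right, norm_smul, norm_inv, norm_pow, Real.norm_ofNat] at h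
      rw [norm_mul, Real.norm_eq_abs, Real.norm_eq_abs]
      calc |k z| * |χ (((2 : ℝ) ^ l)⁻¹ • z + y) - χ y|
          ≤ |k z| * (C * (((2 : ℝ) ^ l)⁻¹ * ‖z‖)) := by gcongr
        _ = _ := by ring
    rw [e]
    refine (Finset.abs_sum_le_sum_abs _ _).trans ((Finset.sum_le_sum fun l _ => b l).trans ?_)
    rw [← Finset.sum_mul]
    refine mul_le_mul_of_nonneg_right ?_ hC0
    simpa using sum_ite_inv_two_pow_le 0 J
  have swap : ∫ x, χ x * ∫ y, (∑ l ∈ Finset.range J, dilate l k (x - y)) * v y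
      = ∫ y, (∫ x, χ x * ∑ l ∈ Finset.range J, dilate l k (x - y)) * v y := by
    simp only [← integral_const_mul, ← integral_mul_const]
    rw [integral_integral_swap hint]
    simp only [mul_assoc]
  rw [swap, ← Real.norm_eq_abs, mul_assoc 2, ← integral_const_mul]
  refine norm_integral_le_of_norm_le (hv.abs.const_mul _) (ae_of_all _ fun y => ?_)
  rw [norm_mul, Real.norm_eq_abs, Real.norm_eq_abs]
  exact mul_le_mul_of_nonneg_right (inner y) (abs_nonneg _)

lemma SchwartzMap.exists_abs_sub_conv_dilate_le (Φ : 𝓢(E, ℝ)) (h1 : ∫ x, Φ x = 1) {H : E → ℝ}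
    (hH : Continuous H) (hHc : HasCompactSupport H) {ε : ℝ} (hε : 0 < ε) :
    ∃ J : ℕ, ∀ x, |H x - ∫ y, dilate J Φ (x - y) * H y| ≤ ε := by
  have hΦ := Φ.integrable (μ := volume)
  set I := ∫ z, |Φ z| with hI
  set I₁ := ∫ z, ‖z‖ * |Φ z| with hI₁
  have hI0 : 0 ≤ I := integral_nonneg fun _ => abs_nonneg _
  have hI₁0 : 0 ≤ I₁ := integral_nonneg fun z => by positivity
  obtain ⟨M, hM⟩ := hHc.exists_bound_of_continuous hH
  have hM0 : 0 ≤ M := (norm_nonneg _).trans (hM 0)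
  obtain ⟨δ, hδ, hu⟩ := Metric.uniformContinuous_iff.1
    (hHc.uniformContinuous_of_continuous hH) (ε / (2 * (I + 1))) (by positivity)
  have ht : Filter.Tendsto (fun J : ℕ => 2 * M / δ * I₁ * ((2 : ℝ)⁻¹) ^ J) Filter.atTop
      (nhds (2 * M / δ * I₁ * 0)) :=
    (tendsto_pow_atTop_nhds_zero_of_lt_one (by norm_num) (by norm_num)).const_mul _
  rw [mul_zero] at ht
  obtain ⟨J, hJ⟩ := (ht.eventually_le_const (half_pos hε)).exists
  refine ⟨J, fun x => ?_⟩
  have hxi : Integrable (fun z => Φ z * H (x - ((2 : ℝ) ^ J)⁻¹ • z)) :=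
    hΦ.mul_bdd (c := M) (by fun_prop) (ae_of_all _ fun z => hM _)
  have e : H x - ∫ y, dilate J Φ (x - y) * H y
      = ∫ z, Φ z * (H x - H (x - ((2 : ℝ) ^ J)⁻¹ • z)) := by
    rw [← integral_sub_left_eq_self _ volume x]
    simp only [sub_sub_cancel, mul_sub]
    rw [integral_dilate_mul J Φ fun z => H (x - z), integral_sub (hΦ.mul_const _) hxi,
      integral_mul_const, h1, one_mul]
  rw [e, ← Real.norm_eq_abs]
  have key : ∀ z, ‖Φ z * (H x - H (x - ((2 : ℝ) ^ J)⁻¹ • z))‖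
      ≤ ε / (2 * (I + 1)) * |Φ z| + 2 * M / δ * ((2 : ℝ)⁻¹) ^ J * (‖z‖ * |Φ z|) := by
    intro z
    rw [norm_mul, Real.norm_eq_abs]
    have hn : ‖((2 : ℝ) ^ J)⁻¹ • z‖ = ((2 : ℝ)⁻¹) ^ J * ‖z‖ := by
      rw [norm_smul, norm_inv, norm_pow, Real.norm_ofNat, inv_pow]
    have hb : ‖H x - H (x - ((2 : ℝ) ^ J)⁻¹ • z)‖
        ≤ ε / (2 * (I + 1)) + 2 * M / δ * (((2 : ℝ)⁻¹) ^ J * ‖z‖) := by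
      rcases lt_or_ge ‖((2 : ℝ) ^ J)⁻¹ • z‖ δ with hlt | hge
      · have := hu (a := x) (b := x - ((2 : ℝ) ^ J)⁻¹ • z) (by
          rw [dist_eq_norm, sub_sub_cancel]; exact hlt)
        rw [dist_eq_norm] at this
        refine this.le.trans (le_add_of_nonneg_right (by positivity))
      · rw [hn] at hge
        have h2 : ‖H x - H (x - ((2 : ℝ) ^ J)⁻¹ • z)‖ ≤ 2 * M := by
          refine (norm_sub_le _ _).trans ?_
          linarith [hM x, hM (x - ((2 : ℝ) ^ J)⁻¹ • z)]
        have h3 : 2 * M ≤ 2 * M / δ * (((2 : ℝ)⁻¹) ^ J * ‖z‖) := by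
          rw [div_mul_eq_mul_div, le_div_iff₀ hδ]; gcongr
        have : 0 ≤ ε / (2 * (I + 1)) := by positivity
        linarith
    refine (mul_le_mul_of_nonneg_left hb (abs_nonneg _)).trans (le_of_eq (by ring))
  refine (norm_integral_le_of_norm_le ((hΦ.abs.const_mul _).add
    (Φ.integrable_norm_mul_abs.const_mul _)) (ae_of_all _ key)).trans ?_
  rw [integral_add' (hΦ.abs.const_mul _) (Φ.integrable_norm_mul_abs.const_mul _),
    integral_const_mul, integral_const_mul, ← hI, ← hI₁]
  have h4 : ε / (2 * (I + 1)) * I ≤ ε / 2 := by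
    rw [div_mul_eq_mul_div, div_le_div_iff₀ (by positivity) (by positivity)]
    nlinarith
  nlinarith

end Convolution

section Localization

open Module SchwartzMap LineDeriv
open scoped ContDiff

variable {d : ℕ}

local notation "𝔼" => EuclideanSpace ℝ (Fin d)

lemma iterPDeriv_concat (L : List (Fin d)) (i : Fin d) (φ : 𝔼 → ℝ) :
    iterPDeriv (L ++ [i]) φ = iterPDeriv L (pderiv' i φ) := by
  simp [iterPDeriv, List.foldr_append]

lemma ContDiff.pderiv' {φ : 𝔼 → ℝ} (h : ContDiff ℝ ∞ φ) (i : Fin d) :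
    ContDiff ℝ ∞ (pderiv' i φ) :=
  (h.fderiv_right (m := ∞) (by simp)).clm_apply contDiff_const

lemma ContDiff.iterPDeriv {φ : 𝔼 → ℝ} (h : ContDiff ℝ ∞ φ) (L : List (Fin d)) :
    ContDiff ℝ ∞ (iterPDeriv L φ) := by
  induction L with
  | nil => exact h
  | cons i L ih => exact ih.pderiv' i

lemma tsupport_iterPDeriv_subset (L : List (Fin d)) (φ : 𝔼 → ℝ) :
    tsupport (iterPDeriv L φ) ⊆ tsupport φ := by
  induction L with
  | nil => exact subset_rfl
  | cons i L ih =>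
    refine subset_trans (closure_mono fun x hx => ?_) ((tsupport_fderiv_subset ℝ).trans ih)
    intro h0
    exact hx (by change fderiv ℝ (iterPDeriv L φ) x _ = 0; rw [h0]; rfl)

lemma pderiv'_mul {φ ψ : 𝔼 → ℝ} (hφ : ContDiff ℝ ∞ φ) (hψ : ContDiff ℝ ∞ ψ) (i : Fin d) :
    pderiv' i (fun y => φ y * ψ y) = fun y => pderiv' i φ y * ψ y + φ y * pderiv' i ψ y := by
  ext y
  simp only [pderiv']
  rw [fderiv_fun_mul (hφ.differentiable (by simp) y) (hψ.differentiable (by simp) y)]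
  simp; ring

lemma iterPDeriv_add {φ ψ : 𝔼 → ℝ} (hφ : ContDiff ℝ ∞ φ) (hψ : ContDiff ℝ ∞ ψ)
    (L : List (Fin d)) :
    iterPDeriv L (fun y => φ y + ψ y) = fun y => iterPDeriv L φ y + iterPDeriv L ψ y := by
  induction L with
  | nil => rfl
  | cons i L ih =>
    change pderiv' i (iterPDeriv L _) = _
    rw [ih]
    ext y
    change fderiv ℝ _ y _ = fderiv ℝ (iterPDeriv L φ) y _ + fderiv ℝ (iterPDeriv L ψ) y _
    rw [fderiv_fun_add ((hφ.iterPDeriv L).differentiable (by simp) y)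
      ((hψ.iterPDeriv L).differentiable (by simp) y)]
    simp

lemma iterPDeriv_const_mul {φ : 𝔼 → ℝ} (hφ : ContDiff ℝ ∞ φ) (c : ℝ) (L : List (Fin d)) :
    iterPDeriv L (fun y => c * φ y) = fun y => c * iterPDeriv L φ y := by
  induction L with
  | nil => rfl
  | cons i L ih =>
    change pderiv' i (iterPDeriv L _) = _
    rw [ih]
    ext y
    change fderiv ℝ _ y _ = c * fderiv ℝ (iterPDeriv L φ) y _
    rw [fderiv_const_mul ((hφ.iterPDeriv L).differentiable (by simp) y)]
    simp

lemma contDiff_dilate_sub (l : ℕ) (Q : 𝓢(𝔼, ℝ)) (x : 𝔼) :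
    ContDiff ℝ ∞ (fun y => dilate l Q (x - y)) :=
  ((dilated l Q).smooth ⊤).comp (contDiff_const.sub contDiff_id)

lemma pderiv'_dilate_sub (l : ℕ) (Q : 𝓢(𝔼, ℝ)) (x : 𝔼) (i : Fin d) :
    pderiv' i (fun y => dilate l Q (x - y))
      = fun y => -(2 : ℝ) ^ l * dilate l (∂_{EuclideanSpace.single i (1 : ℝ)} Q : 𝓢(𝔼, ℝ))
        (x - y) := by
  ext y
  have h1 : HasFDerivAt (fun y : 𝔼 => (2 : ℝ) ^ l • (x - y))
      ((2 : ℝ) ^ l • (-ContinuousLinearMap.id ℝ 𝔼)) y := by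
    exact ((hasFDerivAt_id (𝕜 := ℝ) y).const_sub x).const_smul ((2 : ℝ) ^ l)
  have h2 := ((Q.differentiableAt (x := (2 : ℝ) ^ l • (x - y))).hasFDerivAt.comp y h1).const_mul
    (((2 : ℝ) ^ l) ^ finrank ℝ 𝔼)
  simp only [pderiv', dilate]
  erw [h2.fderiv]
  simp [lineDerivOp_apply_eq_fderiv]
  ring

lemma exists_abs_iterPDeriv_mul_dilate_sub_le (L : List (Fin d)) :
    ∀ (χ : 𝔼 → ℝ), ContDiff ℝ ∞ χ → HasCompactSupport χ → ∀ Q : 𝓢(𝔼, ℝ),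
    ∃ C : ℝ, 0 ≤ C ∧ ∀ (l : ℕ) (x y : 𝔼),
      (2 : ℝ) ^ l * |iterPDeriv L (fun y => χ y * dilate l Q (x - y)) y
        - (-(2 : ℝ) ^ l) ^ L.length * (χ y * dilate l (iterPDeriv L Q) (x - y))|
      ≤ C * ((2 : ℝ) ^ l) ^ L.length * dilate l majorant (x - y) := by
  induction L using List.reverseRecOn with
  | nil =>
    intro χ _ _ Q
    refine ⟨0, le_rfl, fun l x y => le_of_eq ?_⟩
    simp [iterPDeriv]
  | append_singleton L i ih =>
    intro χ hχ hχc Q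
    have hχ' := hχ.pderiv' i
    have hχc' : HasCompactSupport (pderiv' i χ) :=
      hχc.of_isClosed_subset (isClosed_tsupport _) (tsupport_iterPDeriv_subset [i] χ)
    obtain ⟨C₁, hC₁, h₁⟩ := ih (pderiv' i χ) hχ' hχc' Q
    obtain ⟨C₂, hC₂, h₂⟩ := ih χ hχ hχc (∂_{EuclideanSpace.single i (1 : ℝ)} Q)
    obtain ⟨C₃, hC₃, h₃⟩ := (iterLineDeriv L Q).exists_norm_le_majorant
    obtain ⟨M, hM⟩ := hχc'.exists_bound_of_continuous hχ'.continuous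
    have hM0 : 0 ≤ M := (norm_nonneg _).trans (hM 0)
    refine ⟨C₁ + M * C₃ + C₂, by positivity, fun l x y => ?_⟩
    have hq := contDiff_dilate_sub l Q x
    have hq' := contDiff_dilate_sub l (∂_{EuclideanSpace.single i (1 : ℝ)} Q) x
    have hsplit : iterPDeriv (L ++ [i]) (fun y => χ y * dilate l Q (x - y)) y
        = iterPDeriv L (fun y => pderiv' i χ y * dilate l Q (x - y)) y
          + -(2 : ℝ) ^ l * iterPDeriv L (fun y => χ y *
            dilate l (∂_{EuclideanSpace.single i (1 : ℝ)} Q : 𝓢(𝔼, ℝ)) (x - y)) y := by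
      rw [iterPDeriv_concat, pderiv'_mul hχ hq, pderiv'_dilate_sub]
      simp only [mul_left_comm (χ _)]
      rw [iterPDeriv_add (hχ'.mul hq) (contDiff_const.mul (hχ.mul hq')),
        iterPDeriv_const_mul (hχ.mul hq')]
    have hQ : iterPDeriv (L ++ [i]) Q
        = iterPDeriv L (∂_{EuclideanSpace.single i (1 : ℝ)} Q : 𝓢(𝔼, ℝ)) := by
      rw [iterPDeriv_concat]; rfl
    have a₁ := h₁ l x y
    have a₂ := h₂ l x y
    have a₃ : |pderiv' i χ y * dilate l (iterPDeriv L Q) (x - y)|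
        ≤ M * C₃ * dilate l majorant (x - y) := by
      rw [abs_mul, abs_dilate, iterPDeriv_schwartz, mul_assoc]
      refine mul_le_mul (hM y) ?_ ?_ hM0
      · refine (dilate_mono h₃ l _).trans (le_of_eq ?_)
        simp only [dilate]; ring
      · simp only [dilate]; positivity
    rw [hsplit, hQ, List.length_append, List.length_singleton, pow_succ, pow_succ]
    set t : ℝ := 2 ^ l with ht
    have ht0 : 0 < t := by positivity
    set a := iterPDeriv L (fun y => pderiv' i χ y * dilate l Q (x - y)) y
    set b := iterPDeriv L (fun y => χ y *
            dilate l (∂_{EuclideanSpace.single i (1 : ℝ)} Q : 𝓢(𝔼, ℝ)) (x - y)) y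
    set a' := pderiv' i χ y * dilate l (iterPDeriv L Q) (x - y)
    set b' := χ y * dilate l (iterPDeriv L (∂_{EuclideanSpace.single i (1 : ℝ)} Q : 𝓢(𝔼, ℝ)))
      (x - y)
    set W := dilate l majorant (x - y)
    have hW : 0 ≤ W := mul_nonneg (by positivity) (majorant_pos _).le
    have h1t : (1 : ℝ) ≤ t := one_le_pow₀ one_le_two
    have e : a + -t * b - (-t) ^ L.length * -t * b'
        = (a - (-t) ^ L.length * a') + (-t) ^ L.length * a'
          + -t * (b - (-t) ^ L.length * b') := by ring
    rw [e]
    have hn : |(-t) ^ L.length| = t ^ L.length := by rw [abs_pow, abs_neg, abs_of_pos ht0]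
    have htri : |(a - (-t) ^ L.length * a') + (-t) ^ L.length * a'
          + -t * (b - (-t) ^ L.length * b')|
        ≤ |a - (-t) ^ L.length * a'| + t ^ L.length * |a'| + t * |b - (-t) ^ L.length * b'| := by
      refine (abs_add_le _ _).trans (add_le_add ((abs_add_le _ _).trans (le_of_eq ?_))
        (le_of_eq ?_))
      · rw [abs_mul _ a', hn]
      · rw [abs_mul, abs_neg, abs_of_pos ht0]
    have hp : 0 ≤ t ^ L.length := by positivity
    have b₁ : t * |a - (-t) ^ L.length * a'| ≤ C₁ * t ^ L.length * W * t :=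
      a₁.trans (le_mul_of_one_le_right (by positivity) h1t)
    have b₂ := mul_le_mul_of_nonneg_left a₂ ht0.le
    have b₃ := mul_le_mul_of_nonneg_left a₃ (mul_nonneg ht0.le hp)
    nlinarith [mul_le_mul_of_nonneg_left htri ht0.le]

lemma multiIdxEq_eq_filter (k : ℕ) :
    multiIdxEq d k = (multiIdxLe d k).filter fun α => ∑ i, α i = k := by
  ext α
  simp only [multiIdxEq, multiIdxLe, Finset.mem_filter]
  exact ⟨fun h => ⟨⟨h.1, h.2.le⟩, h.2⟩, fun h => ⟨h.1.1, h.2⟩⟩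

/-- Applying the operator to `χ · Q_{l,x}` and rescaling gives its principal part up to a lower
order error. -/
lemma exists_abs_pderivMulti_mul_dilate_sub_le {k : ℕ} {χ : 𝔼 → ℝ}
    (hχ : ContDiff ℝ ∞ χ) (hχc : HasCompactSupport χ) (Q : 𝓢(𝔼, ℝ)) (α : Fin d → ℕ)
    (hα : ∑ i, α i ≤ k) :
    ∃ C : ℝ, 0 ≤ C ∧ ∀ (l : ℕ) (x y : 𝔼),
      |(((2 : ℝ) ^ l) ^ k)⁻¹ * ((-1) ^ (∑ i, α i) *
          pderivMulti α (fun y => χ y * dilate l Q (x - y)) y)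
        - (if ∑ i, α i = k then χ y * dilate l (pderivMulti α Q) (x - y) else 0)|
      ≤ C * ((2 : ℝ) ^ l)⁻¹ * dilate l majorant (x - y) := by
  obtain ⟨C, hC, h⟩ := exists_abs_iterPDeriv_mul_dilate_sub_le (multiList α) χ hχ hχc Q
  obtain ⟨C₃, hC₃, h₃⟩ := (iterLineDeriv (multiList α) Q).exists_norm_le_majorant
  obtain ⟨M, hM⟩ := hχc.exists_bound_of_continuous hχ.continuous
  have hM0 : 0 ≤ M := (norm_nonneg _).trans (hM 0)
  refine ⟨C + M * C₃, by positivity, fun l x y => ?_⟩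
  have h := h l x y
  rw [length_multiList] at h
  rw [pderivMulti_eq_iterPDeriv, pderivMulti_eq_iterPDeriv]
  have a₃ : |χ y * dilate l (iterPDeriv (multiList α) Q) (x - y)|
      ≤ M * C₃ * dilate l majorant (x - y) := by
    rw [abs_mul, abs_dilate, iterPDeriv_schwartz, mul_assoc]
    refine mul_le_mul (hM y) ?_ ?_ hM0
    · refine (dilate_mono h₃ l _).trans (le_of_eq ?_)
      simp only [dilate]; ring
    · simp only [dilate]; positivity
  set t : ℝ := 2 ^ l with ht
  have ht0 : 0 < t := by positivity
  have h1t : (1 : ℝ) ≤ t := one_le_pow₀ one_le_two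
  set D := iterPDeriv (multiList α) (fun y => χ y * dilate l Q (x - y)) y
  set b := χ y * dilate l (iterPDeriv (multiList α) Q) (x - y)
  set W := dilate l majorant (x - y)
  have hW : 0 ≤ W := mul_nonneg (by positivity) (majorant_pos _).le
  set a := ∑ i, α i
  have hs : |(-1 : ℝ) ^ a| = 1 := by simp
  have hsq : (-1 : ℝ) ^ k * (-1) ^ k = 1 := by rw [← mul_pow]; simp
  split_ifs with hk
  · have e : (t ^ k)⁻¹ * ((-1) ^ a * D) - b = (t ^ k)⁻¹ * ((-1) ^ a * (D - (-t) ^ a * b)) := by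
      rw [neg_pow t, hk]
      have : (-1 : ℝ) ^ k * (D - (-1) ^ k * t ^ k * b)
          = (-1) ^ k * D - ((-1) ^ k * (-1) ^ k) * (t ^ k * b) := by ring
      rw [this, hsq]
      field_simp
    rw [e, abs_mul, abs_mul, hs, one_mul, abs_of_pos (by positivity)]
    rw [hk] at h ⊢
    have h' : |D - (-t) ^ k * b| ≤ t⁻¹ * (C * t ^ k * W) := by
      rw [← div_eq_inv_mul, le_div_iff₀ ht0, mul_comm]; exact h
    refine (mul_le_mul_of_nonneg_left h' (by positivity)).trans ?_
    have : (t ^ k)⁻¹ * (t⁻¹ * (C * t ^ k * W)) = C * t⁻¹ * W := by field_simp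
    rw [this]
    have : 0 ≤ M * C₃ * (t⁻¹ * W) := by positivity
    nlinarith
  · have hlt : a + 1 ≤ k := lt_of_le_of_ne hα hk
    rw [sub_zero, abs_mul, abs_mul, hs, one_mul, abs_of_pos (by positivity)]
    have hD : |D| ≤ (C + M * C₃) * t ^ a * W := by
      have h1 : |D| ≤ |D - (-t) ^ a * b| + |(-t) ^ a * b| := by
        have := abs_add_le (D - (-t) ^ a * b) ((-t) ^ a * b)
        rwa [sub_add_cancel] at this
      have h2 : |D - (-t) ^ a * b| ≤ t * |D - (-t) ^ a * b| :=
        le_mul_of_one_le_left (abs_nonneg _) h1t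
      have h3 : |(-t) ^ a * b| ≤ t ^ a * (M * C₃ * W) := by
        rw [abs_mul, abs_pow, abs_neg, abs_of_pos ht0]
        exact mul_le_mul_of_nonneg_left a₃ (by positivity)
      nlinarith
    refine (mul_le_mul_of_nonneg_left hD (by positivity)).trans ?_
    have h4 : (t ^ k)⁻¹ * t ^ a ≤ t⁻¹ := by
      rw [← div_eq_inv_mul, div_le_iff₀ (by positivity), ← div_eq_inv_mul, le_div_iff₀ ht0,
        ← pow_succ]
      exact pow_le_pow_right₀ h1t hlt
    calc (t ^ k)⁻¹ * ((C + M * C₃) * t ^ a * W)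
        = (C + M * C₃) * ((t ^ k)⁻¹ * t ^ a) * W := by ring
      _ ≤ _ := by gcongr

/-- The convolution of the localized field with the rescaled principal part is a lower order
error. -/
lemma exists_abs_sum_conv_le {m n k : ℕ} (hk : 1 ≤ k)
    (A : (Fin d → ℕ) → Matrix (Fin n) (Fin m) ℝ) (Q : 𝓢(𝔼, ℝ)) {χ : 𝔼 → ℝ}
    (hχ : ContDiff ℝ ∞ χ) (hχc : HasCompactSupport χ) {B : Set 𝔼} (hB : IsCompact B)
    (hχB : tsupport χ ⊆ B) (i : Fin n) :
    ∃ C : ℝ, 0 ≤ C ∧ ∀ (R : ℝ) (N s : 𝔼 → ℝ) (F : Fin m → 𝔼 → ℝ), 0 ≤ R → R ≤ 1 →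
      Continuous N → Continuous s → (∀ j, Continuous (F j)) → (∀ j y, |F j y| ≤ N y) →
      (∀ y, 0 ≤ N y) →
      (∀ ψ : 𝔼 → ℝ, ContDiff ℝ ∞ ψ → HasCompactSupport ψ → tsupport ψ ⊆ B →
        ∑ α ∈ multiIdxLe d k, R ^ (k - ∑ l, α l) * ((-1) ^ (∑ l, α l) *
          ∑ j, A α i j * ∫ y, pderivMulti α ψ y * F j y) = ∫ y, ψ y * s y) →
      ∀ (l : ℕ) (x : 𝔼), |∑ α ∈ multiIdxEq d k, ∑ j, A α i j *
          ∫ y, χ y * dilate l (pderivMulti α Q) (x - y) * F j y|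
        ≤ C * (((2 : ℝ) ^ l)⁻¹ * ∫ y, dilate l majorant (x - y) *
          B.indicator (fun y => N y + |s y|) y) := by
  have hex : ∀ α : Fin d → ℕ, ∃ C : ℝ, 0 ≤ C ∧ (∑ i, α i ≤ k → ∀ (l : ℕ) (x y : 𝔼),
      |(((2 : ℝ) ^ l) ^ k)⁻¹ * ((-1) ^ (∑ i, α i) *
          pderivMulti α (fun y => χ y * dilate l Q (x - y)) y)
        - (if ∑ i, α i = k then χ y * dilate l (pderivMulti α Q) (x - y) else 0)|
      ≤ C * ((2 : ℝ) ^ l)⁻¹ * dilate l majorant (x - y)) := fun α => by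
    by_cases hα : ∑ i, α i ≤ k
    · obtain ⟨C, hC, h⟩ := exists_abs_pderivMulti_mul_dilate_sub_le hχ hχc Q α hα
      exact ⟨C, hC, fun _ => h⟩
    · exact ⟨0, le_rfl, fun h => absurd h hα⟩
  choose Cα hCα hG using hex
  obtain ⟨C₃, hC₃, h₃⟩ := Q.exists_norm_le_majorant
  obtain ⟨M, hM⟩ := hχc.exists_bound_of_continuous hχ.continuous
  have hM0 : 0 ≤ M := (norm_nonneg _).trans (hM 0)
  refine ⟨(∑ α ∈ multiIdxLe d k, ∑ j, |A α i j| * Cα α) + M * C₃, ?_, ?_⟩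
  · exact add_nonneg (Finset.sum_nonneg fun α _ => Finset.sum_nonneg fun j _ =>
      mul_nonneg (abs_nonneg _) (hCα α)) (by positivity)
  intro R N s F hR0 hR1 hN hs hF hFN hN0 heq l x
  set t : ℝ := 2 ^ l with ht
  have ht0 : 0 < t := by positivity
  have h1t : (1 : ℝ) ≤ t := one_le_pow₀ one_le_two
  set W : 𝔼 → ℝ := fun y => dilate l majorant (x - y) with hW
  have hW0 : ∀ y, 0 ≤ W y := fun y => mul_nonneg (by positivity) (majorant_pos _).le
  have hWc : Continuous W := (continuous_dilate continuous_majorant l).comp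
    (continuous_const.sub continuous_id)
  set a : 𝔼 → ℝ := B.indicator (fun y => N y + |s y|) with ha
  have haB : ∀ y ∈ B, a y = N y + |s y| := fun y hy => Set.indicator_of_mem hy _
  have ha0 : ∀ y, 0 ≤ a y := fun y =>
    Set.indicator_nonneg (fun y _ => add_nonneg (hN0 y) (abs_nonneg _)) y
  have hWa : Integrable (fun y => W y * a y) := by
    have : IntegrableOn (fun y => W y * (N y + |s y|)) B :=
      (hWc.mul (hN.add hs.abs)).continuousOn.integrableOn_compact hB
    rw [← integrable_indicator_iff hB.measurableSet] at this
    refine this.congr (ae_of_all _ fun y => ?_)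
    by_cases hy : y ∈ B <;> simp [ha, hy]
  set I := ∫ y, W y * a y with hI
  have hI0 : 0 ≤ I := integral_nonneg fun y => mul_nonneg (hW0 y) (ha0 y)
  set ψ : 𝔼 → ℝ := fun y => χ y * dilate l Q (x - y) with hψ
  have hψs : ContDiff ℝ ∞ ψ := hχ.mul (contDiff_dilate_sub l Q x)
  have hψc : HasCompactSupport ψ := hχc.mul_right
  have hψχ : tsupport ψ ⊆ tsupport χ := tsupport_mul_subset_left
  have hψB : tsupport ψ ⊆ B := hψχ.trans hχB
  have hDs : ∀ α : Fin d → ℕ, ContDiff ℝ ∞ (pderivMulti α ψ) := fun α => by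
    rw [pderivMulti_eq_iterPDeriv]; exact hψs.iterPDeriv _
  have hDt : ∀ α : Fin d → ℕ, tsupport (pderivMulti α ψ) ⊆ tsupport ψ := fun α => by
    rw [pderivMulti_eq_iterPDeriv]; exact tsupport_iterPDeriv_subset _ _
  have hDc : ∀ α : Fin d → ℕ, HasCompactSupport (pderivMulti α ψ) := fun α =>
    hψc.of_isClosed_subset (isClosed_tsupport _) (hDt α)
  set P : (Fin d → ℕ) → 𝔼 → ℝ := fun α y => (t ^ k)⁻¹ * ((-1) ^ (∑ i, α i) * pderivMulti α ψ y)
    with hP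
  set Z : (Fin d → ℕ) → 𝔼 → ℝ := fun α y =>
    if ∑ i, α i = k then χ y * dilate l (pderivMulti α Q) (x - y) else 0 with hZ
  have hPi : ∀ α j, Integrable (fun y => P α y * F j y) := fun α j => by
    refine Continuous.integrable_of_hasCompactSupport
      ((continuous_const.mul (continuous_const.mul (hDs α).continuous)).mul (hF j)) ?_
    exact ((hDc α).mul_left.mul_left).mul_right
  have hZi : ∀ α j, Integrable (fun y => Z α y * F j y) := fun α j => by
    by_cases hα : ∑ i, α i = k
    · simp only [hZ, if_pos hα, pderivMulti_eq_iterPDeriv, iterPDeriv_schwartz]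
      refine Continuous.integrable_of_hasCompactSupport ((hχ.continuous.mul
        (contDiff_dilate_sub l _ x).continuous).mul (hF j)) (hχc.mul_right.mul_right)
    · simp only [hZ, if_neg hα, zero_mul]; exact integrable_zero _ _ _
  have hGi : ∀ α ∈ multiIdxLe d k, ∀ j,
      |(∫ y, P α y * F j y) - ∫ y, Z α y * F j y| ≤ Cα α * t⁻¹ * I := by
    intro α hα j
    have hα' : ∑ i, α i ≤ k := (Finset.mem_filter.1 hα).2
    rw [← integral_sub (hPi α j) (hZi α j), hI, ← integral_const_mul, ← Real.norm_eq_abs]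
    refine norm_integral_le_of_norm_le (hWa.const_mul _) (ae_of_all _ fun y => ?_)
    rw [← sub_mul, norm_mul, Real.norm_eq_abs, Real.norm_eq_abs]
    by_cases hy : y ∈ B
    · rw [haB y hy]
      calc |P α y - Z α y| * |F j y| ≤ (Cα α * t⁻¹ * W y) * (N y + |s y|) := by
            refine mul_le_mul (hG α hα' l x y) ?_ (abs_nonneg _) ?_
            · linarith [hFN j y, abs_nonneg (s y)]
            · have := hW0 y; have := hCα α; positivity
        _ = _ := by ring
    · have h1 : pderivMulti α ψ y = 0 :=
        image_eq_zero_of_notMem_tsupport fun h => hy (hψB (hDt α h))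
      have h2 : χ y = 0 := image_eq_zero_of_notMem_tsupport fun h => hy (hχB h)
      have h3 : P α y - Z α y = 0 := by simp [hP, hZ, h1, h2]
      rw [h3, abs_zero, zero_mul]
      have := hW0 y; have := hCα α; have := ha0 y
      positivity
  have hψi : |(t ^ k)⁻¹ * ∫ y, ψ y * s y| ≤ M * C₃ * t⁻¹ * I := by
    rw [abs_mul, abs_of_pos (by positivity)]
    have h1 : |∫ y, ψ y * s y| ≤ M * C₃ * I := by
      rw [hI, ← integral_const_mul, ← Real.norm_eq_abs]
      refine norm_integral_le_of_norm_le (hWa.const_mul _) (ae_of_all _ fun y => ?_)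
      rw [norm_mul, Real.norm_eq_abs, Real.norm_eq_abs]
      by_cases hy : y ∈ B
      · rw [haB y hy]
        have h4 : |dilate l Q (x - y)| ≤ C₃ * W y := by
          rw [abs_dilate]
          refine (dilate_mono h₃ l _).trans (le_of_eq ?_)
          simp only [hW, dilate]; ring
        calc |ψ y| * |s y| ≤ (M * (C₃ * W y)) * (N y + |s y|) := by
              rw [hψ, abs_mul]
              refine mul_le_mul (mul_le_mul (hM y) h4 (abs_nonneg _) hM0) ?_ (abs_nonneg _) ?_
              · linarith [hN0 y]
              · have := hW0 y; positivity
          _ = _ := by ring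
      · have h2 : χ y = 0 := image_eq_zero_of_notMem_tsupport fun h => hy (hχB h)
        simp only [hψ, h2, zero_mul, abs_zero]
        have := hW0 y; have := ha0 y
        positivity
    have h2 : (t ^ k)⁻¹ ≤ t⁻¹ := by
      gcongr
      exact le_self_pow₀ h1t (by lia)
    calc (t ^ k)⁻¹ * |∫ y, ψ y * s y| ≤ t⁻¹ * (M * C₃ * I) := by gcongr
      _ = _ := by ring
  have hpair : ∑ α ∈ multiIdxLe d k, R ^ (k - ∑ l, α l) * ∑ j, A α i j * ∫ y, P α y * F j y
      = (t ^ k)⁻¹ * ∫ y, ψ y * s y := by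
    rw [← heq ψ hψs hψc hψB, Finset.mul_sum]
    refine Finset.sum_congr rfl fun α _ => ?_
    simp only [hP, mul_assoc, integral_const_mul, Finset.mul_sum]
    refine Finset.sum_congr rfl fun j _ => ?_
    ring
  have hmain : ∑ α ∈ multiIdxEq d k, ∑ j, A α i j *
        ∫ y, χ y * dilate l (pderivMulti α Q) (x - y) * F j y
      = ∑ α ∈ multiIdxLe d k, R ^ (k - ∑ l, α l) * ∑ j, A α i j * ∫ y, Z α y * F j y := by
    rw [multiIdxEq_eq_filter, Finset.sum_filter]
    refine Finset.sum_congr rfl fun α _ => ?_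
    by_cases hα : ∑ i, α i = k
    · simp only [hZ, if_pos hα]; rw [hα]; simp
    · simp only [hZ, if_neg hα]; simp
  have hfin : ∑ α ∈ multiIdxEq d k, ∑ j, A α i j *
        ∫ y, χ y * dilate l (pderivMulti α Q) (x - y) * F j y
      = (t ^ k)⁻¹ * (∫ y, ψ y * s y) - ∑ α ∈ multiIdxLe d k, R ^ (k - ∑ l, α l) *
        ∑ j, A α i j * ((∫ y, P α y * F j y) - ∫ y, Z α y * F j y) := by
    rw [hmain, ← hpair]
    simp only [mul_sub, Finset.sum_sub_distrib]
    ring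
  rw [hfin]
  have hsum : |∑ α ∈ multiIdxLe d k, R ^ (k - ∑ l, α l) *
        ∑ j, A α i j * ((∫ y, P α y * F j y) - ∫ y, Z α y * F j y)|
      ≤ (∑ α ∈ multiIdxLe d k, ∑ j, |A α i j| * Cα α) * (t⁻¹ * I) := by
    rw [Finset.sum_mul]
    refine (Finset.abs_sum_le_sum_abs _ _).trans (Finset.sum_le_sum fun α hα => ?_)
    rw [abs_mul, abs_of_nonneg (pow_nonneg hR0 _), Finset.sum_mul]
    refine (mul_le_of_le_one_left (abs_nonneg _) (pow_le_one₀ hR0 hR1)).trans ?_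
    refine (Finset.abs_sum_le_sum_abs _ _).trans (Finset.sum_le_sum fun j _ => ?_)
    rw [abs_mul, mul_assoc]
    refine mul_le_mul_of_nonneg_left ((hGi α hα j).trans (le_of_eq (by ring))) (abs_nonneg _)
  refine (abs_sub _ _).trans ?_
  rw [add_mul]
  linarith

end Localization

section SingularIntegral

open Module SchwartzMap

variable {E : Type*} [NormedAddCommGroup E] [InnerProductSpace ℝ E] [FiniteDimensional ℝ E]
  [MeasurableSpace E] [BorelSpace E]

lemma SchwartzMap.exists_bounds_sum_conv [Nontrivial E] {ι : Type*} (S : Finset ι)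
    (K : ι → 𝓢(E, ℝ)) (hK : ∀ i ∈ S, ∫ x, K i x = 0) (c : ι → ℝ) {χ : E → ℝ} {B : ℝ}
    (hB : ∀ x y, |χ x - χ y| ≤ B * ‖x - y‖) (hχ : Continuous χ) {M : ℝ}
    (hχM : ∀ x, |χ x| ≤ M) :
    ∃ C : ℝ, 0 ≤ C ∧ ∀ (J : ℕ) (v : ι → E → ℝ) (δ : ℝ), (∀ i, Continuous (v i)) →
      (∀ i, HasCompactSupport (v i)) → (∀ i, ∫ y, |v i y| ≤ δ) → 0 ≤ δ →
      Integrable (fun x => ∑ i ∈ S, c i *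
        ∫ y, (∑ l ∈ Finset.range J, dilate l (K i) (x - y)) * v i y) ∧
      |∫ x, χ x * ∑ i ∈ S, c i *
        ∫ y, (∑ l ∈ Finset.range J, dilate l (K i) (x - y)) * v i y| ≤ C * δ ∧
      ∀ r : ℝ, 0 < r → volume {x | r < |∑ i ∈ S, c i *
        ∫ y, (∑ l ∈ Finset.range J, dilate l (K i) (x - y)) * v i y|}
        ≤ ENNReal.ofReal (C * δ / r) := by
  have hW : ∀ i, ∃ C : ℝ, 0 ≤ C ∧ (i ∈ S → ∀ (J : ℕ) (v : E → ℝ) (r : ℝ), Continuous v →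
      HasCompactSupport v → 0 < r →
      volume {x | r < |∫ y, (∑ l ∈ Finset.range J, dilate l (K i) (x - y)) * v y|}
        ≤ ENNReal.ofReal (C * (∫ y, |v y|) / r)) := fun i => by
    by_cases hi : i ∈ S
    · obtain ⟨C, hC, h⟩ := (K i).exists_weak_type (hK i hi)
      exact ⟨C, hC, fun _ => h⟩
    · exact ⟨0, le_rfl, fun h => absurd h hi⟩
  choose W hW0 hW using hW
  set a := ∑ i ∈ S, |c i| with ha
  have ha0 : 0 ≤ a := Finset.sum_nonneg fun i _ => abs_nonneg _
  set Z : ι → ℝ := fun i => 2 * B * (∫ z, ‖z‖ * |K i z|) with hZ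
  have hW1 : 0 ≤ ∑ i ∈ S, W i := Finset.sum_nonneg fun i _ => hW0 i
  have hZ1 : 0 ≤ ∑ i ∈ S, |c i| * |Z i| := Finset.sum_nonneg fun i _ => by positivity
  refine ⟨(∑ i ∈ S, |c i| * |Z i|) + (∑ i ∈ S, W i) * (a + 1), by positivity, ?_⟩
  intro J v δ hv hvc hvδ hδ
  have hvi : ∀ i, Integrable (v i) := fun i => (hv i).integrable_of_hasCompactSupport (hvc i)
  have hKi : ∀ i, Integrable (fun x => ∑ l ∈ Finset.range J, dilate l (K i) x) := fun i =>
    integrable_finsetSum _ fun l _ => integrable_dilate (K i).integrable l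
  set U : ι → E → ℝ := fun i x => ∫ y, (∑ l ∈ Finset.range J, dilate l (K i) (x - y)) * v i y
    with hU
  have hUi : ∀ i, Integrable (U i) := fun i => integrable_conv (hKi i) (hvi i)
  refine ⟨integrable_finsetSum _ fun i _ => (hUi i).const_mul _, ?_, fun r hr => ?_⟩
  · have e : ∫ x, χ x * ∑ i ∈ S, c i * U i x = ∑ i ∈ S, c i * ∫ x, χ x * U i x := by
      simp only [Finset.mul_sum, ← integral_const_mul]
      rw [integral_finsetSum]
      · exact Finset.sum_congr rfl fun i _ => by congr 1; ext x; ring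
      · exact fun i _ => ((hUi i).const_mul _).bdd_mul hχ.aestronglyMeasurable (ae_of_all _ hχM)
    change |∫ x, χ x * ∑ i ∈ S, c i * U i x| ≤ _
    rw [e]
    have h1 : |∑ i ∈ S, c i * ∫ x, χ x * U i x| ≤ (∑ i ∈ S, |c i| * |Z i|) * δ := by
      rw [Finset.sum_mul]
      refine (Finset.abs_sum_le_sum_abs _ _).trans (Finset.sum_le_sum fun i hi => ?_)
      rw [abs_mul, mul_assoc]
      refine mul_le_mul_of_nonneg_left (((K i).abs_integral_mul_conv_sum_dilate_le (hK i hi) hB hχ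
        hχM J (hvi i)).trans ?_) (abs_nonneg _)
      exact mul_le_mul (le_abs_self _) (hvδ i) (integral_nonneg fun _ => abs_nonneg _)
        (abs_nonneg _)
    have h2 : 0 ≤ (∑ i ∈ S, W i) * (a + 1) * δ := by positivity
    linarith
  · have hsub : {x | r < |∑ i ∈ S, c i * U i x|} ⊆ ⋃ i ∈ S, {x | r / (a + 1) < |U i x|} := by
      intro x hx
      by_contra hcon
      simp only [Set.mem_iUnion, not_exists, Set.mem_ofPred_eq, not_lt] at hcon hx
      have : |∑ i ∈ S, c i * U i x| ≤ a * (r / (a + 1)) := by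
        rw [ha, Finset.sum_mul]
        refine (Finset.abs_sum_le_sum_abs _ _).trans (Finset.sum_le_sum fun i hi => ?_)
        rw [abs_mul]
        exact mul_le_mul_of_nonneg_left (hcon i hi) (abs_nonneg _)
      have h2 : a * (r / (a + 1)) ≤ r := by
        rw [mul_div_assoc', div_le_iff₀ (by positivity)]; nlinarith
      linarith
    refine (measure_mono hsub).trans ((measure_biUnion_finset_le _ _).trans ?_)
    have h1 : ∀ i ∈ S, volume {x | r / (a + 1) < |U i x|}
        ≤ ENNReal.ofReal (W i * δ / (r / (a + 1))) := fun i hi =>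
      (hW i hi J (v i) _ (hv i) (hvc i) (by positivity)).trans (ENNReal.ofReal_le_ofReal
        (div_le_div_of_nonneg_right (mul_le_mul_of_nonneg_left (hvδ i) (hW0 i)) (by positivity)))
    refine (Finset.sum_le_sum h1).trans ?_
    rw [← ENNReal.ofReal_sum_of_nonneg fun i _ => by have := hW0 i; positivity]
    refine ENNReal.ofReal_le_ofReal ?_
    have h3 : ∑ i ∈ S, W i * δ / (r / (a + 1)) = (∑ i ∈ S, W i) * (a + 1) * δ / r := by
      rw [← Finset.sum_div, ← Finset.sum_mul]
      field_simp
    rw [h3]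
    refine div_le_div_of_nonneg_right ?_ hr.le
    exact mul_le_mul_of_nonneg_right (le_add_of_nonneg_left hZ1) hδ

/-- If `H = u + w` with `H ≥ 0`, the mass of `H` on a set is controlled by the mean of `u`, the
distribution function of `u`, and `w` on small sets. -/
lemma setIntegral_le_of_decomposition {H u w χ N : E → ℝ} (hHuw : ∀ x, H x = u x + w x)
    (hH : ∀ x, 0 ≤ H x) (hu : Integrable u) (hw : Integrable w) (hχ : Continuous χ)
    (hχ0 : ∀ x, 0 ≤ χ x) (hχ1 : ∀ x, χ x ≤ 1) {B : Set E} (hBm : MeasurableSet B)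
    (hB : volume B ≠ ⊤) (hχB : ∀ x, x ∉ B → χ x = 0) {G : Set E} (hG : MeasurableSet G)
    (hGχ : ∀ x ∈ G, χ x = 1) (hGN : ∀ x ∈ G, N x = H x) {r : ℝ} (hr : 0 < r) :
    ∃ T : Set E, T ⊆ {x | r < |u x|} ∧ T ⊆ B ∧
    ∫ x in G, N x ≤ (∫ x, χ x * u x) + r * volume.real B + (∫ x in T, |w x|)
      + ∫ x in G, |w x| := by
  have hnull : NullMeasurableSet ({x | r < |u x|} ∩ B) volume :=
    (nullMeasurableSet_lt aemeasurable_const (hu.1.aemeasurable.abs)).inter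
      hBm.nullMeasurableSet
  obtain ⟨T, hTsub, hTm, hTae⟩ := hnull.exists_measurable_subset_ae_eq
  refine ⟨T, fun x hx => (hTsub hx).1, fun x hx => (hTsub hx).2, ?_⟩
  have hχu : Integrable fun x => χ x * u x := hu.bdd_mul (c := 1) hχ.aestronglyMeasurable
    (ae_of_all _ fun x => by rw [Real.norm_eq_abs, abs_of_nonneg (hχ0 x)]; exact hχ1 x)
  have hHi : Integrable H := by
    rw [funext hHuw]
    exact hu.add hw
  have hBi : Integrable (B.indicator fun _ => r) :=
    (integrable_indicator_iff hBm).2 (integrableOn_const hB)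
  have hTi : Integrable (T.indicator fun x => |w x|) := hw.abs.indicator hTm
  have hGi : Integrable (G.indicator fun x => |w x|) := hw.abs.indicator hG
  have hpt : ∀ᵐ x, G.indicator H x ≤ χ x * u x + B.indicator (fun _ => r) x
      + T.indicator (fun x => |w x|) x + G.indicator (fun x => |w x|) x := by
    filter_upwards [hTae.mem_iff] with x hx
    have hw0 := abs_nonneg (w x)
    have hT0 : 0 ≤ T.indicator (fun x => |w x|) x :=
      Set.indicator_nonneg (fun _ _ => abs_nonneg _) x
    have hB0 : 0 ≤ B.indicator (fun _ => r) x := Set.indicator_nonneg (fun _ _ => hr.le) x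
    have hG0 : 0 ≤ G.indicator (fun x => |w x|) x :=
      Set.indicator_nonneg (fun _ _ => abs_nonneg _) x
    by_cases hxG : x ∈ G
    · rw [Set.indicator_of_mem hxG, Set.indicator_of_mem hxG, hGχ x hxG, hHuw x]
      linarith [le_abs_self (w x)]
    · rw [Set.indicator_of_notMem hxG]
      suffices 0 ≤ χ x * u x + B.indicator (fun _ => r) x + T.indicator (fun x => |w x|) x by
        linarith
      by_cases hxB : x ∈ B
      · by_cases hux : r < |u x|
        · have hxT : x ∈ T := hx.2 ⟨hux, hxB⟩
          rw [Set.indicator_of_mem hxT]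
          have h1 : -|w x| ≤ u x := by
            have := hH x
            rw [hHuw] at this
            linarith [le_abs_self (w x)]
          nlinarith [hχ0 x, hχ1 x]
        · rw [Set.indicator_of_mem hxB]
          have h1 : -r ≤ u x := (abs_le.1 (not_lt.1 hux)).1
          nlinarith [hχ0 x, hχ1 x]
      · rw [hχB x hxB, zero_mul]
        linarith
  have key := integral_mono_ae (hHi.indicator hG) (((hχu.add hBi).add hTi).add hGi) hpt
  rw [integral_indicator hG] at key
  have e : ∫ x, (((fun x => χ x * u x) + B.indicator (fun _ => r)) + T.indicator (fun x => |w x|)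
      + G.indicator fun x => |w x|) x = (∫ x, χ x * u x) + r * volume.real B + (∫ x in T, |w x|)
      + ∫ x in G, |w x| := by
    rw [integral_add' ((hχu.add hBi).add hTi) hGi, integral_add' (hχu.add hBi) hTi,
      integral_add' hχu hBi, integral_indicator hBm, integral_indicator hTm, integral_indicator hG,
      setIntegral_const, smul_eq_mul, mul_comm r]
  rw [setIntegral_congr_fun hG hGN, ← e]
  exact key

end SingularIntegral

section CoreEstimate

open Module SchwartzMap LineDeriv
open scoped ContDiff

variable {E : Type*} [NormedAddCommGroup E] [InnerProductSpace ℝ E] [FiniteDimensional ℝ E]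
  [MeasurableSpace E] [BorelSpace E]

lemma integrable_continuous_mul {a b : E → ℝ} (ha : Continuous a) (hb : Continuous b)
    (hbc : HasCompactSupport b) : Integrable fun y => a y * b y :=
  (ha.mul hb).integrable_of_hasCompactSupport hbc.mul_left

/-- Telescoping of the convolutions with dyadic dilates. -/
lemma conv_dilate_sub_conv_dilate_zero {ι : Type*} {S : Finset ι} {Φ : E → ℝ} (hΦ : Continuous Φ)
    {K : ι → E → ℝ} (hK : ∀ p, Continuous (K p)) {b : ι → ℝ}
    (h : ∀ z, dilate 1 Φ z - Φ z = ∑ p ∈ S, b p * K p z) {H : E → ℝ} (hH : Continuous H)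
    (hHc : HasCompactSupport H) (J : ℕ) (x : E) :
    (∫ y, dilate J Φ (x - y) * H y) - ∫ y, dilate 0 Φ (x - y) * H y
      = ∑ p ∈ S, b p * ∫ y, (∑ l ∈ Finset.range J, dilate l (K p) (x - y)) * H y := by
  have hstep : ∀ l z, dilate (l + 1) Φ z - dilate l Φ z = ∑ p ∈ S, b p * dilate l (K p) z := by
    intro l z
    have := h ((2 : ℝ) ^ l • z)
    simp only [dilate, pow_one, smul_smul] at this ⊢
    rw [← pow_succ'] at this
    calc _ = ((2 : ℝ) ^ l) ^ finrank ℝ E * (2 ^ finrank ℝ E * Φ ((2 : ℝ) ^ (l + 1) • z)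
          - Φ ((2 : ℝ) ^ l • z)) := by rw [pow_succ, mul_pow]; ring
      _ = _ := by
        rw [this, Finset.mul_sum]
        exact Finset.sum_congr rfl fun _ _ => by ring
  have htel : ∀ z, dilate J Φ z - dilate 0 Φ z
      = ∑ p ∈ S, b p * ∑ l ∈ Finset.range J, dilate l (K p) z := by
    intro z
    rw [← Finset.sum_range_sub (fun l => dilate l Φ z) J]
    simp only [hstep, Finset.mul_sum]
    exact Finset.sum_comm
  have hi : ∀ l, Integrable fun y => dilate l Φ (x - y) * H y := fun l =>
    integrable_continuous_mul ((continuous_dilate hΦ l).comp (by fun_prop)) hH hHc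
  rw [← integral_sub (hi J) (hi 0)]
  simp only [← integral_const_mul]
  rw [← integral_finsetSum]
  · refine integral_congr_ae (ae_of_all _ fun y => ?_)
    change dilate J Φ (x - y) * H y - dilate 0 Φ (x - y) * H y = _
    rw [← sub_mul, htel, Finset.sum_mul]
    exact Finset.sum_congr rfl fun _ _ => by ring
  · intro p _
    refine (integrable_continuous_mul ?_ hH hHc).const_mul _
    exact continuous_finsetSum _ fun l _ => (continuous_dilate (hK p) l).comp (by fun_prop)

/-- Smallness on small sets of a function with a lower order dyadic bound. -/
lemma setIntegral_abs_le_of_sum_dilate_majorant_le {ι : Type*} (S : Finset ι) {w : E → ℝ}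
    (hw : Integrable w) {C : ι → ℝ} (hC : ∀ i, 0 ≤ C i) {a : ι → E → ℝ}
    (ha : ∀ i, Integrable (a i)) (ha0 : ∀ i x, 0 ≤ a i x) {m D : ℝ} (ham : ∀ i, ∫ x, a i x ≤ m)
    {J : ℕ} (h : ∀ x, |w x| ≤ D + ∑ i ∈ S, C i * ∑ l ∈ Finset.range J, ((2 : ℝ) ^ l)⁻¹ *
      ∫ y, dilate l majorant (x - y) * a i y) (L : ℕ) {T : Set E} (hT : volume T ≠ ⊤) :
    ∫ x in T, |w x| ≤ D * volume.real T + (∑ i ∈ S, C i) *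
      (2 * (((2 : ℝ) ^ L) ^ finrank ℝ E * volume.real T
        + ((2 : ℝ) ^ L)⁻¹ * ∫ x : E, majorant x) * m) := by
  have hm : 0 ≤ ∫ x : E, majorant x := integral_nonneg fun x => (majorant_pos x).le
  have hc : ∀ i l, Integrable (fun x => ∫ y, dilate l majorant (x - y) * a i y) := fun i l =>
    integrable_conv (integrable_dilate integrable_majorant l) (ha i)
  have hs : ∀ i, Integrable (fun x => C i * ∑ l ∈ Finset.range J, ((2 : ℝ) ^ l)⁻¹ *
      ∫ y, dilate l majorant (x - y) * a i y) := fun i =>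
    (integrable_finsetSum _ fun l _ => (hc i l).const_mul _).const_mul _
  have hD : IntegrableOn (fun _ => D) T := integrableOn_const hT
  refine (setIntegral_mono hw.abs.integrableOn (hD.add
    (integrable_finsetSum S fun i _ => hs i).integrableOn) h).trans ?_
  have e : ∫ x in T, (D + ∑ i ∈ S, C i * ∑ l ∈ Finset.range J,
      ((2 : ℝ) ^ l)⁻¹ * ∫ y, dilate l majorant (x - y) * a i y)
      = D * volume.real T + ∑ i ∈ S, C i * ∫ x in T, ∑ l ∈ Finset.range J,
      ((2 : ℝ) ^ l)⁻¹ * ∫ y, dilate l majorant (x - y) * a i y := by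
    rw [integral_add hD (integrable_finsetSum S fun i _ => hs i).integrableOn,
      integral_finsetSum _ fun i _ => (hs i).integrableOn, setIntegral_const, smul_eq_mul, mul_comm]
    simp only [integral_const_mul]
  refine e.le.trans ?_
  rw [Finset.sum_mul]
  gcongr with i
  · exact hC i
  · refine (setIntegral_sum_dilate_majorant_le (ha i) (ha0 i) L J hT).trans ?_
    exact mul_le_mul_of_nonneg_left (ham i) (by positivity)

end CoreEstimate

section CoreEstimateDomain

open Module SchwartzMap LineDeriv
open scoped ContDiff

variable {d : ℕ}

local notation "𝔼" => EuclideanSpace ℝ (Fin d)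

/-- Decomposition of the localized density into a singular integral of the deviation from the
constant polar and a lower order remainder. -/
lemma exists_decomposition [Nontrivial 𝔼] {m n k : ℕ} (hk : 1 ≤ k)
    {A : (Fin d → ℕ) → Matrix (Fin n) (Fin m) ℝ} {P : Fin m → ℝ} (hP : P ∉ waveCone k A)
    {χ : 𝔼 → ℝ} (hχ : ContDiff ℝ ∞ χ) (hχc : HasCompactSupport χ) (hχ0 : ∀ x, 0 ≤ χ x)
    (hχ1 : ∀ x, χ x ≤ 1) {B : Set 𝔼} (hB : IsCompact B) (hχB : tsupport χ ⊆ B) :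
    ∃ C D C' : ℝ, 0 ≤ C ∧ 0 ≤ D ∧ 0 ≤ C' ∧ ∀ (R : ℝ) (N : 𝔼 → ℝ) (s : Fin n → 𝔼 → ℝ)
      (F : Fin m → 𝔼 → ℝ) (ε : ℝ), 0 ≤ R → R ≤ 1 → Continuous N → (∀ i, Continuous (s i)) →
      (∀ j, Continuous (F j)) → (∀ j y, |F j y| ≤ N y) → (∀ y, 0 ≤ N y) → ∫ y in B, N y ≤ 1 →
      (∀ i, ∫ y in B, |s i y| ≤ 1) → 0 ≤ ε → (∀ j, ∫ y in B, |P j * N y - F j y| ≤ ε) →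
      (∀ ψ : 𝔼 → ℝ, ContDiff ℝ ∞ ψ → HasCompactSupport ψ → tsupport ψ ⊆ B → ∀ i,
        ∑ α ∈ multiIdxLe d k, R ^ (k - ∑ l, α l) * ((-1) ^ (∑ l, α l) *
          ∑ j, A α i j * ∫ y, pderivMulti α ψ y * F j y) = ∫ y, ψ y * s i y) →
      ∃ u w : 𝔼 → ℝ, (∀ x, χ x * N x = u x + w x) ∧ Integrable u ∧ Integrable w ∧
        |∫ x, χ x * u x| ≤ C * ε ∧
        (∀ r : ℝ, 0 < r → volume {x | r < |u x|} ≤ ENNReal.ofReal (C * ε / r)) ∧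
        ∀ (L : ℕ) (T : Set 𝔼), volume T ≠ ⊤ → ∫ x in T, |w x| ≤ D * volume.real T +
          C' * (((2 : ℝ) ^ L) ^ d * volume.real T + ((2 : ℝ) ^ L)⁻¹) := by
  obtain ⟨Φ, Q, hΦ1, hΦ⟩ := exists_parametrix hP
  choose Ci hCi hCib using fun i => exists_abs_sum_conv_le hk A (Q i) hχ hχc hB hχB i
  set S : Finset (Fin n × (Fin d → ℕ) × Fin m) :=
    Finset.univ ×ˢ (multiIdxEq d k ×ˢ Finset.univ) with hS
  set K : Fin n × (Fin d → ℕ) × Fin m → 𝓢(𝔼, ℝ) := fun p =>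
    iterLineDeriv (multiList p.2.1) (Q p.1) with hK
  have hKp : ∀ p, ⇑(K p) = pderivMulti p.2.1 (Q p.1) := fun p => by
    rw [hK, pderivMulti_eq_iterPDeriv, iterPDeriv_schwartz]
  set c : Fin n × (Fin d → ℕ) × Fin m → ℝ := fun p => A p.2.1 p.1 p.2.2 with hc
  have hK0 : ∀ p ∈ S, ∫ x, K p x = 0 := by
    intro p hp
    have hp' : ∑ i, p.2.1 i = k := by
      simp only [hS, Finset.mem_product, multiIdxEq, Finset.mem_filter] at hp
      exact hp.2.1.2
    have hL : multiList p.2.1 ≠ [] := by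
      intro h0
      have := length_multiList p.2.1
      rw [h0, hp'] at this
      simp at this
      omega
    have := SchwartzMap.integral_iterPDeriv_eq_zero hL (Q p.1)
    rwa [iterPDeriv_schwartz] at this
  obtain ⟨C₀, hχL⟩ :=
    (hχ.of_le (by simp)).lipschitzWith_of_hasCompactSupport hχc (n := 1) one_ne_zero
  have hχL' : ∀ x y, |χ x - χ y| ≤ C₀ * ‖x - y‖ := fun x y => hχL.norm_sub_le x y
  have hχa : ∀ x, |χ x| ≤ 1 := fun x => by rw [abs_of_nonneg (hχ0 x)]; exact hχ1 x
  obtain ⟨C, hC, hCb⟩ := exists_bounds_sum_conv S K hK0 c hχL' hχ.continuous hχa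
  obtain ⟨MΦ, hMΦ, hMΦb⟩ := Φ.exists_norm_le_majorant
  set I := ∫ x : 𝔼, majorant x with hI
  have hI0 : 0 ≤ I := integral_nonneg fun x => (majorant_pos x).le
  have hCs : 0 ≤ ∑ i, Ci i := Finset.sum_nonneg fun i _ => hCi i
  refine ⟨C, 1 + MΦ, (∑ i, Ci i) * 4 * (1 + I), hC, by positivity, by positivity, ?_⟩
  intro R N s F ε hR0 hR1 hN hs hF hFN hN0 hN1 hs1 hε hPF heq
  have hmul : ∀ {h : 𝔼 → ℝ}, HasCompactSupport fun y => χ y * h y := fun {h} => hχc.mul_right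
  set H : 𝔼 → ℝ := fun y => χ y * N y with hH
  have hHcont : Continuous H := hχ.continuous.mul hN
  have hχsupp : ∀ y, y ∉ B → χ y = 0 := fun y hy =>
    image_eq_zero_of_notMem_tsupport fun h => hy (hχB h)
  have hloc : ∀ {h : 𝔼 → ℝ}, Continuous h → ∫ y, |χ y * h y| ≤ ∫ y in B, |h y| := by
    intro h hh
    rw [← integral_indicator hB.measurableSet]
    refine integral_mono ?_ ?_ fun y => ?_
    · exact ((hχ.continuous.mul hh).integrable_of_hasCompactSupport hmul).abs
    · exact (integrable_indicator_iff hB.measurableSet).2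
        (hh.abs.continuousOn.integrableOn_compact hB)
    · by_cases hy : y ∈ B
      · simp only [Set.indicator_of_mem hy, abs_mul]
        exact mul_le_of_le_one_left (abs_nonneg _) (hχa y)
      · simp [Set.indicator_of_notMem hy, hχsupp y hy]
  obtain ⟨J, hJ⟩ := Φ.exists_abs_sub_conv_dilate_le hΦ1 hHcont hmul one_pos
  set v : Fin n × (Fin d → ℕ) × Fin m → 𝔼 → ℝ := fun p y => χ y * (P p.2.2 * N y - F p.2.2 y)
    with hv
  have hvc : ∀ p, Continuous (v p) := fun p =>
    hχ.continuous.mul ((continuous_const.mul hN).sub (hF _))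
  obtain ⟨hu, hu1, hu2⟩ := hCb J v ε hvc (fun p => hmul)
    (fun p => (hloc ((continuous_const.mul hN).sub (hF _))).trans (hPF _)) hε
  set u : 𝔼 → ℝ := fun x => ∑ p ∈ S, c p *
    ∫ y, (∑ l ∈ Finset.range J, dilate l (K p) (x - y)) * v p y with hudef
  have hHi : Integrable H := hHcont.integrable_of_hasCompactSupport hmul
  set a : Fin n → 𝔼 → ℝ := fun i => B.indicator fun y => N y + |s i y| with ha
  have hBi : ∀ {h : 𝔼 → ℝ}, Continuous h → IntegrableOn h B := fun hh =>
    hh.continuousOn.integrableOn_compact hB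
  have hai : ∀ i, Integrable (a i) := fun i =>
    (integrable_indicator_iff hB.measurableSet).2 (hBi (hN.add (hs i).abs))
  have ha0 : ∀ i x, 0 ≤ a i x := fun i x =>
    Set.indicator_nonneg (fun y _ => add_nonneg (hN0 y) (abs_nonneg _)) x
  have ha2 : ∀ i, ∫ x, a i x ≤ 2 := fun i => by
    rw [ha, integral_indicator hB.measurableSet, integral_add (hBi hN) (hBi (hs i).abs)]
    linarith [hs1 i]
  set r : 𝔼 → ℝ := fun x => ∑ p ∈ S, c p *
    ∫ y, (∑ l ∈ Finset.range J, dilate l (K p) (x - y)) * (χ y * F p.2.2 y) with hr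
  have hKc : ∀ p x, Continuous fun y => ∑ l ∈ Finset.range J, dilate l (K p) (x - y) := fun p x =>
    continuous_finsetSum _ fun l _ => (continuous_dilate (K p).continuous l).comp (by fun_prop)
  have hid : ∀ x, (∫ y, dilate J Φ (x - y) * H y) - (∫ y, dilate 0 Φ (x - y) * H y)
      = u x + r x := by
    intro x
    rw [conv_dilate_sub_conv_dilate_zero (S := S) Φ.continuous (K := fun p => K p)
      (fun p => (K p).continuous) (b := fun p => c p * P p.2.2) ?_ hHcont hmul]
    · rw [hudef, hr, ← Finset.sum_add_distrib]
      refine Finset.sum_congr rfl fun p _ => ?_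
      rw [mul_assoc, ← mul_add, ← integral_const_mul, ← integral_add]
      · congr 2; ext y; simp only [hH, hv]; ring
      · exact integrable_continuous_mul (hKc p x) (hvc p) hmul
      · exact integrable_continuous_mul (hKc p x) (hχ.continuous.mul (hF _)) hmul
    · intro z
      rw [hΦ z, hS, Finset.sum_product]
      refine Finset.sum_congr rfl fun i _ => ?_
      rw [Finset.sum_product]
      refine Finset.sum_congr rfl fun α _ => ?_
      simp only [hKp, hc, Finset.sum_mul]
  have hrb : ∀ x, |r x| ≤ ∑ i, Ci i * ∑ l ∈ Finset.range J, ((2 : ℝ) ^ l)⁻¹ *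
      ∫ y, dilate l majorant (x - y) * a i y := by
    intro x
    have e : r x = ∑ i, ∑ l ∈ Finset.range J, ∑ α ∈ multiIdxEq d k, ∑ j, A α i j *
        ∫ y, χ y * dilate l (pderivMulti α (Q i)) (x - y) * F j y := by
      rw [hr, hS]
      simp only
      rw [Finset.sum_product]
      refine Finset.sum_congr rfl fun i _ => ?_
      rw [Finset.sum_product, Finset.sum_comm (s := Finset.range J)]
      refine Finset.sum_congr rfl fun α _ => ?_
      rw [Finset.sum_comm (s := Finset.range J)]
      refine Finset.sum_congr rfl fun j _ => ?_
      rw [← Finset.mul_sum, ← integral_finsetSum]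
      · simp only [hKp, hc]
        congr 2; ext y
        rw [Finset.sum_mul]
        exact Finset.sum_congr rfl fun _ _ => by ring
      · intro l _
        have := integrable_continuous_mul (a := fun y => dilate l (K (i, α, j)) (x - y))
          ((continuous_dilate (K (i, α, j)).continuous l).comp (by fun_prop))
          (hχ.continuous.mul (hF j)) hmul
        refine this.congr (ae_of_all _ fun y => ?_)
        simp only [hKp, Pi.mul_apply]; ring
    rw [e]
    refine (Finset.abs_sum_le_sum_abs _ _).trans (Finset.sum_le_sum fun i _ => ?_)
    rw [Finset.mul_sum]
    refine (Finset.abs_sum_le_sum_abs _ _).trans (Finset.sum_le_sum fun l _ => ?_)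
    exact hCib i R N (s i) F hR0 hR1 hN (hs i) hF hFN hN0 (fun ψ h1 h2 h3 => heq ψ h1 h2 h3 i) l x
  have hH1 : ∫ y, |H y| ≤ 1 := by
    refine (hloc hN).trans ((setIntegral_congr_fun hB.measurableSet fun y _ => ?_).le.trans hN1)
    exact abs_of_nonneg (hN0 y)
  have h0b : ∀ x, |∫ y, dilate 0 Φ (x - y) * H y| ≤ MΦ := by
    intro x
    have hle : ∀ z, |Φ z| ≤ MΦ := fun z => (hMΦb z).trans
      (mul_le_of_le_one_right hMΦ (majorant_le_one z))
    calc |∫ y, dilate 0 Φ (x - y) * H y| ≤ ∫ y, MΦ * |H y| := by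
          rw [← Real.norm_eq_abs]
          refine norm_integral_le_of_norm_le (hHi.abs.const_mul _) (ae_of_all _ fun y => ?_)
          rw [Real.norm_eq_abs, abs_mul]
          exact mul_le_mul_of_nonneg_right (by simpa [dilate] using hle (x - y)) (abs_nonneg _)
      _ ≤ MΦ := by
          rw [integral_const_mul]
          exact mul_le_of_le_one_right hMΦ hH1
  refine ⟨u, fun x => H x - u x, fun x => by simp only [hH]; ring, hu, hHi.sub hu, hu1, hu2, ?_⟩
  intro L T hT
  have hwb : ∀ x, |H x - u x| ≤ (1 + MΦ) + ∑ i, Ci i * ∑ l ∈ Finset.range J, ((2 : ℝ) ^ l)⁻¹ *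
      ∫ y, dilate l majorant (x - y) * a i y := by
    intro x
    have e : H x - u x = (H x - ∫ y, dilate J Φ (x - y) * H y)
        + (∫ y, dilate 0 Φ (x - y) * H y) + r x := by linarith [hid x]
    rw [e]
    linarith [abs_add_three (H x - ∫ y, dilate J Φ (x - y) * H y)
      (∫ y, dilate 0 Φ (x - y) * H y) (r x), hJ x, h0b x, hrb x]
  refine (setIntegral_abs_le_of_sum_dilate_majorant_le Finset.univ (hHi.sub hu) hCi hai ha0 ha2
    hwb L hT).trans ?_
  rw [finrank_euclideanSpace_fin]
  have hV := measureReal_nonneg (μ := volume) (s := T)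
  have h1 : (0 : ℝ) ≤ ((2 : ℝ) ^ L) ^ d * volume.real T := by positivity
  have h2 : (0 : ℝ) ≤ ((2 : ℝ) ^ L)⁻¹ := by positivity
  have h3 : (∑ i, Ci i) * (2 * (((2 : ℝ) ^ L) ^ d * volume.real T + ((2 : ℝ) ^ L)⁻¹ * I) * 2)
      ≤ (∑ i, Ci i) * (4 * (1 + I) * (((2 : ℝ) ^ L) ^ d * volume.real T + ((2 : ℝ) ^ L)⁻¹)) := by
    refine mul_le_mul_of_nonneg_left ?_ hCs
    nlinarith [mul_nonneg h1 hI0]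
  linarith

end CoreEstimateDomain

section SmallSets

open Module SchwartzMap LineDeriv
open scoped ContDiff

variable {d : ℕ}

local notation "𝔼" => EuclideanSpace ℝ (Fin d)

/-- If the polar is close to a vector outside the wave cone, the mass does not concentrate on
sets of small volume. -/
theorem exists_setIntegral_lt [Nontrivial 𝔼] {m n k : ℕ} (hk : 1 ≤ k)
    {A : (Fin d → ℕ) → Matrix (Fin n) (Fin m) ℝ} {P : Fin m → ℝ} (hP : P ∉ waveCone k A)
    {c₀ : ℝ} (hc₀ : 0 < c₀) :
    ∃ ε : ℝ, 0 < ε ∧ ∀ (R : ℝ) (N : 𝔼 → ℝ) (s : Fin n → 𝔼 → ℝ)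
      (F : Fin m → 𝔼 → ℝ), 0 ≤ R → R ≤ 1 → Continuous N → (∀ i, Continuous (s i)) →
      (∀ j, Continuous (F j)) → (∀ j y, |F j y| ≤ N y) → (∀ y, 0 ≤ N y) →
      ∫ y in closedBall 0 (3 / 4), N y ≤ 1 → (∀ i, ∫ y in closedBall 0 (3 / 4), |s i y| ≤ 1) →
      (∀ j, ∫ y in closedBall 0 (3 / 4), |P j * N y - F j y| ≤ ε) →
      (∀ ψ : 𝔼 → ℝ, ContDiff ℝ ∞ ψ → HasCompactSupport ψ → tsupport ψ ⊆ closedBall 0 (3 / 4) →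
        ∀ i, ∑ α ∈ multiIdxLe d k, R ^ (k - ∑ l, α l) * ((-1) ^ (∑ l, α l) *
          ∑ j, A α i j * ∫ y, pderivMulti α ψ y * F j y) = ∫ y, ψ y * s i y) →
      ∀ G : Set 𝔼, MeasurableSet G → G ⊆ closedBall 0 (1 / 2) → volume.real G ≤ ε →
        ∫ y in G, N y < c₀ := by
  let b : ContDiffBump (0 : 𝔼) := ⟨1 / 2, 3 / 4, by norm_num, by norm_num⟩
  have hbt : tsupport b = closedBall 0 (3 / 4) := b.tsupport_eq
  obtain ⟨C, D, C', hC, hD, hC', h⟩ := exists_decomposition hk hP (χ := b) b.contDiff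
    b.hasCompactSupport (fun x => b.nonneg) (fun x => b.le_one)
    (isCompact_closedBall (0 : 𝔼) (3 / 4)) hbt.subset
  obtain ⟨L, hL⟩ := exists_pow_lt_of_lt_one (by positivity : 0 < c₀ / (8 * (C' + 1)))
    (by norm_num : (2⁻¹ : ℝ) < 1)
  set V := volume.real (closedBall (0 : 𝔼) (3 / 4)) with hV
  have hV0 : 0 ≤ V := measureReal_nonneg
  set W : ℝ := D + C' * ((2 : ℝ) ^ L) ^ d with hW
  have hW0 : 0 ≤ W := by positivity
  set r : ℝ := c₀ / (8 * (V + 1)) with hr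
  have hr0 : 0 < r := by positivity
  set t : ℝ := c₀ / (8 * (W + 1)) with ht
  have ht0 : 0 < t := by positivity
  set ε : ℝ := min t (min (c₀ / (8 * (C + 1))) (r * t / (C + 1))) with hε
  have hε0 : 0 < ε := by positivity
  refine ⟨ε, hε0, ?_⟩
  intro R N s F hR0 hR1 hN hs hF hFN hN0 hN1 hs1 hPF heq G hG hGB hGε
  obtain ⟨u, w, huw, hu, hw, hu1, hu2, hw1⟩ :=
    h R N s F ε hR0 hR1 hN hs hF hFN hN0 hN1 hs1 hε0.le hPF heq
  obtain ⟨T, hTu, hTB, hT⟩ := setIntegral_le_of_decomposition (N := N) huw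
    (fun x => mul_nonneg b.nonneg (hN0 x)) hu hw b.continuous (fun x => b.nonneg)
    (fun x => b.le_one)
    measurableSet_closedBall measure_closedBall_lt_top.ne
    (fun x hx => image_eq_zero_of_notMem_tsupport (by rwa [hbt])) hG
    (fun x hx => b.one_of_mem_closedBall (hGB hx))
    (fun x hx => by simp only [b.one_of_mem_closedBall (hGB hx), one_mul]) hr0
  have hfin : ∀ {Z : Set 𝔼} {q : ℝ}, Z ⊆ closedBall 0 q → volume Z ≠ ⊤ := fun hZ =>
    ((measure_mono hZ).trans_lt measure_closedBall_lt_top).ne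
  have hTt : volume.real T ≤ t := by
    have h1 : volume.real T ≤ C * ε / r := ENNReal.toReal_le_of_le_ofReal (by positivity)
      ((measure_mono hTu).trans (hu2 r hr0))
    refine h1.trans ?_
    have h2 : ε ≤ r * t / (C + 1) := (min_le_right _ _).trans (min_le_right _ _)
    rw [le_div_iff₀ (by positivity)] at h2
    rw [div_le_iff₀ hr0]
    nlinarith
  have hGt : volume.real G ≤ t := hGε.trans (min_le_left _ _)
  have hw2 : ∀ {Z : Set 𝔼}, volume Z ≠ ⊤ → volume.real Z ≤ t → ∫ x in Z, |w x| ≤ c₀ / 4 := by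
    intro Z hZ hZt
    refine (hw1 L Z hZ).trans ?_
    have h1 : W * volume.real Z ≤ c₀ / 8 := by
      have h3 : W * volume.real Z ≤ (W + 1) * t := by
        have := measureReal_nonneg (μ := volume) (s := Z)
        nlinarith
      refine h3.trans (le_of_eq ?_)
      rw [ht]; field_simp
    have h2 : C' * ((2 : ℝ) ^ L)⁻¹ ≤ c₀ / 8 := by
      rw [inv_pow, lt_div_iff₀ (by positivity)] at hL
      have : (0 : ℝ) ≤ ((2 : ℝ) ^ L)⁻¹ := by positivity
      linarith
    rw [hW] at h1
    linarith
  have hCε : C * ε ≤ c₀ / 8 := by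
    have h2 : ε ≤ c₀ / (8 * (C + 1)) := (min_le_right _ _).trans (min_le_left _ _)
    rw [le_div_iff₀ (by positivity)] at h2
    linarith
  have hrV : r * V ≤ c₀ / 8 := by
    rw [hr, div_mul_eq_mul_div, div_le_div_iff₀ (by positivity) (by positivity)]
    nlinarith
  have h1 := hw2 (hfin hTB) hTt
  have h2 := hw2 (hfin hGB) hGt
  linarith [le_abs_self (∫ x, b x * u x)]

end SmallSets

section Mollification

open Module
open scoped ContDiff Convolution

variable {E : Type*} [NormedAddCommGroup E] [MeasurableSpace E] [BorelSpace E]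

/-- The mollification of the measure `f • ν` by the kernel `η`. -/
noncomputable def mollify (η : E → ℝ) (ν : Measure E) (f : E → ℝ) (y : E) : ℝ :=
  ∫ z, η (y - z) * f z ∂ν

section

variable {η : E → ℝ} {ν : Measure E} {f : E → ℝ}

lemma integrable_kernel_mul (hη : Continuous η) (hηc : HasCompactSupport η) (hf : Integrable f ν)
    (y : E) : Integrable (fun z => η (y - z) * f z) ν := by
  obtain ⟨M, hM⟩ := hηc.exists_bound_of_continuous hη
  exact hf.bdd_mul (by fun_prop : Continuous fun z => η (y - z)).aestronglyMeasurable
    (ae_of_all _ fun z => hM _)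

lemma continuous_mollify (hη : Continuous η) (hηc : HasCompactSupport η) (hf : Integrable f ν) :
    Continuous (mollify η ν f) := by
  obtain ⟨M, hM⟩ := hηc.exists_bound_of_continuous hη
  refine continuous_of_dominated (bound := fun z => M * |f z|) (fun y =>
    (integrable_kernel_mul hη hηc hf y).aestronglyMeasurable) (fun y => ae_of_all _ fun z => ?_)
    (hf.abs.const_mul M) (ae_of_all _ fun z => by fun_prop)
  rw [norm_mul]
  exact mul_le_mul_of_nonneg_right (hM _) (norm_nonneg _)

end

variable [InnerProductSpace ℝ E] [FiniteDimensional ℝ E]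

section

variable {η : E → ℝ} {ν : Measure E} [IsFiniteMeasure ν] {f : E → ℝ}

lemma integrable_prod_kernel_mul (hη : Continuous η) (hηc : HasCompactSupport η)
    (hf : Integrable f ν) :
    Integrable (fun p : E × E => η (p.1 - p.2) * f p.2) (volume.prod ν) := by
  have hηi : Integrable η := hη.integrable_of_hasCompactSupport hηc
  have hm : AEStronglyMeasurable (fun p : E × E => η (p.1 - p.2) * f p.2) (volume.prod ν) :=
    (by fun_prop : Continuous fun p : E × E => η (p.1 - p.2)).aestronglyMeasurable.mul
      hf.aestronglyMeasurable.comp_snd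
  rw [integrable_prod_iff' hm]
  refine ⟨ae_of_all _ fun z => (hηi.comp_sub_right z).mul_const (f z), ?_⟩
  simp only [norm_mul, integral_mul_const]
  refine (hf.norm.const_mul (∫ y, ‖η y‖)).congr (ae_of_all _ fun z => ?_)
  simp only
  rw [integral_sub_right_eq_self (fun y => ‖η y‖) z]

lemma integral_mul_mollify (hη : Continuous η) (hηc : HasCompactSupport η) (hf : Integrable f ν)
    {h : E → ℝ} (hh : AEStronglyMeasurable h) {M : ℝ} (hM : ∀ y, ‖h y‖ ≤ M) :
    ∫ y, h y * mollify η ν f y = ∫ z, (∫ y, h y * η (y - z)) * f z ∂ν := by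
  have hi : Integrable (fun p : E × E => h p.1 * (η (p.1 - p.2) * f p.2)) (volume.prod ν) :=
    (integrable_prod_kernel_mul hη hηc hf).bdd_mul hh.comp_fst (ae_of_all _ fun p => hM _)
  have := integral_integral_swap (f := fun y z => h y * (η (y - z) * f z)) hi
  simp only [integral_const_mul] at this
  refine this.trans ?_
  refine integral_congr_ae (ae_of_all _ fun z => ?_)
  simp only [← mul_assoc, integral_mul_const]

lemma setIntegral_abs_mollify_le (hη : Continuous η) (hηc : HasCompactSupport η)
    (hη0 : ∀ x, 0 ≤ η x) (hη1 : ∫ x, η x = 1) (hf : Integrable f ν) (B : Set E) :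
    ∫ y in B, |mollify η ν f y| ≤ ∫ z, |f z| ∂ν := by
  have hi := integrable_prod_kernel_mul hη hηc hf.abs
  have hη1' : ∀ z, ∫ y, η (y - z) = 1 := fun z => by rw [integral_sub_right_eq_self, hη1]
  have h1 : ∀ y, |mollify η ν f y| ≤ mollify η ν (fun z => |f z|) y := fun y => by
    refine (abs_integral_le_integral_abs).trans (le_of_eq ?_)
    refine integral_congr_ae (ae_of_all _ fun z => ?_)
    simp only [abs_mul, abs_of_nonneg (hη0 _)]
  have hmi : Integrable (mollify η ν fun z => |f z|) := hi.integral_prod_left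
  have hmi' : Integrable (fun y => |mollify η ν f y|) :=
    ((integrable_prod_kernel_mul hη hηc hf).integral_prod_left).abs
  calc ∫ y in B, |mollify η ν f y| ≤ ∫ y, |mollify η ν f y| :=
        setIntegral_le_integral hmi' (ae_of_all _ fun y => abs_nonneg _)
    _ ≤ ∫ y, mollify η ν (fun z => |f z|) y := integral_mono hmi' hmi h1
    _ = ∫ z, |f z| ∂ν := by
        have := integral_mul_mollify hη hηc hf.abs (h := fun _ => 1) aestronglyMeasurable_const
          (M := 1) (by simp)
        simpa [hη1'] using this

lemma measureReal_le_setIntegral_mollify (hη : Continuous η) (hηc : HasCompactSupport η)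
    (hη0 : ∀ x, 0 ≤ η x) (hη1 : ∫ x, η x = 1) {K U : Set E} (hK : MeasurableSet K)
    (hU : MeasurableSet U) (hKU : ∀ z ∈ K, ∀ y, η (y - z) ≠ 0 → y ∈ U) :
    ν.real K ≤ ∫ y in U, mollify η ν (fun _ => 1) y := by
  have hηi : Integrable η := hη.integrable_of_hasCompactSupport hηc
  have h1 : Integrable (fun _ : E => (1 : ℝ)) ν := integrable_const 1
  have e := integral_mul_mollify hη hηc h1 (h := U.indicator fun _ => 1)
    (aestronglyMeasurable_const.indicator hU) (M := 1) (fun y => by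
      by_cases hy : y ∈ U <;> simp [hy])
  have e1 : ∫ y, U.indicator (fun _ => (1 : ℝ)) y * mollify η ν (fun _ => 1) y
      = ∫ y in U, mollify η ν (fun _ => 1) y := by
    rw [← integral_indicator hU]
    congr 1; ext y
    by_cases hy : y ∈ U <;> simp [hy]
  rw [← e1, e, ← integral_indicator_one hK]
  have hq : ∀ z, Integrable fun y => U.indicator (fun _ => (1 : ℝ)) y * η (y - z) := fun z =>
    (hηi.comp_sub_right z).bdd_mul (c := 1) (aestronglyMeasurable_const.indicator hU)
      (ae_of_all _ fun y => by by_cases hy : y ∈ U <;> simp [hy])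
  have hi : Integrable (fun p : E × E => U.indicator (fun _ => (1 : ℝ)) p.1 *
      (η (p.1 - p.2) * 1)) (volume.prod ν) :=
    (integrable_prod_kernel_mul hη hηc h1).bdd_mul (c := 1)
      (aestronglyMeasurable_const.indicator hU : AEStronglyMeasurable _ volume).comp_fst
      (ae_of_all _ fun p => by by_cases hy : p.1 ∈ U <;> simp [hy])
  refine integral_mono ((integrable_const _).indicator hK) ?_ fun z => ?_
  · simpa using hi.integral_prod_right
  · simp only [mul_one]
    by_cases hz : z ∈ K
    · rw [Set.indicator_of_mem hz]
      have : ∫ y, U.indicator (fun _ => (1 : ℝ)) y * η (y - z) = ∫ y, η (y - z) := by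
        congr 1; ext y
        by_cases hy : η (y - z) = 0
        · simp [hy]
        · simp [hKU z hz y hy]
      rw [this, integral_sub_right_eq_self, hη1]
      rfl
    · rw [Set.indicator_of_notMem hz]
      exact integral_nonneg fun y => mul_nonneg (Set.indicator_nonneg (fun _ _ => zero_le_one) _)
        (hη0 _)

end

lemma convolution_mul_eq {η ψ : E → ℝ} (hη : ∀ x, η (-x) = η x) (z : E) :
    (η ⋆[ContinuousLinearMap.mul ℝ ℝ, volume] ψ) z = ∫ y, ψ y * η (y - z) := by
  rw [convolution_eq_swap]
  refine integral_congr_ae (ae_of_all _ fun y => ?_)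
  simp only [ContinuousLinearMap.mul_apply']
  rw [← hη (z - y), neg_sub, mul_comm]

end Mollification

section MollificationDerivative

open scoped ContDiff Convolution

variable {d : ℕ}

local notation "𝔼" => EuclideanSpace ℝ (Fin d)

lemma iterPDeriv_convolution {η ψ : 𝔼 → ℝ} (hη : Continuous η) (hψ : ContDiff ℝ ∞ ψ)
    (hψc : HasCompactSupport ψ) (L : List (Fin d)) :
    iterPDeriv L (η ⋆[ContinuousLinearMap.mul ℝ ℝ, volume] ψ)
      = η ⋆[ContinuousLinearMap.mul ℝ ℝ, volume] iterPDeriv L ψ := by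
  induction L with
  | nil => rfl
  | cons i L ih =>
    change pderiv' i (iterPDeriv L _) = _
    rw [ih]
    have hc : HasCompactSupport (iterPDeriv L ψ) :=
      hψc.of_isClosed_subset (isClosed_tsupport _) (tsupport_iterPDeriv_subset L ψ)
    have hd : ContDiff ℝ 1 (iterPDeriv L ψ) := (hψ.iterPDeriv L).of_le (by simp)
    ext x
    have h := hc.hasFDerivAt_convolution_right (ContinuousLinearMap.mul ℝ ℝ)
      (hη.locallyIntegrable (μ := volume)) hd x
    rw [pderiv', h.fderiv, convolution_precompR_apply _ (hη.locallyIntegrable)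
      (hc.fderiv ℝ) (hd.continuous_fderiv one_ne_zero)]
    rfl

end MollificationDerivative

section Concentration

open scoped ContDiff Convolution

variable {d : ℕ}

local notation "𝔼" => EuclideanSpace ℝ (Fin d)

/-- Measures with polar close to a vector outside the wave cone do not concentrate on null sets:
quantitative version. -/
theorem exists_measureReal_inter_ball_le [Nontrivial 𝔼] {m n k : ℕ} (hk : 1 ≤ k)
    {A : (Fin d → ℕ) → Matrix (Fin n) (Fin m) ℝ} {P : Fin m → ℝ} (hP : P ∉ waveCone k A)
    {c₀ : ℝ} (hc₀ : 0 < c₀) :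
    ∃ ε : ℝ, 0 < ε ∧ ∀ (R : ℝ) (ν τ : Measure 𝔼) [IsFiniteMeasure ν] [IsFiniteMeasure τ]
      (f : Fin m → 𝔼 → ℝ) (g : Fin n → 𝔼 → ℝ), 0 ≤ R → R ≤ 1 →
      (∀ j, AEStronglyMeasurable (f j) ν) → (∀ i, AEStronglyMeasurable (g i) τ) →
      (∀ j, ∀ᵐ x ∂ν, |f j x| ≤ 1) → (∀ i, ∀ᵐ x ∂τ, |g i x| ≤ 1) →
      ν.real Set.univ ≤ 1 → τ.real Set.univ ≤ 1 → (∀ j, ∫ x, |P j - f j x| ∂ν ≤ ε) →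
      (∀ ψ : 𝔼 → ℝ, ContDiff ℝ ∞ ψ → HasCompactSupport ψ → tsupport ψ ⊆ ball 0 1 →
        ∀ i, ∑ α ∈ multiIdxLe d k, R ^ (k - ∑ l, α l) * ((-1) ^ (∑ l, α l) *
          ∑ j, A α i j * ∫ y, pderivMulti α ψ y * f j y ∂ν) = ∫ y, ψ y * g i y ∂τ) →
      ∀ S : Set 𝔼, MeasurableSet S → volume S = 0 → ν.real (S ∩ ball 0 (1 / 2)) ≤ c₀ := by
  obtain ⟨ε, hε, h⟩ := exists_setIntegral_lt (d := d) hk hP hc₀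
  refine ⟨ε, hε, ?_⟩
  intro R ν τ _ _ f g hR0 hR1 hfm hgm hf1 hg1 hν hτ hPf heq S hS hS0
  by_contra! hcon
  have hSm : MeasurableSet (S ∩ ball (0 : 𝔼) (1 / 2)) := hS.inter measurableSet_ball
  obtain ⟨K, hKS, hK, hKν⟩ := hSm.exists_lt_isCompact
    (r := ENNReal.ofReal c₀) (μ := ν)
    (by rwa [← ofReal_measureReal, ENNReal.ofReal_lt_ofReal_iff_of_nonneg hc₀.le])
  have hK0 : volume K = 0 := measure_mono_null (hKS.trans Set.inter_subset_left) hS0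
  obtain ⟨U', hKU', hU'o, hU'ε⟩ := K.exists_isOpen_lt_of_lt (μ := volume) (ENNReal.ofReal ε)
    (by rw [hK0]; exact ENNReal.ofReal_pos.2 hε)
  set U := U' ∩ ball (0 : 𝔼) (1 / 2) with hU
  have hUo : IsOpen U := hU'o.inter isOpen_ball
  have hKU : K ⊆ U := Set.subset_inter hKU' (hKS.trans Set.inter_subset_right)
  obtain ⟨t', ht'0, ht'⟩ := hK.exists_thickening_subset_open hUo hKU
  set t := min t' (1 / 8) with ht
  have ht0 : 0 < t := by positivity
  let b : ContDiffBump (0 : 𝔼) := ⟨t / 2, t, by positivity, by linarith⟩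
  set η : 𝔼 → ℝ := b.normed volume with hη
  have hηc : Continuous η := b.continuous_normed
  have hηs : HasCompactSupport η := b.hasCompactSupport_normed
  have hη0 : ∀ x, 0 ≤ η x := b.nonneg_normed
  have hη1 : ∫ x, η x = 1 := b.integral_normed
  have hηn : ∀ x, η (-x) = η x := b.normed_neg
  have hηsupp : ∀ x, η x ≠ 0 → ‖x‖ < t := fun x hx => by
    have : x ∈ Function.support η := hx
    rw [hη, b.support_normed_eq] at this
    simpa using this
  have hfi : ∀ j, Integrable (f j) ν := fun j => Integrable.of_bound (hfm j) 1 (hf1 j)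
  have hgi : ∀ i, Integrable (g i) τ := fun i => Integrable.of_bound (hgm i) 1 (hg1 i)
  have h1i : Integrable (fun _ : 𝔼 => (1 : ℝ)) ν := integrable_const 1
  have hsub : ∀ j y, P j * mollify η ν (fun _ => 1) y - mollify η ν (f j) y
      = mollify η ν (fun z => P j - f j z) y := by
    intro j y
    simp only [mollify]
    rw [← integral_const_mul, ← integral_sub ((integrable_kernel_mul hηc hηs h1i y).const_mul _)
      (integrable_kernel_mul hηc hηs (hfi j) y)]
    congr 1; ext z; ring
  have hFN : ∀ j y, |mollify η ν (f j) y| ≤ mollify η ν (fun _ => 1) y := by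
    intro j y
    rw [← Real.norm_eq_abs]
    refine norm_integral_le_of_norm_le (integrable_kernel_mul hηc hηs h1i y) ?_
    filter_upwards [hf1 j] with z hz
    rw [norm_mul, Real.norm_of_nonneg (hη0 _)]
    exact mul_le_mul_of_nonneg_left hz (hη0 _)
  have hN0 : ∀ y, 0 ≤ mollify η ν (fun _ => 1) y := fun y =>
    integral_nonneg fun z => mul_nonneg (hη0 _) zero_le_one
  have hderiv : ∀ (ψ : 𝔼 → ℝ), ContDiff ℝ ∞ ψ → HasCompactSupport ψ → ∀ α z,
      pderivMulti α (η ⋆[ContinuousLinearMap.mul ℝ ℝ, volume] ψ) z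
        = ∫ y, pderivMulti α ψ y * η (y - z) := by
    intro ψ hψ hψc α z
    rw [pderivMulti_eq_iterPDeriv, iterPDeriv_convolution hηc hψ hψc, convolution_mul_eq hηn,
      pderivMulti_eq_iterPDeriv]
  have hpc : ∀ (ψ : 𝔼 → ℝ), ContDiff ℝ ∞ ψ → HasCompactSupport ψ → ∀ α : Fin d → ℕ,
      Continuous (pderivMulti α ψ) ∧ ∃ M, ∀ y, ‖pderivMulti α ψ y‖ ≤ M := by
    intro ψ hψ hψc α
    rw [pderivMulti_eq_iterPDeriv]
    have hc : Continuous (iterPDeriv (multiList α) ψ) := (hψ.iterPDeriv _).continuous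
    have hs : HasCompactSupport (iterPDeriv (multiList α) ψ) :=
      hψc.of_isClosed_subset (isClosed_tsupport _) (tsupport_iterPDeriv_subset _ ψ)
    exact ⟨hc, hs.exists_bound_of_continuous hc⟩
  have hlt := h R (mollify η ν fun _ => 1) (fun i => mollify η τ (g i)) (fun j => mollify η ν (f j))
    hR0 hR1 (continuous_mollify hηc hηs h1i) (fun i => continuous_mollify hηc hηs (hgi i))
    (fun j => continuous_mollify hηc hηs (hfi j)) hFN hN0 ?_ ?_ ?_ ?_ U hUo.measurableSet
    (Set.inter_subset_right.trans ball_subset_closedBall)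
    (ENNReal.toReal_le_of_le_ofReal hε.le ((measure_mono Set.inter_subset_left).trans hU'ε.le))
  · have hKr : c₀ < ν.real K := (ENNReal.ofReal_lt_iff_lt_toReal hc₀.le (measure_ne_top _ _)).1 hKν
    have := measureReal_le_setIntegral_mollify (ν := ν) hηc hηs hη0 hη1 hK.measurableSet
      hUo.measurableSet (fun z hz y hy => ht' (mem_thickening_iff.2 ⟨z, hz, by
        rw [dist_eq_norm]
        exact (hηsupp _ hy).trans_le (min_le_left _ _)⟩))
    linarith
  · have := setIntegral_abs_mollify_le hηc hηs hη0 hη1 h1i (closedBall (0 : 𝔼) (3 / 4))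
    refine (integral_mono_of_nonneg (ae_of_all _ hN0) ?_ (ae_of_all _ fun y => le_abs_self _)).trans
      (this.trans (by simpa using hν))
    exact (continuous_mollify hηc hηs h1i).abs.continuousOn.integrableOn_compact
      (isCompact_closedBall _ _)
  · intro i
    refine (setIntegral_abs_mollify_le hηc hηs hη0 hη1 (hgi i) _).trans ?_
    refine (integral_mono_ae (hgi i).abs (integrable_const 1) (hg1 i)).trans ?_
    simpa using hτ
  · intro j
    simp only [hsub]
    exact (setIntegral_abs_mollify_le hηc hηs hη0 hη1 ((integrable_const _).sub (hfi j)) _).trans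
      (hPf j)
  · intro ψ hψ hψc hψs i
    obtain ⟨M, hM⟩ := hψc.exists_bound_of_continuous hψ.continuous
    rw [integral_mul_mollify hηc hηs (hgi i) hψ.continuous.aestronglyMeasurable hM]
    have key := heq (η ⋆[ContinuousLinearMap.mul ℝ ℝ, volume] ψ)
      (hψc.contDiff_convolution_right _ hηc.locallyIntegrable hψ)
      (hηs.convolution _ hψc) ?_ i
    · simp only [hderiv ψ hψ hψc, convolution_mul_eq hηn] at key
      rw [← key]
      refine Finset.sum_congr rfl fun α _ => ?_
      congr 2
      refine Finset.sum_congr rfl fun j _ => ?_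
      obtain ⟨hc, M', hM'⟩ := hpc ψ hψ hψc α
      rw [integral_mul_mollify hηc hηs (hfi j) hc.aestronglyMeasurable hM']
    · have hs : Function.support (η ⋆[ContinuousLinearMap.mul ℝ ℝ, volume] ψ)
          ⊆ closedBall 0 (7 / 8) := by
        refine (support_convolution_subset _).trans ?_
        rintro _ ⟨x, hx, y, hy, rfl⟩
        have h1 := hηsupp x hx
        have h2 := hψs (subset_tsupport _ hy)
        rw [mem_closedBall_zero_iff] at h2 ⊢
        have h3 : t ≤ 1 / 8 := min_le_right _ _
        refine (norm_add_le _ _).trans ?_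
        linarith
      exact (closure_minimal hs isClosed_closedBall).trans (closedBall_subset_ball (by norm_num))

end Concentration

section BlowUp

open Module
open scoped ContDiff Topology

/-- A function bounded below by a power of the radius is doubling at arbitrarily small radii. -/
lemma exists_doubling {M : ℝ → ℝ} {C δ : ℝ} (d : ℕ) (hδ : 0 < δ)
    (h : ∀ r, 0 < r → r < δ → r ^ d ≤ C * M r) (hC : 0 ≤ C) :
    ∃ r, 0 < r ∧ r < δ ∧ (1 / 4) ^ (d + 1) * M r ≤ M (r / 4) := by
  by_contra! hcon
  set r := δ / 2 with hr
  have hr0 : 0 < r := by positivity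
  have hrδ : r < δ := by linarith
  have hj : ∀ j : ℕ, 0 < r / 4 ^ j ∧ r / 4 ^ j < δ := fun j =>
    ⟨by positivity, (div_le_self hr0.le (one_le_pow₀ (by norm_num))).trans_lt hrδ⟩
  have hind : ∀ j : ℕ, M (r / 4 ^ j) ≤ ((1 / 4) ^ (d + 1)) ^ j * M r := by
    intro j
    induction j with
    | zero => simp
    | succ j ih =>
      have := hcon _ (hj j).1 (hj j).2
      have h2 : r / 4 ^ (j + 1) = r / 4 ^ j / 4 := by rw [pow_succ]; field_simp
      rw [h2]
      refine this.le.trans ?_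
      rw [pow_succ _ j, mul_comm (_ ^ j), mul_assoc]
      exact mul_le_mul_of_nonneg_left ih (by positivity)
  have hlim : Filter.Tendsto (fun j : ℕ => C * M r * (1 / 4 : ℝ) ^ j) Filter.atTop (𝓝 0) := by
    simpa using (tendsto_pow_atTop_nhds_zero_of_lt_one (by norm_num : (0 : ℝ) ≤ 1 / 4)
      (by norm_num)).const_mul (C * M r)
  have hle : r ^ d ≤ 0 := by
    refine ge_of_tendsto' hlim fun j => ?_
    have h1 := (h _ (hj j).1 (hj j).2).trans (mul_le_mul_of_nonneg_left (hind j) hC)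
    rw [div_pow, ← pow_mul, mul_comm j d, div_le_iff₀ (by positivity)] at h1
    refine h1.trans (le_of_eq ?_)
    rw [← pow_mul, add_mul, pow_add, one_mul, one_div, inv_pow, inv_pow]
    field_simp
  exact absurd hle (not_le.2 (by positivity))

variable {d : ℕ}

local notation "𝔼" => EuclideanSpace ℝ (Fin d)

lemma iterPDeriv_comp_smul_sub {ψ : 𝔼 → ℝ} (hψ : ContDiff ℝ ∞ ψ) (a : ℝ) (x : 𝔼)
    (L : List (Fin d)) :
    iterPDeriv L (fun y => ψ (a • (y - x)))
      = fun y => a ^ L.length * iterPDeriv L ψ (a • (y - x)) := by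
  induction L with
  | nil => simp [iterPDeriv]
  | cons i L ih =>
    change pderiv' i (iterPDeriv L _) = _
    rw [ih]
    ext y
    have hd : DifferentiableAt ℝ (iterPDeriv L ψ) (a • (y - x)) :=
      ((hψ.iterPDeriv L).differentiable (by simp)).differentiableAt
    have h1 : HasFDerivAt (fun y : 𝔼 => a • (y - x)) (a • ContinuousLinearMap.id ℝ 𝔼) y :=
      ((hasFDerivAt_id y).sub_const x).const_smul a
    have h2 := (hd.hasFDerivAt.comp y h1).const_mul (a ^ L.length)
    change fderiv ℝ (fun y => a ^ L.length * iterPDeriv L ψ (a • (y - x))) y _ = _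
    rw [HasFDerivAt.fderiv (f := fun y => a ^ L.length * iterPDeriv L ψ (a • (y - x))) h2]
    simp only [smul_apply, ContinuousLinearMap.comp_apply,
      ContinuousLinearMap.id_apply, map_smul, smul_eq_mul, List.length_cons, pow_succ]
    change _ = _ * fderiv ℝ (iterPDeriv L ψ) (a • (y - x)) _
    ring

lemma pderivMulti_comp_smul_sub {ψ : 𝔼 → ℝ} (hψ : ContDiff ℝ ∞ ψ) (a : ℝ) (x : 𝔼)
    (α : Fin d → ℕ) (y : 𝔼) :
    pderivMulti α (fun y => ψ (a • (y - x))) y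
      = a ^ (∑ l, α l) * pderivMulti α ψ (a • (y - x)) := by
  rw [pderivMulti_eq_iterPDeriv, pderivMulti_eq_iterPDeriv, iterPDeriv_comp_smul_sub hψ,
    length_multiList]

lemma pderivMulti_eq_zero_of_notMem {ψ : 𝔼 → ℝ} {B : Set 𝔼} (hB : tsupport ψ ⊆ B)
    (α : Fin d → ℕ) {y : 𝔼} (hy : y ∉ B) : pderivMulti α ψ y = 0 := by
  rw [pderivMulti_eq_iterPDeriv]
  exact image_eq_zero_of_notMem_tsupport fun h => hy (hB (tsupport_iterPDeriv_subset _ ψ h))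

/-- The normalized rescaling of a measure at scale `r` around `x`. -/
noncomputable def rescale (c : ENNReal) (μ : Measure 𝔼) (x : 𝔼) (r : ℝ) : Measure 𝔼 :=
  c • (μ.restrict (closedBall x r)).map fun y => r⁻¹ • (y - x)

/-- The rescaling homeomorphism. -/
noncomputable def rescaleHomeomorph (x : 𝔼) (r : ℝ) (hr : r ≠ 0) : 𝔼 ≃ₜ 𝔼 :=
  (Homeomorph.subRight x).trans (Homeomorph.smulOfNeZero r⁻¹ (inv_ne_zero hr))

lemma coe_rescaleHomeomorph (x : 𝔼) (r : ℝ) (hr : r ≠ 0) :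
    ⇑(rescaleHomeomorph x r hr) = fun y => r⁻¹ • (y - x) := rfl

lemma measurableEmbedding_rescale {x : 𝔼} {r : ℝ} (hr : r ≠ 0) :
    MeasurableEmbedding (fun y : 𝔼 => r⁻¹ • (y - x) : 𝔼 → 𝔼) :=
  (rescaleHomeomorph x r hr).measurableEmbedding

lemma integral_rescale {c : ENNReal} {μ : Measure 𝔼} {x : 𝔼} {r : ℝ} (hr : r ≠ 0) (h : 𝔼 → ℝ) :
    ∫ z, h z ∂rescale c μ x r = c.toReal * ∫ y in closedBall x r, h (r⁻¹ • (y - x)) ∂μ := by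
  rw [rescale, integral_smul_measure, (measurableEmbedding_rescale hr).integral_map, smul_eq_mul]

lemma rescale_apply {c : ENNReal} {μ : Measure 𝔼} {x : 𝔼} {r : ℝ} (hr : r ≠ 0) (s : Set 𝔼) :
    rescale c μ x r s = c * μ.restrict (closedBall x r) ((fun y => r⁻¹ • (y - x)) ⁻¹' s) := by
  rw [rescale, Measure.smul_apply, (measurableEmbedding_rescale hr).map_apply, smul_eq_mul]

lemma isFiniteMeasure_rescale {c : ENNReal} {μ : Measure 𝔼} {x : 𝔼} {r : ℝ}
    [IsFiniteMeasure μ] (hc : c ≠ ⊤) :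
    IsFiniteMeasure (rescale c μ x r) := by
  unfold rescale
  exact Measure.smul_finite _ hc

lemma rescale_comp_inv {x : 𝔼} {r : ℝ} (hr : r ≠ 0) (y : 𝔼) : x + r • r⁻¹ • (y - x) = y := by
  rw [smul_inv_smul₀ hr, add_sub_cancel]

lemma aestronglyMeasurable_rescale {c : ENNReal} {μ : Measure 𝔼} {x : 𝔼} {r : ℝ}
    {F : Type*} [TopologicalSpace F]
    [TopologicalSpace.PseudoMetrizableSpace F] (hr : r ≠ 0) {h : 𝔼 → F}
    (hh : AEStronglyMeasurable h μ) :
    AEStronglyMeasurable (fun z => h (x + r • z)) (rescale c μ x r) := by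
  refine AEStronglyMeasurable.smul_measure ?_ c
  rw [(measurableEmbedding_rescale hr).aestronglyMeasurable_map_iff]
  have : (fun z => h (x + r • z)) ∘ (fun y : 𝔼 => r⁻¹ • (y - x)) = h := by
    ext y; simp only [Function.comp, rescale_comp_inv hr]
  rw [this]
  exact hh.restrict

lemma ae_rescale {c : ENNReal} {μ : Measure 𝔼} {x : 𝔼} {r : ℝ} (hr : r ≠ 0)
    {p : 𝔼 → Prop} (hp : ∀ᵐ y ∂μ, p y) :
    ∀ᵐ z ∂rescale c μ x r, p (x + r • z) := by
  refine Measure.ae_smul_measure ?_ c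
  rw [(measurableEmbedding_rescale hr).ae_map_iff]
  simp only [rescale_comp_inv hr]
  exact ae_restrict_of_ae hp

end BlowUp

section Structure

open scoped ContDiff Topology

variable {d : ℕ}

local notation "𝔼" => EuclideanSpace ℝ (Fin d)

/-- The equation satisfied by the rescaled measures. -/
lemma rescaled_equation {m n k : ℕ} {A : (Fin d → ℕ) → Matrix (Fin n) (Fin m) ℝ} {Ω : Set 𝔼}
    {ρ τ : Measure 𝔼} {f : 𝔼 → EuclideanSpace ℝ (Fin m)} {g : 𝔼 → EuclideanSpace ℝ (Fin n)}
    (heq : ∀ φ : 𝔼 → ℝ, ContDiff ℝ ∞ φ → HasCompactSupport φ → tsupport φ ⊆ Ω → ∀ i : Fin n,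
      ∑ α ∈ multiIdxLe d k, (-1 : ℝ) ^ (∑ l, α l) *
        ∑ j, A α i j * ∫ x, pderivMulti α φ x * f x j ∂ρ = ∫ x, φ x * g x i ∂τ)
    {x : 𝔼} {r : ℝ} (hr : 0 < r) (hx : closedBall x r ⊆ Ω) (c : ENNReal) {ψ : 𝔼 → ℝ}
    (hψ : ContDiff ℝ ∞ ψ) (hψc : HasCompactSupport ψ) (hψs : tsupport ψ ⊆ ball 0 1) (i : Fin n) :
    ∑ α ∈ multiIdxLe d k, r ^ (k - ∑ l, α l) * ((-1) ^ (∑ l, α l) *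
        ∑ j, A α i j * ∫ y, pderivMulti α ψ y * f (x + r • y) j ∂rescale c ρ x r)
      = ∫ y, ψ y * g (x + r • y) i ∂rescale (ENNReal.ofReal (r ^ k) * c) τ x r := by
  set e := rescaleHomeomorph x r hr.ne' with he
  set φ : 𝔼 → ℝ := fun y => ψ (r⁻¹ • (y - x)) with hφ
  have hφe : φ = ψ ∘ e := rfl
  have hball : ∀ y, r⁻¹ • (y - x) ∈ ball (0 : 𝔼) 1 → y ∈ closedBall x r := by
    intro y hy
    rw [mem_ball_zero_iff, norm_smul, norm_inv, Real.norm_of_nonneg hr.le, inv_mul_lt_iff₀ hr,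
      mul_one] at hy
    rw [mem_closedBall, dist_eq_norm]
    exact hy.le
  have hφs : tsupport φ ⊆ closedBall x r := by
    rw [hφe, tsupport_comp_eq_preimage]
    exact fun y hy => hball y (hψs hy)
  have hφd : ContDiff ℝ ∞ φ := hψ.comp (by fun_prop)
  have hφc : HasCompactSupport φ := hψc.comp_homeomorph e
  have key := heq φ hφd hφc (hφs.trans hx) i
  have h1 : ∀ α j, ∫ y, pderivMulti α φ y * f y j ∂ρ
      = (r⁻¹) ^ (∑ l, α l) * ∫ y in closedBall x r, pderivMulti α ψ (r⁻¹ • (y - x)) * f y j ∂ρ := by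
    intro α j
    rw [← setIntegral_eq_integral_of_forall_compl_eq_zero (s := closedBall x r),
      ← integral_const_mul]
    · refine integral_congr_ae (ae_of_all _ fun y => ?_)
      simp only [hφ, pderivMulti_comp_smul_sub hψ, mul_assoc]
    · intro y hy
      rw [pderivMulti_eq_zero_of_notMem hφs α hy, zero_mul]
  have h2 : ∫ y, φ y * g y i ∂τ = ∫ y in closedBall x r, ψ (r⁻¹ • (y - x)) * g y i ∂τ := by
    rw [← setIntegral_eq_integral_of_forall_compl_eq_zero (s := closedBall x r)]
    intro y hy
    rw [image_eq_zero_of_notMem_tsupport (fun h => hy (hφs h)), zero_mul]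
  simp only [integral_rescale hr.ne', rescale_comp_inv hr.ne']
  rw [ENNReal.toReal_mul, ENNReal.toReal_ofReal (by positivity), ← h2, ← key, Finset.mul_sum]
  refine Finset.sum_congr rfl fun α hα => ?_
  have hαk : ∑ l, α l ≤ k := by
    simp only [multiIdxLe, Finset.mem_filter] at hα
    exact hα.2
  simp only [h1, Finset.mul_sum]
  refine Finset.sum_congr rfl fun j _ => ?_
  rw [pow_sub₀ _ hr.ne' hαk, inv_pow]
  ring

open scoped Pointwise in
/-- The polar at a singular blow-up point lies in the wave cone. -/
theorem mem_waveCone_of_tendsto [Nontrivial 𝔼] {m n k : ℕ} (hk : 1 ≤ k)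
    {A : (Fin d → ℕ) → Matrix (Fin n) (Fin m) ℝ} {Ω : Set 𝔼} (hΩ : IsOpen Ω)
    {ρ τ : Measure 𝔼} [IsFiniteMeasure ρ] [IsFiniteMeasure τ]
    {f : 𝔼 → EuclideanSpace ℝ (Fin m)} (hf : AEStronglyMeasurable f ρ)
    (hf1 : ∀ᵐ x ∂ρ, ‖f x‖ = 1) {g : 𝔼 → EuclideanSpace ℝ (Fin n)}
    (hg : AEStronglyMeasurable g τ) (hg1 : ∀ᵐ x ∂τ, ‖g x‖ = 1)
    (heq : ∀ φ : 𝔼 → ℝ, ContDiff ℝ ∞ φ → HasCompactSupport φ → tsupport φ ⊆ Ω → ∀ i : Fin n,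
      ∑ α ∈ multiIdxLe d k, (-1 : ℝ) ^ (∑ l, α l) *
        ∑ j, A α i j * ∫ x, pderivMulti α φ x * f x j ∂ρ = ∫ x, φ x * g x i ∂τ)
    {S : Set 𝔼} (hS : MeasurableSet S) (hS0 : volume S = 0) {x : 𝔼} (hx : x ∈ Ω)
    (hL : Filter.Tendsto (fun r => ⨍ y in closedBall x r, ‖f y - f x‖ ∂ρ) (𝓝[>] 0) (𝓝 0))
    (hτ : ∃ C : ENNReal, C ≠ ⊤ ∧ Filter.Tendsto
      (fun r => τ (closedBall x r) / ρ (closedBall x r)) (𝓝[>] 0) (𝓝 C))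
    (hv : ∃ C : ENNReal, C ≠ ⊤ ∧ Filter.Tendsto
      (fun r => volume (closedBall x r) / ρ (closedBall x r)) (𝓝[>] 0) (𝓝 C))
    (hSx : Filter.Tendsto (fun r => ρ (S ∩ closedBall x r) / ρ (closedBall x r)) (𝓝[>] 0) (𝓝 1)) :
    (fun j => f x j) ∈ waveCone k A := by
  by_contra hP
  set θ : ℝ := (1 / 4) ^ (d + 1) with hθ
  have hθ0 : 0 < θ := by positivity
  obtain ⟨ε, hε, h⟩ := exists_measureReal_inter_ball_le (d := d) hk hP
    (by positivity : 0 < θ / 4)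
  set M : ℝ → ℝ := fun r => ρ.real (closedBall x r) with hM
  have hratio : ∀ (μ : Measure 𝔼) [IsLocallyFiniteMeasure μ], (∃ C : ENNReal, C ≠ ⊤ ∧
      Filter.Tendsto (fun r => μ (closedBall x r) / ρ (closedBall x r)) (𝓝[>] 0) (𝓝 C)) →
      ∃ C : ℝ, 0 ≤ C ∧ ∀ᶠ r in 𝓝[>] (0 : ℝ), μ.real (closedBall x r) ≤ C * M r := by
    rintro μ _ ⟨C, hC, hlim⟩
    refine ⟨(C + 1).toReal, ENNReal.toReal_nonneg, ?_⟩
    have hlt : C < C + 1 := ENNReal.lt_add_right hC one_ne_zero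
    filter_upwards [hlim.eventually_lt_const hlt] with r hr
    have hC1 : C + 1 ≠ ⊤ := ENNReal.add_ne_top.2 ⟨hC, ENNReal.one_ne_top⟩
    have hle : μ (closedBall x r) ≤ (C + 1) * ρ (closedBall x r) := by
      refine (ENNReal.div_le_iff_le_mul (Or.inr hC1) (Or.inl (measure_ne_top _ _))).1 hr.le
    have := ENNReal.toReal_mono (ENNReal.mul_ne_top hC1 (measure_ne_top _ _)) hle
    rwa [ENNReal.toReal_mul] at this
  obtain ⟨Cτ, hCτ, hτe⟩ := hratio τ hτ
  obtain ⟨Cv, hCv, hve⟩ := hratio volume hv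
  have hLe : ∀ᶠ r in 𝓝[>] (0 : ℝ), ⨍ y in closedBall x r, ‖f y - f x‖ ∂ρ ≤ ε :=
    hL.eventually_le_const hε
  have hSe : ∀ᶠ r in 𝓝[>] (0 : ℝ), M r / 2 ≤ ρ.real (S ∩ closedBall x r) := by
    filter_upwards [hSx.eventually_const_lt (by norm_num : (1 / 2 : ENNReal) < 1)] with r hr
    have h1 : 1 / 2 * ρ (closedBall x r) ≤ ρ (S ∩ closedBall x r) :=
      ENNReal.mul_le_of_le_div hr.le
    have := ENNReal.toReal_mono (measure_ne_top _ _) h1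
    rw [ENNReal.toReal_mul] at this
    simp only [hM, Measure.real]
    norm_num at this
    linarith
  have hΩe : ∀ᶠ r in 𝓝[>] (0 : ℝ), closedBall x r ⊆ Ω := by
    obtain ⟨δ, hδ, hb⟩ := Metric.isOpen_iff.1 hΩ x hx
    filter_upwards [Ioo_mem_nhdsGT hδ] with r hr
    exact (closedBall_subset_ball hr.2).trans hb
  have h1e : ∀ᶠ r in 𝓝[>] (0 : ℝ), r * Cτ ≤ 1 ∧ r ≤ 1 := by
    filter_upwards [Ioo_mem_nhdsGT (by positivity : (0 : ℝ) < 1 / (Cτ + 1))] with r hr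
    have h2 := hr.2
    rw [lt_div_iff₀ (by positivity)] at h2
    have := mul_nonneg hr.1.le hCτ
    have := hr.1
    constructor
    · linarith
    · by_contra! h3
      nlinarith
  obtain ⟨δ, hδ, hall⟩ := mem_nhdsGT_iff_exists_Ioo_subset.1
    (((((hτe.and hve).and hLe).and hSe).and hΩe).and h1e)
  have hω : 0 < volume.real (ball (0 : 𝔼) 1) :=
    ENNReal.toReal_pos (measure_ball_pos _ _ one_pos).ne' measure_ball_lt_top.ne
  have hvr : ∀ r, 0 < r → r < δ → r ^ d * volume.real (ball (0 : 𝔼) 1) ≤ Cv * M r := by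
    intro r hr hrδ
    have := (hall ⟨hr, hrδ⟩).1.1.1.1.2
    rwa [Measure.addHaar_real_closedBall _ _ hr.le, finrank_euclideanSpace_fin] at this
  obtain ⟨r, hr, hrδ, hdoub⟩ := exists_doubling (M := M)
    (C := Cv / volume.real (ball (0 : 𝔼) 1)) d hδ (fun r hr hrδ => by
      rw [div_mul_eq_mul_div, le_div_iff₀ hω]
      exact hvr r hr hrδ) (by positivity)
  obtain ⟨⟨⟨⟨⟨hr1, hr2⟩, hr3⟩, hr4⟩, hr5⟩, hr6, hr7⟩ := hall ⟨hr, hrδ⟩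
  have hMr : 0 < M r := by
    by_contra! hneg
    have h2 := hvr r hr hrδ
    have h3 : 0 < r ^ d * volume.real (ball (0 : 𝔼) 1) := by positivity
    nlinarith
  obtain ⟨⟨⟨_, hq⟩, _⟩, _⟩ := hall ⟨by positivity, by linarith⟩ (a := r / 4)
  set c : ENNReal := ENNReal.ofReal (M r)⁻¹ with hc
  have hcr : c.toReal = (M r)⁻¹ := ENNReal.toReal_ofReal (by positivity)
  have hct : c ≠ ⊤ := ENNReal.ofReal_ne_top
  have hct' : ENNReal.ofReal (r ^ k) * c ≠ ⊤ := ENNReal.mul_ne_top ENNReal.ofReal_ne_top hct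
  have : IsFiniteMeasure (rescale c ρ x r) := isFiniteMeasure_rescale hct
  have : IsFiniteMeasure (rescale (ENNReal.ofReal (r ^ k) * c) τ x r) :=
    isFiniteMeasure_rescale hct'
  have hcoord : ∀ {p : ℕ} (v : EuclideanSpace ℝ (Fin p)) (j : Fin p), |v j| ≤ ‖v‖ := fun v j =>
    PiLp.norm_apply_le v j
  have hfin := h r (rescale c ρ x r) (rescale (ENNReal.ofReal (r ^ k) * c) τ x r)
    (fun j z => f (x + r • z) j) (fun i z => g (x + r • z) i) hr.le hr7
    (fun j => (EuclideanSpace.proj j : _ →L[ℝ] ℝ).continuous.comp_aestronglyMeasurable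
      (aestronglyMeasurable_rescale hr.ne' hf))
    (fun i => (EuclideanSpace.proj i : _ →L[ℝ] ℝ).continuous.comp_aestronglyMeasurable
      (aestronglyMeasurable_rescale hr.ne' hg))
    (fun j => by
      filter_upwards [ae_rescale hr.ne' hf1] with z hz
      exact (hcoord _ _).trans hz.le)
    (fun i => by
      filter_upwards [ae_rescale hr.ne' hg1] with z hz
      exact (hcoord _ _).trans hz.le) ?_ ?_ ?_ ?_
    ((rescaleHomeomorph x r hr.ne') '' S) ?_ ?_
  · rw [Measure.real, rescale_apply hr.ne', ENNReal.toReal_mul, hcr] at hfin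
    have hsub : S ∩ closedBall x (r / 4) ⊆ ((fun y => r⁻¹ • (y - x)) ⁻¹'
        ((rescaleHomeomorph x r hr.ne') '' S ∩ ball 0 (1 / 2))) ∩ closedBall x r := by
      rintro y ⟨hyS, hy⟩
      rw [mem_closedBall] at hy
      refine ⟨⟨⟨y, hyS, rfl⟩, ?_⟩, ?_⟩
      · rw [mem_ball_zero_iff, norm_smul, norm_inv, Real.norm_of_nonneg hr.le, inv_mul_lt_iff₀ hr,
          ← dist_eq_norm]
        linarith
      · rw [mem_closedBall]; linarith
    have hle : ρ.real (S ∩ closedBall x (r / 4)) ≤ (ρ.restrict (closedBall x r)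
        ((fun y => r⁻¹ • (y - x)) ⁻¹'
        ((rescaleHomeomorph x r hr.ne') '' S ∩ ball 0 (1 / 2)))).toReal := by
      rw [Measure.restrict_apply' measurableSet_closedBall]
      exact ENNReal.toReal_mono (measure_ne_top _ _) (measure_mono hsub)
    have h2 : θ / 2 * M r ≤ θ / 4 * M r := by
      rw [inv_mul_le_iff₀ hMr] at hfin
      linarith
    nlinarith [mul_pos hθ0 hMr]
  · rw [Measure.real, rescale_apply hr.ne', ENNReal.toReal_mul, hcr, Set.preimage_univ,
      Measure.restrict_apply_univ]
    exact (inv_mul_cancel₀ hMr.ne').le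
  · rw [Measure.real, rescale_apply hr.ne', ENNReal.toReal_mul, ENNReal.toReal_mul, hcr,
      Set.preimage_univ, Measure.restrict_apply_univ, ENNReal.toReal_ofReal (by positivity)]
    change r ^ k * (M r)⁻¹ * τ.real (closedBall x r) ≤ 1
    have h2 : r ^ k ≤ r := pow_le_of_le_one hr.le hr7 (by omega)
    calc r ^ k * (M r)⁻¹ * τ.real (closedBall x r) ≤ r * (M r)⁻¹ * (Cτ * M r) := by gcongr
      _ = r * Cτ := by field_simp
      _ ≤ 1 := hr6
  · intro j
    rw [integral_rescale hr.ne', hcr]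
    simp only [rescale_comp_inv hr.ne']
    rw [setAverage_eq, smul_eq_mul] at hr3
    refine le_trans (mul_le_mul_of_nonneg_left ?_ (by positivity)) hr3
    have hfi : Integrable f ρ := Integrable.of_bound hf 1 (hf1.mono fun y hy => hy.le)
    refine integral_mono_of_nonneg (ae_of_all _ fun y => abs_nonneg _)
      ((hfi.sub (integrable_const _)).norm.integrableOn) (ae_of_all _ fun y => ?_)
    simp only
    rw [abs_sub_comm]
    exact hcoord (f y - f x) j
  · intro ψ hψ hψc hψs i
    exact rescaled_equation heq hr hr5 c hψ hψc hψs i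
  · exact (rescaleHomeomorph x r hr.ne').measurableEmbedding.measurableSet_image.2 hS
  · have : (rescaleHomeomorph x r hr.ne') '' S = r⁻¹ • ((fun y => y + -x) '' S) := by
      rw [← Set.image_smul, Set.image_image]
      refine Set.image_congr fun y _ => ?_
      simp only [coe_rescaleHomeomorph, sub_eq_add_neg]
    rw [this, Measure.addHaar_smul]
    simp [hS0]

end Structure

/-- **Structure theorem for measures solving `𝒜 μ = σ`**.
Here `μ = f·ρ` (with `ρ = |μ|` and `|f| = 1` `ρ`-a.e.) is a finite `ℝ^m`-valued Radon
measure on the open set `Ω`, `σ = g·τ` (with `τ = |σ|` and `|g| = 1` `τ`-a.e.) is a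
finite `ℝ^n`-valued Radon measure on `Ω`, the operator `𝒜` has order `k ≥ 1`, and
`𝒜 μ = σ` in the sense of distributions.  Then the polar `f = dμ/d|μ|` lies in the
wave cone `Λ_𝒜` at `|μ|^s`-a.e. point. -/
theorem statement1 {d m n k : ℕ} (hk : 1 ≤ k)
    (A : (Fin d → ℕ) → Matrix (Fin n) (Fin m) ℝ)
    (Ω : Set (EuclideanSpace ℝ (Fin d))) (hΩ : IsOpen Ω)
    (ρ : Measure (EuclideanSpace ℝ (Fin d))) [IsFiniteMeasure ρ]
    (hρΩ : ρ Ωᶜ = 0)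
    (f : EuclideanSpace ℝ (Fin d) → EuclideanSpace ℝ (Fin m))
    (hf : AEStronglyMeasurable f ρ)
    (hpolar : ∀ᵐ x ∂ρ, ‖f x‖ = 1)
    (τ : Measure (EuclideanSpace ℝ (Fin d))) [IsFiniteMeasure τ]
    (hτΩ : τ Ωᶜ = 0)
    (g : EuclideanSpace ℝ (Fin d) → EuclideanSpace ℝ (Fin n))
    (hg : AEStronglyMeasurable g τ)
    (hgpolar : ∀ᵐ x ∂τ, ‖g x‖ = 1)
    (heq : ∀ φ : EuclideanSpace ℝ (Fin d) → ℝ,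
      ContDiff ℝ (⊤ : ℕ∞) φ → HasCompactSupport φ → tsupport φ ⊆ Ω →
      ∀ i : Fin n,
        ∑ α ∈ multiIdxLe d k, (-1 : ℝ) ^ (∑ l, α l) *
          ∑ j, A α i j * ∫ x, pderivMulti α φ x * f x j ∂ρ
          = ∫ x, φ x * g x i ∂τ) :
    ∀ᵐ x ∂(ρ.singularPart volume), (fun j => f x j) ∈ waveCone k A := by
  rcases Nat.eq_zero_or_pos d with rfl | hd
  · have hac : ρ ≪ volume := by
      intro s hs
      rcases s.eq_empty_or_nonempty with rfl | hne
      · exact measure_empty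
      · rw [Subsingleton.eq_univ_of_nonempty hne] at hs
        exact absurd hs (isOpen_univ.measure_pos _ Set.univ_nonempty).ne'
    rw [(Measure.singularPart_eq_zero _ _).2 hac]
    simp
  · have : Nonempty (Fin d) := ⟨⟨0, hd⟩⟩
    obtain ⟨s, hs, hs1, hs2⟩ := Measure.mutuallySingular_singularPart ρ
      (volume : Measure (EuclideanSpace ℝ (Fin d)))
    have hle := Measure.singularPart_le ρ (volume : Measure (EuclideanSpace ℝ (Fin d)))
    have hfi : Integrable f ρ := Integrable.of_bound hf 1 (hpolar.mono fun y hy => hy.le)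
    have hmem : ∀ᵐ x ∂(ρ.singularPart volume), x ∈ sᶜ := measure_eq_zero_iff_ae_notMem.1 hs1
    have hxΩ : ∀ᵐ x ∂ρ, x ∈ Ω := by
      filter_upwards [measure_eq_zero_iff_ae_notMem.1 hρΩ] with x hx
      simpa using hx
    filter_upwards [hmem, ae_mono hle hxΩ,
      ae_mono hle ((Besicovitch.vitaliFamily ρ).ae_tendsto_average_norm_sub
        hfi.locallyIntegrable),
      ae_mono hle (Besicovitch.ae_tendsto_rnDeriv τ ρ), ae_mono hle (Measure.rnDeriv_lt_top τ ρ),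
      ae_mono hle (Besicovitch.ae_tendsto_rnDeriv volume ρ),
      ae_mono hle (Measure.rnDeriv_lt_top volume ρ),
      ae_mono hle (Besicovitch.ae_tendsto_measure_inter_div_of_measurableSet ρ hs.compl)]
      with x hxs hxΩ hL hτ hτ' hv hv' hS
    rw [Set.indicator_of_mem hxs] at hS
    exact mem_waveCone_of_tendsto hk hΩ hf hpolar hg hgpolar heq hs.compl hs2 hxΩ
      (hL.comp (Besicovitch.tendsto_filterAt ρ x)) ⟨_, hτ'.ne, hτ⟩ ⟨_, hv'.ne, hv⟩ hS
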